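/- Let α ∈ ℝ, 2 ≤ r < ∞, δ(r) = 2(1/2 − 1/r), and let q be defined by 2/q = δ(r) (with q = ∞ when r = 2). There is a constant C, independent of T and u₀, such that for every 0 < T < 1 and every u₀ in the Schwartz class on ℝ², ( ∫_{−T}^{T} ‖ |D_x|^{δ(r)/2} S(t)u₀ ‖_{L^r(ℝ²)}^{q} dt )^{1/q} ≤ C ‖u₀‖_{L²(ℝ²)}. -/

import Mathlib

open MeasureTheory ENNReal NNReal

/-- The dispersion relation of the fifth order KP-I equation with parameter `α`:
`ω(ξ,μ) = ξ⁵ − αξ³ + μ²/ξ` (for `ξ ≠ 0`). -/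
noncomputable def omega5 (α ξ μ : ℝ) : ℝ := ξ ^ 5 - α * ξ ^ 3 + μ ^ 2 / ξ

/-- The Fourier transform on `ℝ²`, with the paper's unitary normalization
`f̂(ξ,μ) = (2π)⁻¹ ∫ f(x,y) e^{−i(xξ+yμ)} dx dy`. -/
noncomputable def ft2 (f : ℝ × ℝ → ℂ) (ξ μ : ℝ) : ℂ :=
  (1 / (2 * Real.pi)) *
    ∫ p : ℝ × ℝ, f p * Complex.exp (-Complex.I * ((p.1 * ξ + p.2 * μ : ℝ) : ℂ))

/-- `|D_x|^σ S(t) u₀`: the free fifth order KP-I evolution of `u₀` with the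
Fourier multiplier `|ξ|^σ` applied, i.e. the function whose spatial Fourier
transform is `|ξ|^σ e^{itω(ξ,μ)} û₀(ξ,μ)`. -/
noncomputable def SfreeDx (α σ : ℝ) (u₀ : ℝ × ℝ → ℂ) (t x y : ℝ) : ℂ :=
  (1 / (2 * Real.pi)) *
    ∫ p : ℝ × ℝ, ((|p.1| ^ σ : ℝ) : ℂ) * ft2 u₀ p.1 p.2 *
      Complex.exp (Complex.I * ((x * p.1 + y * p.2 + t * omega5 α p.1 p.2 : ℝ) : ℂ))

/-- `δ(r) = 2(1/2 − 1/r)`. -/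
noncomputable def delta (r : ℝ) : ℝ := 2 * (1 / 2 - 1 / r)


lemma kp_lint_even (g : ℝ → ℝ≥0∞) :
    ∫⁻ u : ℝ, g |u| ≤ 2 * ∫⁻ u in Set.Ioi (0 : ℝ), g u := by
  rw [← lintegral_add_compl (fun u => g |u|) (measurableSet_Ioi (a := (0 : ℝ))), two_mul]
  have e1 : ∫⁻ u in Set.Ioi (0 : ℝ), g |u| = ∫⁻ u in Set.Ioi (0 : ℝ), g u := by
    refine setLIntegral_congr_fun measurableSet_Ioi ?_
    intro u hu
    simp only
    rw [abs_of_pos hu]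
  have e2 : ∫⁻ u in (Set.Ioi (0 : ℝ))ᶜ, g |u| = ∫⁻ u in Set.Ioi (0 : ℝ), g u := by
    rw [Set.compl_Ioi, ← setLIntegral_congr (Iio_ae_eq_Iic (a := (0 : ℝ)))]
    have hpre : (MeasurableEquiv.neg ℝ) ⁻¹' (Set.Ioi 0) = Set.Iio (0 : ℝ) := by
      ext u; simp
    have hmp : MeasurePreserving (MeasurableEquiv.neg ℝ) volume volume :=
      Measure.measurePreserving_neg volume
    have := hmp.setLIntegral_comp_preimage_emb (MeasurableEquiv.measurableEmbedding _) g (Set.Ioi 0)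
    rw [hpre] at this
    rw [← this]
    refine setLIntegral_congr_fun measurableSet_Iio ?_
    intro u hu
    simp only [MeasurableEquiv.neg_apply]
    rw [abs_of_neg hu]
  rw [e1, e2]

lemma kp_near (δ R : ℝ) (hδ1 : δ < 1) (hR : 0 < R) :
    ∫⁻ u : ℝ, (Set.Iic R).indicator (fun v => ENNReal.ofReal (v ^ (-δ))) |u| ≤
      ENNReal.ofReal (2 / (1 - δ) * R ^ (1 - δ)) := by
  refine (kp_lint_even _).trans ?_
  rw [lintegral_indicator measurableSet_Iic, Measure.restrict_restrict measurableSet_Iic,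
    Set.inter_comm, Set.Ioi_inter_Iic]
  have hi : IntegrableOn (fun v : ℝ => v ^ (-δ)) (Set.Ioc 0 R) := by
    have := (intervalIntegral.intervalIntegrable_rpow' (r := -δ) (a := 0) (b := R) (by linarith))
    rwa [intervalIntegrable_iff_integrableOn_Ioc_of_le hR.le] at this
  rw [← ofReal_integral_eq_lintegral_ofReal hi]
  · rw [← intervalIntegral.integral_of_le hR.le, integral_rpow (Or.inl (by linarith))]
    rw [show (2 : ℝ≥0∞) = ENNReal.ofReal 2 by simp, ← ENNReal.ofReal_mul (by norm_num)]
    apply ENNReal.ofReal_le_ofReal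
    rw [Real.zero_rpow (by linarith), show -δ + 1 = 1 - δ by ring, sub_zero]
    apply le_of_eq; ring
  · filter_upwards [ae_restrict_mem measurableSet_Ioc] with v hv
    exact Real.rpow_nonneg hv.1.le _

lemma kp_far (R : ℝ) (hR : 0 < R) :
    ∫⁻ u : ℝ, (Set.Ioi R).indicator (fun v => ENNReal.ofReal (v ^ (-2 : ℝ))) |u| ≤
      ENNReal.ofReal (2 / R) := by
  refine (kp_lint_even _).trans ?_
  rw [lintegral_indicator measurableSet_Ioi, Measure.restrict_restrict measurableSet_Ioi,
    Set.Ioi_inter_Ioi, sup_eq_left.2 hR.le]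
  have hi := integrableOn_Ioi_rpow_of_lt (a := -2) (by norm_num) hR
  rw [← ofReal_integral_eq_lintegral_ofReal hi]
  · rw [integral_Ioi_rpow_of_lt (by norm_num) hR]
    rw [show (2 : ℝ≥0∞) = ENNReal.ofReal 2 by simp, ← ENNReal.ofReal_mul (by norm_num)]
    apply ENNReal.ofReal_le_ofReal
    norm_num
    rw [Real.rpow_neg_one]
    apply le_of_eq; ring
  · filter_upwards [ae_restrict_mem measurableSet_Ioi] with v hv
    exact Real.rpow_nonneg (hR.le.trans (le_of_lt hv)) _

lemma kp_far' (δ R : ℝ) (hδ0 : 0 < δ) (hR : 0 < R) :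
    ∫⁻ u : ℝ, ((Set.Ioi R).indicator (fun v => ENNReal.ofReal (v ^ (-δ))) |u|) ^ (2 / δ) ≤
      ENNReal.ofReal (2 / R) := by
  refine le_trans (le_of_eq ?_) (kp_far R hR)
  congr 1; ext u
  by_cases h : |u| ∈ Set.Ioi R
  · rw [Set.indicator_of_mem h, Set.indicator_of_mem h]
    have h0 : 0 < |u| := hR.trans h
    rw [ENNReal.ofReal_rpow_of_pos (Real.rpow_pos_of_pos h0 _), ← Real.rpow_mul h0.le]
    congr 2; field_simp
  · rw [Set.indicator_of_notMem h, Set.indicator_of_notMem h, ENNReal.zero_rpow_of_pos (by positivity)]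

/-- One-point bound in the diagonal Hardy-Littlewood-Sobolev inequality. -/
lemma kp_hls_point (δ p : ℝ) (hδ0 : 0 < δ) (hδ1 : δ < 1) (hp : p = 2 / (2 - δ)) (f : ℝ → ℝ)
    (hf : Measurable f) (hf0 : ∀ t, 0 ≤ f t) (A : ℝ) (hA : 0 < A)
    (hfA : ∫⁻ t, ENNReal.ofReal (f t) ^ p = ENNReal.ofReal A) (t : ℝ) :
    ENNReal.ofReal (f t) * ∫⁻ s, (if f s ≤ f t then
      ENNReal.ofReal (f s) * ENNReal.ofReal (|t - s| ^ (-δ)) else 0)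
      ≤ ENNReal.ofReal (2 / (1 - δ) + 2) * (ENNReal.ofReal (A ^ (1 - δ)) * ENNReal.ofReal (f t) ^ p) := by
  rcases eq_or_lt_of_le (hf0 t) with h0 | h0
  · rw [← h0]; simp
  have h2δ : 0 < 2 - δ := by linarith
  have hp0 : 0 < p := by rw [hp]; positivity
  set F := f t with hF
  set R := A * F ^ (-p) with hR
  have hR0 : 0 < R := by positivity
  set k1 : ℝ → ℝ≥0∞ := fun u => (Set.Iic R).indicator (fun v => ENNReal.ofReal (v ^ (-δ))) |u|
  set k2 : ℝ → ℝ≥0∞ := fun u => (Set.Ioi R).indicator (fun v => ENNReal.ofReal (v ^ (-δ))) |u|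
  have hk1m : Measurable k1 :=
    ((Measurable.indicator (by fun_prop) measurableSet_Iic)).comp measurable_abs
  have hk2m : Measurable k2 :=
    ((Measurable.indicator (by fun_prop) measurableSet_Ioi)).comp measurable_abs
  have hpt : ∀ s, (if f s ≤ F then
      ENNReal.ofReal (f s) * ENNReal.ofReal (|t - s| ^ (-δ)) else 0) ≤
      ENNReal.ofReal F * k1 (t - s) + ENNReal.ofReal (f s) * k2 (t - s) := by
    intro s
    split_ifs with h
    · rcases le_or_gt |t - s| R with h' | h'
      · refine le_trans ?_ le_self_add
        simp only [k1]
        rw [Set.indicator_of_mem (by exact h')]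
        gcongr
      · refine le_trans ?_ le_add_self
        simp only [k2]
        rw [Set.indicator_of_mem (by exact h')]
    · exact zero_le
  have hI : ∫⁻ s, (if f s ≤ F then
      ENNReal.ofReal (f s) * ENNReal.ofReal (|t - s| ^ (-δ)) else 0) ≤
      ENNReal.ofReal F * ENNReal.ofReal (2 / (1 - δ) * R ^ (1 - δ)) +
      ENNReal.ofReal A ^ (1 / p) * ENNReal.ofReal (2 / R) ^ (δ / 2) := by
    refine (lintegral_mono hpt).trans ?_
    rw [lintegral_add_left (by fun_prop)]
    apply add_le_add
    · rw [lintegral_const_mul _ (by fun_prop)]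
      gcongr
      have e := lintegral_sub_left_eq_self (μ := (volume : Measure ℝ)) k1 t
      rw [e]
      exact kp_near δ R hδ1 hR0
    · have hpq : p.HolderConjugate (2 / δ) := by
        rw [Real.holderConjugate_iff]
        constructor
        · rw [hp, lt_div_iff₀ h2δ]; linarith
        · rw [hp]; field_simp; ring
      have := ENNReal.lintegral_mul_le_Lp_mul_Lq volume hpq
        (f := fun s => ENNReal.ofReal (f s)) (g := fun s => k2 (t - s))
        (by fun_prop) (by fun_prop)
      refine (this).trans ?_
      rw [hfA]
      gcongr
      rw [show 1 / (2 / δ) = δ / 2 by field_simp]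
      gcongr
      have e := lintegral_sub_left_eq_self (μ := (volume : Measure ℝ)) (fun u => k2 u ^ (2 / δ)) t
      rw [e]
      exact kp_far' δ R hδ0 hR0
  refine (mul_le_mul_right hI _).trans ?_
  rw [ENNReal.ofReal_rpow_of_pos hA, ENNReal.ofReal_rpow_of_pos (by positivity),
    ENNReal.ofReal_rpow_of_pos h0, ← ENNReal.ofReal_mul h0.le, ← ENNReal.ofReal_mul (by positivity),
    ← ENNReal.ofReal_add (by have : 0 < 1 - δ := by linarith
                             positivity) (by positivity), ← ENNReal.ofReal_mul h0.le,
    ← ENNReal.ofReal_mul (by positivity), ← ENNReal.ofReal_mul (by have : 0 < 1 - δ := by linarith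
                                                                   positivity)]
  apply ENNReal.ofReal_le_ofReal
  have h1δ : 0 < 1 - δ := by linarith
  have hE1 : F * (F * R ^ (1 - δ)) = A ^ (1 - δ) * F ^ p := by
    rw [hR, Real.mul_rpow hA.le (by positivity), ← Real.rpow_mul h0.le]
    have : F * (F * (A ^ (1 - δ) * F ^ (-p * (1 - δ)))) = A ^ (1 - δ) * (F ^ (1:ℝ) * F ^ (1:ℝ) * F ^ (-p * (1 - δ))) := by
      rw [Real.rpow_one]; ring
    rw [this, ← Real.rpow_add h0, ← Real.rpow_add h0]
    congr 2
    rw [hp]; field_simp; ring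
  have hE2 : F * (A ^ (1 / p) * (1 / R) ^ (δ / 2)) = A ^ (1 - δ) * F ^ p := by
    have : 1 / R = A ^ (-1 : ℝ) * F ^ p := by
      rw [hR, Real.rpow_neg h0.le, Real.rpow_neg_one]; field_simp
    rw [this, Real.mul_rpow (by positivity) (by positivity), ← Real.rpow_mul h0.le, ← Real.rpow_mul hA.le]
    have : F * (A ^ (1 / p) * (A ^ (-1 * (δ / 2)) * F ^ (p * (δ / 2)))) =
      (A ^ (1 / p) * A ^ (-1 * (δ / 2))) * (F ^ (1 : ℝ) * F ^ (p * (δ / 2))) := by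
      rw [Real.rpow_one]; ring
    rw [this, ← Real.rpow_add h0, ← Real.rpow_add hA]
    congr 2
    · rw [hp]; field_simp; ring
    · rw [hp]; field_simp; ring
  have h22 : (2 / R) ^ (δ / 2) ≤ 2 * (1 / R) ^ (δ / 2) := by
    rw [show 2 / R = 2 * (1 / R) by ring, Real.mul_rpow (by norm_num) (by positivity)]
    gcongr
    calc (2 : ℝ) ^ (δ / 2) ≤ 2 ^ (1 : ℝ) := by
          apply Real.rpow_le_rpow_of_exponent_le (by norm_num); linarith
      _ = 2 := by norm_num
  calc F * (F * (2 / (1 - δ) * R ^ (1 - δ)) + A ^ (1 / p) * (2 / R) ^ (δ / 2))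
      ≤ F * (F * (2 / (1 - δ) * R ^ (1 - δ)) + A ^ (1 / p) * (2 * (1 / R) ^ (δ / 2))) := by gcongr
    _ = 2 / (1 - δ) * (F * (F * R ^ (1 - δ))) + 2 * (F * (A ^ (1 / p) * (1 / R) ^ (δ / 2))) := by ring
    _ = _ := by rw [hE1, hE2]; ring

/-- Diagonal Hardy-Littlewood-Sobolev inequality on the line. -/
lemma kp_hls (δ p : ℝ) (hδ0 : 0 < δ) (hδ1 : δ < 1) (hp : p = 2 / (2 - δ)) (f : ℝ → ℝ)
    (hf : Measurable f) (hf0 : ∀ t, 0 ≤ f t) (A : ℝ) (hA : 0 < A)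
    (hfA : ∫⁻ t, ENNReal.ofReal (f t) ^ p = ENNReal.ofReal A) :
    ∫⁻ t, ∫⁻ s, ENNReal.ofReal (f t) * ENNReal.ofReal (f s) * ENNReal.ofReal (|t - s| ^ (-δ)) ≤
      ENNReal.ofReal (2 * (2 / (1 - δ) + 2) * A ^ (2 - δ)) := by
  set K : ℝ → ℝ → ℝ≥0∞ := fun t s => if f s ≤ f t then
    ENNReal.ofReal (f t) * (ENNReal.ofReal (f s) * ENNReal.ofReal (|t - s| ^ (-δ))) else 0 with hK
  have hKm : Measurable (Function.uncurry K) := by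
    refine Measurable.ite (measurableSet_le (by fun_prop) (by fun_prop)) (by fun_prop) measurable_const
  have hle : ∀ t s, ENNReal.ofReal (f t) * ENNReal.ofReal (f s) * ENNReal.ofReal (|t - s| ^ (-δ))
      ≤ K t s + K s t := by
    intro t s
    rcases le_total (f s) (f t) with h | h
    · refine le_trans ?_ le_self_add
      simp only [hK, if_pos h]
      rw [mul_assoc]
    · refine le_trans ?_ le_add_self
      simp only [hK, if_pos h]
      rw [abs_sub_comm, mul_comm (ENNReal.ofReal (f t)), mul_assoc]
  have hswap : ∫⁻ t, ∫⁻ s, K s t = ∫⁻ t, ∫⁻ s, K t s :=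
    lintegral_lintegral_swap (f := fun t s => K s t) (hKm.comp measurable_swap).aemeasurable
  have h1δ : 0 < 1 - δ := by linarith
  have hone : ∫⁻ t, ∫⁻ s, K t s ≤ ENNReal.ofReal (2 / (1 - δ) + 2) *
      (ENNReal.ofReal (A ^ (1 - δ)) * ENNReal.ofReal A) := by
    rw [← hfA, ← lintegral_const_mul _ (by fun_prop), ← lintegral_const_mul _ (by fun_prop)]
    refine lintegral_mono fun t => ?_
    refine le_trans (le_of_eq ?_) (kp_hls_point δ p hδ0 hδ1 hp f hf hf0 A hA hfA t)
    rw [← lintegral_const_mul' _ _ ENNReal.ofReal_ne_top]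
    congr 1; ext s
    simp only [hK]
    split_ifs <;> simp
  calc _ ≤ ∫⁻ t, ∫⁻ s, (K t s + K s t) := lintegral_mono fun t => lintegral_mono fun s => hle t s
    _ = ∫⁻ t, ((∫⁻ s, K t s) + ∫⁻ s, K s t) := by
        congr 1; ext t
        exact lintegral_add_left (hKm.of_uncurry_left (x := t)) _
    _ = (∫⁻ t, ∫⁻ s, K t s) + ∫⁻ t, ∫⁻ s, K s t :=
        lintegral_add_left hKm.lintegral_prod_right' _
    _ = 2 * ∫⁻ t, ∫⁻ s, K t s := by rw [hswap, two_mul]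
    _ ≤ 2 * (ENNReal.ofReal (2 / (1 - δ) + 2) *
      (ENNReal.ofReal (A ^ (1 - δ)) * ENNReal.ofReal A)) := by gcongr
    _ = _ := by
        rw [show (2 : ℝ≥0∞) = ENNReal.ofReal 2 by simp, ← ENNReal.ofReal_mul (by positivity),
          ← ENNReal.ofReal_mul (by positivity), ← ENNReal.ofReal_mul (by positivity)]
        congr 1
        rw [show 2 - δ = (1 - δ) + 1 by ring, Real.rpow_add hA, Real.rpow_one]
        ring


lemma kp_ibp_bound {a b lam : ℝ} (hab : a ≤ b) (ha : 0 < a) (hlam : 0 < lam)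
    (φ g ψ ψ' G G' : ℝ → ℝ) (w w' : ℝ → ℂ)
    (hg : ContinuousOn g (Set.Ioi 0)) (hwc : ContinuousOn w (Set.Ioi 0))
    (hφc : ContinuousOn φ (Set.Ioi 0))
    (hφ : ∀ v ∈ Set.Icc a b, HasDerivAt φ (g v * ψ v) v)
    (hψ : ∀ v ∈ Set.Icc a b, HasDerivAt ψ (ψ' v) v)
    (hw : ∀ v ∈ Set.Icc a b, HasDerivAt w (w' v) v)
    (hG : ∀ v ∈ Set.Icc a b, HasDerivAt G (G' v) v)
    (hψl : ∀ v ∈ Set.Icc a b, lam ≤ |ψ v|)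
    (hw1 : ∀ v ∈ Set.Icc a b, ‖w v‖ ≤ 1)
    (hb : ∀ v ∈ Set.Icc a b, ‖w' v‖ / |ψ v| + |ψ' v| / (ψ v) ^ 2 ≤ G' v) :
    ‖∫ v in a..b, (g v : ℂ) * w v * Complex.exp (Complex.I * (φ v : ℂ))‖
      ≤ 2 / lam + (G b - G a) := by
  set h : ℝ → ℂ := fun v => (g v : ℂ) * w v * Complex.exp (Complex.I * (φ v : ℂ)) with hh
  have hpos : ∀ v ∈ Set.Icc a b, 0 < v := fun v hv => lt_of_lt_of_le ha hv.1
  have hcont : ContinuousOn h (Set.Ioi 0) := by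
    refine ContinuousOn.mul (ContinuousOn.mul ?_ hwc) ?_
    · exact Complex.continuous_ofReal.comp_continuousOn hg
    · refine Complex.continuous_exp.comp_continuousOn (continuousOn_const.mul ?_)
      exact Complex.continuous_ofReal.comp_continuousOn hφc
  set Q : ℝ → ℂ := fun s => w s / (Complex.I * (ψ s : ℂ)) * Complex.exp (Complex.I * (φ s : ℂ))
    with hQ
  have hψ0 : ∀ v ∈ Set.Icc a b, ψ v ≠ 0 := by
    intro v hv h0
    have := hψl v hv
    rw [h0, abs_zero] at this
    linarith
  have hQn : ∀ v ∈ Set.Icc a b, ‖Q v‖ ≤ 1 / lam := by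
    intro v hv
    have h1 : ‖Complex.exp (Complex.I * (φ v : ℂ))‖ = 1 := by
      rw [mul_comm]; exact Complex.norm_exp_ofReal_mul_I _
    simp only [hQ, norm_mul, norm_div, h1, Complex.norm_I, one_mul, mul_one, Complex.norm_real,
      Real.norm_eq_abs]
    exact div_le_div₀ zero_le_one (hw1 v hv) hlam (hψl v hv)
  have hQd : ∀ v ∈ Set.Icc a b, HasDerivAt Q
      (h v + (w' v / (Complex.I * (ψ v : ℂ)) - w v * ψ' v / (Complex.I * (ψ v : ℂ) ^ 2))
        * Complex.exp (Complex.I * (φ v : ℂ))) v := by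
    intro v hv
    have e1 := (hφ v hv).ofReal_comp.const_mul Complex.I
    have e2 := (hψ v hv).ofReal_comp.const_mul Complex.I
    have hne : Complex.I * (ψ v : ℂ) ≠ 0 :=
      mul_ne_zero Complex.I_ne_zero (by exact_mod_cast hψ0 v hv)
    have hne' : (ψ v : ℂ) ≠ 0 := (by exact_mod_cast hψ0 v hv)
    have e3 := ((hw v hv).div e2 hne).mul e1.cexp
    convert! e3 using 1
    simp only [hh, Pi.div_apply]
    push_cast
    field_simp
    ring
  set F : ℝ → ℂ := fun s => (∫ v in a..s, h v) - Q s with hF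
  have hFd : ∀ v ∈ Set.Icc a b, HasDerivAt F
      (-((w' v / (Complex.I * (ψ v : ℂ)) - w v * ψ' v / (Complex.I * (ψ v : ℂ) ^ 2))
        * Complex.exp (Complex.I * (φ v : ℂ)))) v := by
    intro v hv
    have i1 : IntervalIntegrable h volume a v := by
      apply ContinuousOn.intervalIntegrable
      apply hcont.mono
      rw [Set.uIcc_of_le hv.1]
      intro x hx
      exact lt_of_lt_of_le ha hx.1
    have i2 := intervalIntegral.integral_hasDerivAt_right i1
      (hcont.stronglyMeasurableAtFilter isOpen_Ioi v (hpos v hv))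
      (hcont.continuousAt (Ioi_mem_nhds (hpos v hv)))
    convert! i2.sub (hQd v hv) using 1
    ring
  have hmain : ‖F b - F a‖ ≤ G b - G a := by
    have := image_norm_le_of_norm_deriv_right_le_deriv_boundary' (f := fun s => F s - F a)
      (f' := fun v => (-((w' v / (Complex.I * (ψ v : ℂ)) - w v * ψ' v / (Complex.I * (ψ v : ℂ) ^ 2))
        * Complex.exp (Complex.I * (φ v : ℂ))))) (a := a) (b := b)
      (B := fun s => G s - G a) (B' := G') ?_ ?_ ?_ ?_ ?_ ?_ (x := b) ⟨hab, le_rfl⟩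
    · exact this
    · intro v hv
      exact ((hFd v hv).continuousAt.sub continuousAt_const).continuousWithinAt
    · intro v hv
      exact ((hFd v ⟨hv.1, hv.2.le⟩).sub_const _).hasDerivWithinAt
    · simp
    · intro v hv
      exact ((hG v hv).continuousAt.sub continuousAt_const).continuousWithinAt
    · intro v hv
      exact ((hG v ⟨hv.1, hv.2.le⟩).sub_const _).hasDerivWithinAt
    · intro v hv
      have hv' : v ∈ Set.Icc a b := ⟨hv.1, hv.2.le⟩
      refine le_trans ?_ (hb v hv')
      have h1 : ‖Complex.exp (Complex.I * (φ v : ℂ))‖ = 1 := by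
        rw [mul_comm]; exact Complex.norm_exp_ofReal_mul_I _
      rw [norm_neg, norm_mul, h1, mul_one]
      refine (norm_sub_le _ _).trans ?_
      simp only [norm_mul, norm_div, Complex.norm_I, one_mul, Complex.norm_real,
        Real.norm_eq_abs, norm_pow, sq_abs]
      gcongr
      have := hw1 v hv'
      nlinarith [abs_nonneg (ψ' v)]
  have hFa : F a = - Q a := by simp [hF]
  have hFb : (∫ v in a..b, h v) = (F b - F a) + (Q b - Q a) := by
    rw [hFa]; simp [hF]
  rw [hFb]
  calc _ ≤ ‖F b - F a‖ + (‖Q b‖ + ‖Q a‖) :=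
        (norm_add_le _ _).trans (by gcongr; exact norm_sub_le _ _)
    _ ≤ (G b - G a) + (1 / lam + 1 / lam) := by
        gcongr
        · exact hQn b ⟨hab, le_rfl⟩
        · exact hQn a ⟨le_rfl, hab⟩
    _ = _ := by ring

lemma kp_level {a b c : ℝ} (hab : a ≤ b) (ψ : ℝ → ℝ) (hc : ContinuousOn ψ (Set.Icc a b))
    (hm : MonotoneOn ψ (Set.Icc a b)) :
    ∃ v ∈ Set.Icc a b, (∀ x ∈ Set.Icc a v, a < v → ψ x ≤ c) ∧
      (∀ x ∈ Set.Icc v b, v < b → c ≤ ψ x) := by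
  by_cases h1 : ψ b ≤ c
  · refine ⟨b, ⟨hab, le_rfl⟩, ?_, ?_⟩
    · intro x hx _
      exact (hm ⟨hx.1, hx.2⟩ ⟨hab, le_rfl⟩ hx.2).trans h1
    · intro x hx h; exact absurd h (lt_irrefl _)
  by_cases h2 : c ≤ ψ a
  · refine ⟨a, ⟨le_rfl, hab⟩, ?_, ?_⟩
    · intro x hx h; exact absurd h (lt_irrefl _)
    · intro x hx _
      exact h2.trans (hm ⟨le_rfl, hab⟩ ⟨hx.1, hx.2⟩ hx.1)
  push Not at h1 h2
  obtain ⟨v, hv, hvc⟩ := intermediate_value_Icc hab hc ⟨h2.le, h1.le⟩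
  refine ⟨v, hv, ?_, ?_⟩
  · intro x hx _
    rw [← hvc]
    exact hm ⟨hx.1, hx.2.trans hv.2⟩ hv hx.2
  · intro x hx _
    rw [← hvc]
    exact hm hv ⟨hv.1.trans hx.1, hx.2⟩ hx.1

noncomputable def kpW (c η v : ℝ) : ℂ :=
  Complex.exp (((-(c * v ^ 2) : ℝ) : ℂ) + Complex.I * ((η * Real.log v : ℝ) : ℂ))
noncomputable def kpPhi (α t X v : ℝ) : ℝ := t * v ^ 10 - α * t * v ^ 6 + X * v ^ 2
noncomputable def kpPsi (α t X v : ℝ) : ℝ := 10 * t * v ^ 5 - 6 * α * t * v + 2 * X / v ^ 3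
noncomputable def kpJ (α t X c η a b : ℝ) : ℂ :=
  ∫ v in a..b, ((v ^ 4 : ℝ) : ℂ) * kpW c η v * Complex.exp (Complex.I * (kpPhi α t X v : ℂ))

lemma kpW_norm (c η v : ℝ) : ‖kpW c η v‖ = Real.exp (-(c * v ^ 2)) := by
  rw [kpW, Complex.exp_add, norm_mul, mul_comm Complex.I, Complex.norm_exp_ofReal_mul_I, mul_one,
    ← Complex.ofReal_exp, Complex.norm_real, Real.norm_eq_abs, abs_of_pos (Real.exp_pos _)]

lemma kpW_deriv (c η v : ℝ) (hv : 0 < v) : HasDerivAt (kpW c η)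
    (kpW c η v * (((-(2 * c * v) : ℝ) : ℂ) + Complex.I * ((η / v : ℝ) : ℂ))) v := by
  have h1 : HasDerivAt (fun v : ℝ => -(c * v ^ 2)) (-(2 * c * v)) v := by
    have := ((hasDerivAt_pow 2 v).const_mul c).neg
    convert! this using 1
    simp; ring
  have h2 : HasDerivAt (fun v : ℝ => η * Real.log v) (η / v) v := by
    simpa [div_eq_mul_inv] using (Real.hasDerivAt_log hv.ne').const_mul η
  exact (h1.ofReal_comp.add (h2.ofReal_comp.const_mul Complex.I)).cexp

lemma kpPsi_deriv (α t X v : ℝ) (hv : 0 < v) : HasDerivAt (kpPsi α t X)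
    (50 * t * v ^ 4 - 6 * α * t - 6 * X / v ^ 4) v := by
  have h1 := (hasDerivAt_pow 5 v).const_mul (10 * t)
  have h2 := (hasDerivAt_id v).const_mul (6 * α * t)
  have h3 := ((hasDerivAt_pow 3 v).inv (pow_ne_zero 3 hv.ne')).const_mul (2 * X)
  have := (h1.sub h2).add h3
  convert! this using 1
  simp
  field_simp
  ring

lemma kpPhi_deriv (α t X v : ℝ) (hv : 0 < v) : HasDerivAt (kpPhi α t X)
    (v ^ 4 * kpPsi α t X v) v := by
  have h1 := (hasDerivAt_pow 10 v).const_mul t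
  have h2 := (hasDerivAt_pow 6 v).const_mul (α * t)
  have h3 := (hasDerivAt_pow 2 v).const_mul X
  have := (h1.sub h2).add h3
  convert! this using 1
  simp [kpPsi]
  field_simp

lemma kpE_deriv (c lam v : ℝ) : HasDerivAt (fun v => -(Real.exp (-(c * v ^ 2)) / lam))
    (2 * c * v * Real.exp (-(c * v ^ 2)) / lam) v := by
  have h1 : HasDerivAt (fun v : ℝ => -(c * v ^ 2)) (-(2 * c * v)) v := by
    have := ((hasDerivAt_pow 2 v).const_mul c).neg
    convert! this using 1
    simp; ring
  have := (h1.exp.div_const lam).neg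
  convert! this using 1
  ring

lemma kpJ_gen {α t X c η a b lam : ℝ} (hab : a ≤ b) (ha : 0 < a) (hlam : 0 < lam)
    (hc : 0 ≤ c) (G G' : ℝ → ℝ)
    (hG : ∀ v ∈ Set.Icc a b, HasDerivAt G (G' v) v)
    (hψl : ∀ v ∈ Set.Icc a b, lam ≤ |kpPsi α t X v|)
    (hb : ∀ v ∈ Set.Icc a b, |η| / (v * |kpPsi α t X v|) +
      |50 * t * v ^ 4 - 6 * α * t - 6 * X / v ^ 4| / (kpPsi α t X v) ^ 2 ≤ G' v) :
    ‖kpJ α t X c η a b‖ ≤ 3 / lam + (G b - G a) := by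
  have hpos : ∀ v ∈ Set.Icc a b, 0 < v := fun v hv => lt_of_lt_of_le ha hv.1
  have := kp_ibp_bound (lam := lam) hab ha hlam (kpPhi α t X) (fun v => v ^ 4) (kpPsi α t X)
    (fun v => 50 * t * v ^ 4 - 6 * α * t - 6 * X / v ^ 4)
    (fun v => G v + -(Real.exp (-(c * v ^ 2)) / lam))
    (fun v => G' v + 2 * c * v * Real.exp (-(c * v ^ 2)) / lam)
    (kpW c η) (fun v => kpW c η v * (((-(2 * c * v) : ℝ) : ℂ) + Complex.I * ((η / v : ℝ) : ℂ)))
    (by fun_prop)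
    (fun v hv => (kpW_deriv c η v hv).continuousAt.continuousWithinAt)
    (fun v hv => (kpPhi_deriv α t X v hv).continuousAt.continuousWithinAt)
    (fun v hv => kpPhi_deriv α t X v (hpos v hv))
    (fun v hv => kpPsi_deriv α t X v (hpos v hv))
    (fun v hv => kpW_deriv c η v (hpos v hv))
    (fun v hv => (hG v hv).add (kpE_deriv c lam v))
    hψl ?_ ?_
  · refine this.trans ?_
    have e1 : 0 ≤ Real.exp (-(c * b ^ 2)) / lam := by positivity
    have e2 : Real.exp (-(c * a ^ 2)) / lam ≤ 1 / lam := by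
      gcongr
      rw [Real.exp_le_one_iff]
      have : 0 ≤ c * a ^ 2 := by positivity
      linarith
    have : 3 / lam = 2 / lam + 1 / lam := by ring
    linarith
  · intro v hv
    rw [kpW_norm, Real.exp_le_one_iff]
    have : 0 ≤ c * v ^ 2 := by positivity
    linarith
  · intro v hv
    have hv0 := hpos v hv
    have hl := hψl v hv
    have hψ : 0 < |kpPsi α t X v| := lt_of_lt_of_le hlam hl
    have e0 : Real.exp (-(c * v ^ 2)) ≤ 1 := by
      rw [Real.exp_le_one_iff]
      have : 0 ≤ c * v ^ 2 := by positivity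
      linarith
    have e1 : ‖kpW c η v * (((-(2 * c * v) : ℝ) : ℂ) + Complex.I * ((η / v : ℝ) : ℂ))‖
        ≤ 2 * c * v * Real.exp (-(c * v ^ 2)) + |η| / v := by
      rw [norm_mul, kpW_norm]
      have : ‖(((-(2 * c * v) : ℝ) : ℂ) + Complex.I * ((η / v : ℝ) : ℂ))‖ ≤ 2 * c * v + |η| / v := by
        refine (norm_add_le _ _).trans ?_
        rw [norm_mul, Complex.norm_real, Complex.norm_real, Complex.norm_I, one_mul,
          Real.norm_eq_abs, Real.norm_eq_abs, abs_neg, abs_div, abs_of_pos hv0, abs_of_nonneg]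
        positivity
      calc _ ≤ Real.exp (-(c * v ^ 2)) * (2 * c * v + |η| / v) := by gcongr
        _ = 2 * c * v * Real.exp (-(c * v ^ 2)) + Real.exp (-(c * v ^ 2)) * (|η| / v) := by ring
        _ ≤ 2 * c * v * Real.exp (-(c * v ^ 2)) + 1 * (|η| / v) := by gcongr
        _ = _ := by ring
    calc _ ≤ (2 * c * v * Real.exp (-(c * v ^ 2)) + |η| / v) / |kpPsi α t X v| +
          |50 * t * v ^ 4 - 6 * α * t - 6 * X / v ^ 4| / (kpPsi α t X v) ^ 2 := by gcongr
      _ = 2 * c * v * Real.exp (-(c * v ^ 2)) / |kpPsi α t X v| + (|η| / (v * |kpPsi α t X v|) +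
          |50 * t * v ^ 4 - 6 * α * t - 6 * X / v ^ 4| / (kpPsi α t X v) ^ 2) := by
          field_simp
          ring
      _ ≤ 2 * c * v * Real.exp (-(c * v ^ 2)) / lam + G' v := by
          gcongr
          exact hb v hv
      _ = _ := by ring

lemma kp_alpha {α t a v : ℝ} (ht : 0 < t) (ha : 0 < a) (hα : |α| ≤ a ^ 4) (hv : a ≤ v) :
    |α| * t ≤ t * v ^ 4 := by
  have : a ^ 4 ≤ v ^ 4 := by gcongr
  nlinarith

lemma kpJ_B {α t X c η a b lam : ℝ} (hab : a ≤ b) (ha : 0 < a) (hlam : 0 < lam)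
    (hc : 0 ≤ c) (ht : 0 < t) (hα : |α| ≤ a ^ 4) (hX : X ≤ 0)
    (hψl : ∀ v ∈ Set.Icc a b, lam ≤ |kpPsi α t X v|) :
    ‖kpJ α t X c η a b‖ ≤ 5 * (1 + |η|) / lam := by
  have hpos : ∀ v ∈ Set.Icc a b, 0 < v := fun v hv => lt_of_lt_of_le ha hv.1
  have hne : ∀ v ∈ Set.Icc a b, kpPsi α t X v ≠ 0 := by
    intro v hv h0
    have := hψl v hv
    rw [h0, abs_zero] at this
    linarith
  have key := kpJ_gen (c := c) (η := η) hab ha hlam hc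
    (fun v => -((1 + |η|) * (kpPsi α t X v)⁻¹))
    (fun v => (1 + |η|) * (50 * t * v ^ 4 - 6 * α * t - 6 * X / v ^ 4) / (kpPsi α t X v) ^ 2)
    ?_ hψl ?_
  · refine key.trans ?_
    have b1 : |(kpPsi α t X b)⁻¹| ≤ 1 / lam := by
      rw [abs_inv, ← one_div]
      exact one_div_le_one_div_of_le hlam (hψl b ⟨hab, le_rfl⟩)
    have b2 : |(kpPsi α t X a)⁻¹| ≤ 1 / lam := by
      rw [abs_inv, ← one_div]
      exact one_div_le_one_div_of_le hlam (hψl a ⟨le_rfl, hab⟩)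
    have b3 := neg_abs_le (kpPsi α t X b)⁻¹
    have b4 := le_abs_self (kpPsi α t X a)⁻¹
    have h1 : 0 ≤ |η| := abs_nonneg _
    have h2 : 0 < 1 / lam := by positivity
    have : 5 * (1 + |η|) / lam = 5 * (1 + |η|) * (1 / lam) := by ring
    rw [this]
    have : 3 / lam = 3 * (1 / lam) := by ring
    rw [this]
    have e : (kpPsi α t X a)⁻¹ - (kpPsi α t X b)⁻¹ ≤ 2 * (1 / lam) := by linarith
    have e' := mul_le_mul_of_nonneg_left e (show 0 ≤ 1 + |η| by positivity)
    nlinarith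
  · intro v hv
    have := (((kpPsi_deriv α t X v (hpos v hv)).inv (hne v hv)).const_mul (1 + |η|)).neg
    convert! this using 1
    ring
  · intro v hv
    have hv0 := hpos v hv
    have h1 := kp_alpha ht ha hα hv.1
    have h2 := abs_le.1 (le_refl |α|)
    set P := 50 * t * v ^ 4 - 6 * α * t - 6 * X / v ^ 4 with hP
    have hx : 0 ≤ -X / v ^ 4 := div_nonneg (by linarith) (by positivity)
    have hx' : 6 * X / v ^ 4 = -6 * (-X / v ^ 4) := by ring
    have hαt : |α * t| ≤ t * v ^ 4 := by rw [abs_mul, abs_of_pos ht]; exact h1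
    have h3 := abs_le.1 hαt
    have htv : 0 < t * v ^ 4 := by positivity
    have hP0 : 0 < P := by rw [hP, hx']; nlinarith
    have hvP : |kpPsi α t X v| ≤ v * P := by
      have e : kpPsi α t X v = v * (10 * (t * v ^ 4) - 6 * (α * t) - 2 * (-X / v ^ 4)) := by
        rw [kpPsi]; field_simp; ring
      rw [e, abs_mul, abs_of_pos hv0]
      gcongr
      rw [abs_le, hP, hx']
      constructor <;> nlinarith
    have hψ : 0 < |kpPsi α t X v| := lt_of_lt_of_le hlam (hψl v hv)
    rw [abs_of_pos hP0, ← sq_abs (kpPsi α t X v)]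
    have : |η| / (v * |kpPsi α t X v|) ≤ |η| * P / |kpPsi α t X v| ^ 2 := by
      rw [div_le_div_iff₀ (by positivity) (by positivity)]
      have := mul_le_mul_of_nonneg_left hvP (show 0 ≤ |η| * |kpPsi α t X v| by positivity)
      nlinarith
    calc _ ≤ |η| * P / |kpPsi α t X v| ^ 2 + P / |kpPsi α t X v| ^ 2 := by gcongr
      _ = _ := by ring

lemma kpJ_A {α t X c η a b lam : ℝ} (hab : a ≤ b) (ha : 0 < a) (hlam : 0 < lam)
    (hc : 0 ≤ c) (ht : t = lam ^ 2) (hα : |α| ≤ a ^ 4) (hX : 0 ≤ X) (hal : 1 ≤ lam * a ^ 5) :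
    ‖kpJ α t X c η a b‖ ≤ 5 * (1 + |η|) / lam := by
  have ht0 : 0 < t := by rw [ht]; positivity
  have hpos : ∀ v ∈ Set.Icc a b, 0 < v := fun v hv => lt_of_lt_of_le ha hv.1
  have hlow : ∀ v ∈ Set.Icc a b, 4 * t * v ^ 5 + 2 * X / v ^ 3 ≤ kpPsi α t X v := by
    intro v hv
    have hv0 := hpos v hv
    have h1 := kp_alpha ht0 ha hα hv.1
    have hαt : |α * t| ≤ t * v ^ 4 := by rw [abs_mul, abs_of_pos ht0]; exact h1
    have h3 := abs_le.1 hαt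
    rw [kpPsi]
    have := mul_le_mul_of_nonneg_right h3.2 hv0.le
    nlinarith
  have hlow2 : ∀ v ∈ Set.Icc a b, lam ≤ t * v ^ 5 := by
    intro v hv
    have hv0 := hpos v hv
    have : a ^ 5 ≤ v ^ 5 := by gcongr; exact hv.1
    rw [ht]
    nlinarith
  have hpsi : ∀ v ∈ Set.Icc a b, 4 * t * v ^ 5 ≤ kpPsi α t X v := by
    intro v hv
    have hv0 := hpos v hv
    have : 0 ≤ 2 * X / v ^ 3 := by positivity
    linarith [hlow v hv]
  have hppos : ∀ v ∈ Set.Icc a b, 0 < kpPsi α t X v := by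
    intro v hv
    have hv0 := hpos v hv
    have : 0 < 4 * t * v ^ 5 := by positivity
    linarith [hpsi v hv]
  have key := kpJ_gen (α := α) (t := t) (X := X) (c := c) (η := η) hab ha hlam hc
    (fun v => -((14 + |η|) / (20 * t) * (v ^ 5)⁻¹))
    (fun v => (14 + |η|) / (4 * t * v ^ 6))
    ?_ ?_ ?_
  · refine key.trans ?_
    have hb0 : 0 < b := lt_of_lt_of_le ha hab
    have e1 : 0 ≤ (14 + |η|) / (20 * t) * (b ^ 5)⁻¹ := by positivity
    have e2 : (14 + |η|) / (20 * t) * (a ^ 5)⁻¹ ≤ (14 + |η|) / (20 * lam) := by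
      rw [← div_eq_mul_inv, div_div, div_le_div_iff₀ (by positivity) (by positivity), ht]
      have : 0 ≤ (14 + |η|) * lam := by positivity
      nlinarith
    have e3 : 5 * (1 + |η|) / lam = 3 / lam + (14 + |η|) / (20 * lam) + (26 + 99 * |η|) / (20 * lam) := by
      field_simp; ring
    have e4 : 0 ≤ (26 + 99 * |η|) / (20 * lam) := by positivity
    rw [e3]; linarith
  · intro v hv
    have hv0 := hpos v hv
    have := (((hasDerivAt_pow 5 v).inv (pow_ne_zero 5 hv0.ne')).const_mul
      ((14 + |η|) / (20 * t))).neg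
    convert! this using 1
    push_cast
    field_simp
    ring
  · intro v hv
    rw [abs_of_pos (hppos v hv)]
    have := hpos v hv
    linarith [hpsi v hv, hlow2 v hv]
  · intro v hv
    have hv0 := hpos v hv
    have h1 := kp_alpha ht0 ha hα hv.1
    have hαt : |α * t| ≤ t * v ^ 4 := by rw [abs_mul, abs_of_pos ht0]; exact h1
    have h3 := abs_le.1 hαt
    have hp := hppos v hv
    rw [abs_of_pos hp]
    set P := 50 * t * v ^ 4 - 6 * α * t - 6 * X / v ^ 4 with hP
    have hx : 0 ≤ X / v ^ 4 := by positivity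
    have hx' : 6 * X / v ^ 4 = 6 * (X / v ^ 4) := by ring
    have htv : 0 < t * v ^ 4 := by positivity
    have hPb : v * |P| ≤ 14 * kpPsi α t X v := by
      have h4 : v * (4 * (t * v ^ 4) + 2 * (X / v ^ 4)) ≤ kpPsi α t X v := by
        refine le_trans (le_of_eq ?_) (hlow v hv)
        field_simp
      have : |P| ≤ 14 * (4 * (t * v ^ 4) + 2 * (X / v ^ 4)) := by
        rw [abs_le, hP, hx']
        constructor <;> nlinarith
      have := mul_le_mul_of_nonneg_left this hv0.le
      nlinarith
    have e1 : |P| / kpPsi α t X v ^ 2 ≤ 14 / (v * kpPsi α t X v) := by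
      rw [div_le_div_iff₀ (by positivity) (by positivity)]
      have := mul_le_mul_of_nonneg_right hPb hp.le
      nlinarith
    calc _ ≤ |η| / (v * kpPsi α t X v) + 14 / (v * kpPsi α t X v) := by gcongr
      _ = (14 + |η|) / (v * kpPsi α t X v) := by ring
      _ ≤ (14 + |η|) / (v * (4 * t * v ^ 5)) := by
        gcongr
        exact hpsi v hv
      _ = _ := by ring

lemma kpJ_integrable (α t X c η : ℝ) {a b : ℝ} (ha : 0 < a) (hb : 0 < b) :
    IntervalIntegrable (fun v => ((v ^ 4 : ℝ) : ℂ) * kpW c η v *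
      Complex.exp (Complex.I * (kpPhi α t X v : ℂ))) volume a b := by
  apply ContinuousOn.intervalIntegrable
  intro v hv
  have hv0 : 0 < v := by
    rcases hv with ⟨h1, _⟩
    exact lt_of_lt_of_le (lt_min ha hb) h1
  apply ContinuousAt.continuousWithinAt
  have h1 := (kpW_deriv c η v hv0).continuousAt
  have h2 := (kpPhi_deriv α t X v hv0).continuousAt
  fun_prop

lemma kpJ_split (α t X c η : ℝ) {a b d : ℝ} (ha : 0 < a) (hb : 0 < b) (hd : 0 < d) :
    kpJ α t X c η a d = kpJ α t X c η a b + kpJ α t X c η b d :=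
  (intervalIntegral.integral_add_adjacent_intervals (kpJ_integrable α t X c η ha hb)
    (kpJ_integrable α t X c η hb hd)).symm

lemma kpJ_triv (α t X c η : ℝ) {a b : ℝ} (ha : 0 < a) (hab : a ≤ b) (hc : 0 ≤ c) :
    ‖kpJ α t X c η a b‖ ≤ (b ^ 5 - a ^ 5) / 5 := by
  have h1 : ∫ v in a..b, (v ^ 4 : ℝ) = (b ^ 5 - a ^ 5) / 5 := by
    rw [integral_pow]; norm_num
  rw [← h1]
  apply intervalIntegral.norm_integral_le_of_norm_le hab
  · filter_upwards with v hv
    have : ‖Complex.exp (Complex.I * (kpPhi α t X v : ℂ))‖ = 1 := by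
      rw [mul_comm]; exact Complex.norm_exp_ofReal_mul_I _
    rw [norm_mul, norm_mul, this, mul_one, kpW_norm, Complex.norm_real, Real.norm_eq_abs,
      abs_of_nonneg (by positivity)]
    have : Real.exp (-(c * v ^ 2)) ≤ 1 := by
      rw [Real.exp_le_one_iff]
      have : 0 ≤ c * v ^ 2 := by positivity
      linarith
    have h4 : 0 ≤ v ^ 4 := by positivity
    nlinarith
  · exact (continuous_pow 4).intervalIntegrable _ _

lemma kpPsi_mono {α t X a x y : ℝ} (ha : 0 < a) (ht : 0 < t) (hα : |α| ≤ a ^ 4) (hX : X ≤ 0)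
    (hx : a ≤ x) (hxy : x ≤ y) : 4 * t * (y ^ 5 - x ^ 5) ≤ kpPsi α t X y - kpPsi α t X x := by
  have hx0 : 0 < x := lt_of_lt_of_le ha hx
  have h1 := kp_alpha ht ha hα hx
  have hαt : |α * t| ≤ t * x ^ 4 := by rw [abs_mul, abs_of_pos ht]; exact h1
  have h3 := (abs_le.1 hαt).2
  have h4 : 2 * X / x ^ 3 ≤ 2 * X / y ^ 3 := by
    have : (-(2 * X)) / y ^ 3 ≤ (-(2 * X)) / x ^ 3 := by
      apply div_le_div_of_nonneg_left (by linarith) (by positivity)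
      gcongr
    rw [neg_div, neg_div] at this
    linarith
  have h5 : x ^ 4 * (y - x) ≤ y ^ 5 - x ^ 5 := by
    have : x ^ 4 ≤ y ^ 4 := by gcongr
    have hy0 : 0 < y := lt_of_lt_of_le hx0 hxy
    nlinarith
  have h6 := mul_le_mul_of_nonneg_right h3 (sub_nonneg.2 hxy)
  have h7 := mul_le_mul_of_nonneg_left h5 ht.le
  simp only [kpPsi]
  nlinarith

lemma kpJ_high {α t X c η a b lam : ℝ} (hab : a ≤ b) (ha : 0 < a) (hlam : 0 < lam)
    (hc : 0 ≤ c) (ht : t = lam ^ 2) (hα : |α| ≤ a ^ 4) (hal : 1 ≤ lam * a ^ 5) :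
    ‖kpJ α t X c η a b‖ ≤ 12 * (1 + |η|) / lam := by
  have ht0 : 0 < t := by rw [ht]; positivity
  have hη := abs_nonneg η
  rcases le_total 0 X with hX | hX
  · refine (kpJ_A hab ha hlam hc ht hα hX hal).trans ?_
    gcongr; norm_num
  have hpos : ∀ v ∈ Set.Icc a b, 0 < v := fun v hv => lt_of_lt_of_le ha hv.1
  have hm : MonotoneOn (kpPsi α t X) (Set.Icc a b) := by
    intro x hx y hy hxy
    have := kpPsi_mono ha ht0 hα hX hx.1 hxy
    have : 0 ≤ 4 * t * (y ^ 5 - x ^ 5) := by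
      have h0 := hpos x hx
      have : x ^ 5 ≤ y ^ 5 := by gcongr
      have : 0 ≤ y ^ 5 - x ^ 5 := by linarith
      positivity
    linarith
  have hcont : ContinuousOn (kpPsi α t X) (Set.Icc a b) := fun v hv =>
    (kpPsi_deriv α t X v (hpos v hv)).continuousAt.continuousWithinAt
  obtain ⟨v1, hv1, hl1, hr1⟩ := kp_level (c := -lam) hab _ hcont hm
  have hsub : Set.Icc v1 b ⊆ Set.Icc a b := Set.Icc_subset_Icc_left hv1.1
  obtain ⟨v2, hv2, hl2, hr2⟩ := kp_level (c := lam) hv1.2 _ (hcont.mono hsub) (hm.mono hsub)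
  have h10 := hpos v1 hv1
  have h20 := hpos v2 (hsub hv2)
  have hb0 := hpos b ⟨hab, le_rfl⟩
  rw [kpJ_split α t X c η ha h10 hb0, kpJ_split α t X c η h10 h20 hb0]
  have B1 : ‖kpJ α t X c η a v1‖ ≤ 5 * (1 + |η|) / lam := by
    rcases eq_or_lt_of_le hv1.1 with h | h
    · rw [← h, kpJ, intervalIntegral.integral_same, norm_zero]; positivity
    · refine kpJ_B hv1.1 ha hlam hc ht0 hα hX ?_
      intro v hv
      have := hl1 v hv h
      rw [le_abs]; right; linarith
  have hα1 : |α| ≤ v2 ^ 4 := hα.trans (by gcongr; exact hv1.1.trans hv2.1)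
  have B3 : ‖kpJ α t X c η v2 b‖ ≤ 5 * (1 + |η|) / lam := by
    rcases eq_or_lt_of_le hv2.2 with h | h
    · rw [h, kpJ, intervalIntegral.integral_same, norm_zero]; positivity
    · refine kpJ_B hv2.2 h20 hlam hc ht0 hα1 hX ?_
      intro v hv
      have := hr2 v hv h
      rw [le_abs]; left; linarith
  have B2 : ‖kpJ α t X c η v1 v2‖ ≤ 1 / lam := by
    rcases eq_or_lt_of_le hv2.1 with h | h
    · rw [← h, kpJ, intervalIntegral.integral_same, norm_zero]; positivity
    · refine (kpJ_triv α t X c η h10 hv2.1 hc).trans ?_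
      have e1 := hl2 v2 ⟨hv2.1, le_rfl⟩ h
      have e2 := hr1 v1 ⟨le_rfl, hv1.2⟩ (lt_of_lt_of_le h hv2.2)
      have e3 := kpPsi_mono ha ht0 hα hX hv1.1 hv2.1
      rw [le_div_iff₀ hlam]
      rw [ht] at e3
      have e3' : (4 * lam * (v2 ^ 5 - v1 ^ 5)) * lam ≤ 2 * lam := by rw [ht] at e1 e2; nlinarith
      have e4 := le_of_mul_le_mul_right e3' hlam
      nlinarith
  calc _ ≤ _ := norm_add_le _ _
    _ ≤ _ := add_le_add_right (norm_add_le _ _) _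
    _ ≤ 5 * (1 + |η|) / lam + (1 / lam + 5 * (1 + |η|) / lam) := by gcongr
    _ = (11 + 10 * |η|) / lam := by ring
    _ ≤ _ := by gcongr; nlinarith

/-- Core oscillatory integral bound. -/
lemma kpJ_core (α : ℝ) : ∃ C : ℝ, 0 < C ∧ ∀ lam : ℝ, 0 < lam → lam ≤ 2 → ∀ X c η a b : ℝ,
    0 < a → a ≤ b → 0 ≤ c → ‖kpJ α (lam ^ 2) X c η a b‖ ≤ C * (1 + |η|) / lam := by
  refine ⟨13 + 2 * (1 + |α|) ^ 5, by positivity, ?_⟩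
  intro lam hlam hlam2 X c η a b ha hab hc
  have hη := abs_nonneg η
  set A := 1 + |α| with hA
  have hA1 : 1 ≤ A := by have := abs_nonneg α; linarith
  obtain ⟨τ, hτ, hτ5⟩ : ∃ τ : ℝ, 0 < τ ∧ lam * τ ^ 5 = 1 := by
    refine ⟨lam⁻¹ ^ ((5 : ℝ)⁻¹), by positivity, ?_⟩
    rw [← Real.rpow_natCast, ← Real.rpow_mul (by positivity)]
    norm_num
    exact mul_inv_cancel₀ hlam.ne'
  set B := max A τ with hB
  have hBA : A ≤ B := le_max_left _ _
  have hB0 : 0 < B := lt_of_lt_of_le (by linarith) hBA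
  have hB5 : B ^ 5 / 5 ≤ (1 + 2 * A ^ 5) / lam := by
    rw [le_div_iff₀ hlam]
    rcases max_choice A τ with h | h
    · rw [hB, h]
      have : 0 ≤ A ^ 5 := by positivity
      nlinarith
    · rw [hB, h]
      have : 0 ≤ A ^ 5 := by positivity
      nlinarith
  have hαB : |α| ≤ B ^ 4 := by
    have : A ≤ A ^ 4 := le_self_pow₀ hA1 (by norm_num)
    have : A ^ 4 ≤ B ^ 4 := by gcongr
    linarith
  have hlB : 1 ≤ lam * B ^ 5 := by
    rw [← hτ5]; gcongr; exact le_max_right _ _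
  have hA5 : 0 ≤ A ^ 5 := by positivity
  rcases le_total b B with h | h
  · refine (kpJ_triv _ _ _ _ _ ha hab hc).trans ?_
    have h1 : b ^ 5 ≤ B ^ 5 := by
      have : 0 < b := lt_of_lt_of_le ha hab
      gcongr
    have h2 : 0 ≤ a ^ 5 := by positivity
    calc _ ≤ B ^ 5 / 5 := by linarith
      _ ≤ _ := hB5
      _ ≤ _ := by gcongr; nlinarith
  have hm : ∀ a', 0 < a' → B ≤ a' → a' ≤ b →
      ‖kpJ α (lam ^ 2) X c η a' b‖ ≤ 12 * (1 + |η|) / lam := by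
    intro a' h0 h1 h2
    refine kpJ_high h2 h0 hlam hc rfl (hαB.trans (by gcongr)) (hlB.trans (by gcongr))
  rcases le_total B a with h' | h'
  · refine (hm a ha h' hab).trans ?_
    gcongr; nlinarith
  · rw [kpJ_split α _ X c η ha hB0 (lt_of_lt_of_le ha hab)]
    refine (norm_add_le _ _).trans ?_
    have e1 := kpJ_triv α (lam ^ 2) X c η ha h' hc
    have e2 := hm B hB0 le_rfl h
    have h2 : 0 ≤ a ^ 5 := by positivity
    calc _ ≤ (1 + 2 * A ^ 5) / lam + 12 * (1 + |η|) / lam := by linarith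
      _ = (1 + 2 * A ^ 5 + 12 * (1 + |η|)) / lam := by ring
      _ ≤ _ := by gcongr; nlinarith


/-- Frequency regularizer. -/
noncomputable def kpM (a b ε : ℝ) (p : ℝ × ℝ) : ℝ :=
  if a ^ 2 < |p.1| ∧ |p.1| ≤ b ^ 2 then Real.exp (-(ε * (p.2 ^ 2 / |p.1|))) else 0

lemma kpM_measurable (a b ε : ℝ) : Measurable (kpM a b ε) := by
  unfold kpM
  refine Measurable.ite ?_ (by fun_prop) measurable_const
  have h : Measurable (fun p : ℝ × ℝ => |p.1|) := by fun_prop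
  exact (measurableSet_lt measurable_const h).inter (measurableSet_le h measurable_const)

lemma kpM_nonneg (a b ε : ℝ) (p : ℝ × ℝ) : 0 ≤ kpM a b ε p := by
  unfold kpM; split_ifs <;> positivity

lemma kpM_le_one (a b ε : ℝ) (hε : 0 ≤ ε) (p : ℝ × ℝ) : kpM a b ε p ≤ 1 := by
  unfold kpM; split_ifs
  · rw [Real.exp_le_one_iff]
    have : 0 ≤ ε * (p.2 ^ 2 / |p.1|) := by positivity
    linarith
  · norm_num

lemma kpM_integrable (a b ε : ℝ) (hb : 0 < b) (hε : 0 < ε) :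
    Integrable (kpM a b ε) := by
  have h1 : Integrable (Set.indicator (Set.Icc (-(b ^ 2)) (b ^ 2)) (fun _ : ℝ => (1 : ℝ))) :=
    (integrable_indicator_iff measurableSet_Icc).2 (by simp)
  have h2 := integrable_exp_neg_mul_sq (b := ε / b ^ 2) (by positivity)
  have h3 := h1.mul_prod h2
  refine h3.mono' (kpM_measurable a b ε).aestronglyMeasurable ?_
  filter_upwards with p
  rw [Real.norm_eq_abs, abs_of_nonneg (kpM_nonneg _ _ _ _)]
  unfold kpM
  split_ifs with h
  · have hm : p.1 ∈ Set.Icc (-(b ^ 2)) (b ^ 2) := abs_le.1 h.2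
    rw [Set.indicator_of_mem hm, one_mul]
    apply Real.exp_le_exp.2
    have h0 : 0 < |p.1| := lt_of_le_of_lt (by positivity) h.1
    have : p.2 ^ 2 / b ^ 2 ≤ p.2 ^ 2 / |p.1| := by
      gcongr; exact h.2
    have := mul_le_mul_of_nonneg_left this hε.le
    have e : -(ε / b ^ 2) * p.2 ^ 2 = -(ε * (p.2 ^ 2 / b ^ 2)) := by ring
    rw [e]
    linarith
  · apply mul_nonneg
    · exact Set.indicator_nonneg (fun _ _ => zero_le_one) _
    · positivity

lemma kpM_mul_integrable (a b ε : ℝ) (hb : 0 < b) (hε : 0 < ε) :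
    Integrable (fun p => kpM a b ε p * |p.1|) := by
  refine ((kpM_integrable a b ε hb hε).mul_const (b ^ 2)).mono' ?_ ?_
  · exact ((kpM_measurable a b ε).mul (by fun_prop)).aestronglyMeasurable
  · filter_upwards with p
    rw [Real.norm_eq_abs, abs_of_nonneg (mul_nonneg (kpM_nonneg _ _ _ _) (abs_nonneg _))]
    by_cases h : a ^ 2 < |p.1| ∧ |p.1| ≤ b ^ 2
    · exact mul_le_mul_of_nonneg_left h.2 (kpM_nonneg _ _ _ _)
    · simp [kpM, h]

lemma omega5_measurable (α : ℝ) : Measurable (fun p : ℝ × ℝ => omega5 α p.1 p.2) := by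
  unfold omega5; fun_prop

/-- Regularized dispersive kernel integrand. -/
noncomputable def kpKer (α a b ε η t x y : ℝ) (p : ℝ × ℝ) : ℂ :=
  ((kpM a b ε p * |p.1| : ℝ) : ℂ) * Complex.exp (Complex.I * ((η * Real.log |p.1| : ℝ) : ℂ)) *
    Complex.exp (Complex.I * ((x * p.1 + y * p.2 + t * omega5 α p.1 p.2 : ℝ) : ℂ))

lemma kp_norm_expI (x : ℝ) : ‖Complex.exp (Complex.I * (x : ℂ))‖ = 1 := by
  rw [mul_comm]; exact Complex.norm_exp_ofReal_mul_I _

lemma kpKer_integrable (α a b ε η t x y : ℝ) (hb : 0 < b) (hε : 0 < ε) :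
    Integrable (kpKer α a b ε η t x y) := by
  refine (kpM_mul_integrable a b ε hb hε).mono' ?_ ?_
  · have h1 := kpM_measurable a b ε
    have h2 := omega5_measurable α
    unfold kpKer
    refine Measurable.aestronglyMeasurable ?_
    fun_prop
  · filter_upwards with p
    rw [kpKer, norm_mul, norm_mul, kp_norm_expI, kp_norm_expI, mul_one, mul_one, Complex.norm_real,
      Real.norm_eq_abs, abs_of_nonneg (mul_nonneg (kpM_nonneg _ _ _ _) (abs_nonneg _))]

lemma kp_gauss (ε t y v : ℝ) (hε : 0 < ε) (hv : 0 < v) :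
    ∫ μ : ℝ, Complex.exp (-((ε : ℂ) - Complex.I * t) * ((μ / v : ℝ) : ℂ) ^ 2 + Complex.I * y * μ) =
      v * ((Real.pi / ((ε : ℂ) - Complex.I * t)) ^ (1 / 2 : ℂ) *
        (Complex.exp (((-(y ^ 2 * ε / (4 * (ε ^ 2 + t ^ 2)) * v ^ 2) : ℝ) : ℂ)) *
        Complex.exp (Complex.I * ((-(y ^ 2 * t / (4 * (ε ^ 2 + t ^ 2)) * v ^ 2) : ℝ) : ℂ)))) := by
  have h1 := Measure.integral_comp_mul_left (fun μ : ℝ =>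
    Complex.exp (-((ε : ℂ) - Complex.I * t) * ((μ / v : ℝ) : ℂ) ^ 2 + Complex.I * y * μ)) v
  have hv' : (v : ℂ) ≠ 0 := by exact_mod_cast hv.ne'
  have h2 := integral_cexp_quadratic (b := -((ε : ℂ) - Complex.I * t)) (by simp [hε])
    (Complex.I * y * v) 0
  have hβ : ((ε : ℂ) - Complex.I * t) ≠ 0 := by
    intro h
    have := congrArg Complex.re h
    simp at this
    exact hε.ne' this
  have h3 : ∫ μ : ℝ, Complex.exp (-((ε : ℂ) - Complex.I * t) * ((v * μ / v : ℝ) : ℂ) ^ 2 +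
      Complex.I * y * ((v * μ : ℝ) : ℂ)) = ∫ x : ℝ, Complex.exp (-((ε : ℂ) - Complex.I * t) * (x : ℂ) ^ 2 +
      Complex.I * y * v * x + 0) := by
    congr 1; ext μ
    rw [mul_div_cancel_left₀ _ hv.ne']
    push_cast
    congr 1; ring
  have h4 : ∀ z w : ℂ, w = |v⁻¹| • z → z = v * w := by
    intro z w h
    rw [h, abs_of_pos (inv_pos.2 hv), Complex.real_smul]
    push_cast
    field_simp
  rw [h4 _ _ h1]
  congr 1
  rw [h3, h2, neg_neg, ← Complex.exp_add]
  congr 2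
  have hs : ((ε : ℂ) ^ 2 + (t : ℂ) ^ 2) ≠ 0 := by
    have : ε ^ 2 + t ^ 2 ≠ 0 := by positivity
    exact_mod_cast this
  push_cast
  have e1 : ((ε : ℂ) - Complex.I * t) * ((ε : ℂ) + Complex.I * t) = (ε : ℂ) ^ 2 + (t : ℂ) ^ 2 := by
    ring_nf; rw [Complex.I_sq]; ring
  field_simp
  rw [← e1]
  ring_nf
  simp only [Complex.I_sq, show Complex.I ^ 4 = 1 from Complex.I_pow_four]
  ring

/-- value of the inner integral at `ξ = s v²` -/
lemma kp_inner (α a b ε η t x y v s : ℝ) (hs : s = 1 ∨ s = -1) (hε : 0 < ε) (hv : 0 < v)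
    (hva : a < v) (hvb : v ≤ b) (ha : 0 < a) :
    (∫ μ : ℝ, kpKer α a b ε η t x y (s * v ^ 2, μ)) * v =
      (Real.pi / ((ε : ℂ) - Complex.I * ((s * t : ℝ) : ℂ))) ^ (1 / 2 : ℂ) *
      (((v ^ 4 : ℝ) : ℂ) * kpW (y ^ 2 * ε / (4 * (ε ^ 2 + (s * t) ^ 2))) (2 * η) v *
       Complex.exp (Complex.I * (kpPhi α (s * t)
        (s * x - y ^ 2 * (s * t) / (4 * (ε ^ 2 + (s * t) ^ 2))) v : ℂ))) := by
  have hs2 : s ^ 2 = 1 := by rcases hs with h | h <;> rw [h] <;> norm_num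
  have habs : |s * v ^ 2| = v ^ 2 := by
    rcases hs with h | h <;> rw [h] <;> simp
  have hcond : a ^ 2 < v ^ 2 ∧ v ^ 2 ≤ b ^ 2 := ⟨by gcongr, by gcongr⟩
  have hlog : Real.log (v ^ 2) = 2 * Real.log v := by rw [Real.log_pow]; norm_num
  have hdiv : ∀ μ : ℝ, omega5 α (s * v ^ 2) μ = s * (v ^ 10 - α * v ^ 6) + s * (μ / v) ^ 2 := by
    intro μ
    unfold omega5
    rcases hs with h | h
    · rw [h]; field_simp
    · rw [h]; field_simp; ring
  have h1 : ∀ μ : ℝ, kpKer α a b ε η t x y (s * v ^ 2, μ) =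
      (((v ^ 2 : ℝ) : ℂ) * Complex.exp (Complex.I * ((2 * η * Real.log v : ℝ) : ℂ)) *
       Complex.exp (Complex.I * ((s * t * v ^ 10 - α * (s * t) * v ^ 6 + s * x * v ^ 2 : ℝ) : ℂ))) *
       Complex.exp (-((ε : ℂ) - Complex.I * ((s * t : ℝ) : ℂ)) * ((μ / v : ℝ) : ℂ) ^ 2 + Complex.I * y * μ) := by
    intro μ
    simp only [kpKer, kpM, habs, hdiv, hlog]
    rw [if_pos hcond]
    rw [Complex.ofReal_mul, Complex.ofReal_exp]
    have : ∀ A B C D E F : ℂ, A + C + D = E + F →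
      ∀ r : ℂ, Complex.exp A * r * Complex.exp B * Complex.exp (C + D) = r * Complex.exp B * Complex.exp E * Complex.exp F := by
      intro A B C D E F h r
      have : Complex.exp A * Complex.exp (C + D) = Complex.exp E * Complex.exp F := by
        rw [← Complex.exp_add, ← Complex.exp_add]; congr 1; rw [← h]; ring
      linear_combination (r * Complex.exp B) * this
    have key := this (((-(ε * (μ ^ 2 / v ^ 2)) : ℝ) : ℂ)) (Complex.I * ((2 * η * Real.log v : ℝ) : ℂ))
      (Complex.I * ((x * (s * v ^ 2) + y * μ : ℝ) : ℂ))
      (Complex.I * ((t * (s * (v ^ 10 - α * v ^ 6) + s * (μ / v) ^ 2) : ℝ) : ℂ))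
      (Complex.I * ((s * t * v ^ 10 - α * (s * t) * v ^ 6 + s * x * v ^ 2 : ℝ) : ℂ))
      (-((ε : ℂ) - Complex.I * ((s * t : ℝ) : ℂ)) * ((μ / v : ℝ) : ℂ) ^ 2 + Complex.I * y * μ)
      (by push_cast; ring) ((v ^ 2 : ℝ) : ℂ)
    rw [← key]
    congr 2
    · congr 2; push_cast; ring
    · push_cast; ring
  simp_rw [h1]
  rw [integral_const_mul, kp_gauss ε (s * t) y v hε hv]
  unfold kpW kpPhi
  rw [Complex.exp_add]
  have e : Complex.exp (Complex.I * ((s * t * v ^ 10 - α * (s * t) * v ^ 6 +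
      (s * x - y ^ 2 * (s * t) / (4 * (ε ^ 2 + (s * t) ^ 2))) * v ^ 2 : ℝ) : ℂ)) =
      Complex.exp (Complex.I * ((s * t * v ^ 10 - α * (s * t) * v ^ 6 + s * x * v ^ 2 : ℝ) : ℂ)) *
      Complex.exp (Complex.I * ((-(y ^ 2 * (s * t) / (4 * (ε ^ 2 + (s * t) ^ 2)) * v ^ 2) : ℝ) : ℂ)) := by
    rw [← Complex.exp_add]; congr 1; push_cast; ring
  rw [e]
  push_cast
  ring

lemma kpJ_conj (α t X c η a b : ℝ) :
    (starRingEnd ℂ) (kpJ α t X c η a b) = kpJ α (-t) (-X) c (-η) a b := by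
  unfold kpJ
  rw [intervalIntegral.intervalIntegral_eq_integral_uIoc,
    intervalIntegral.intervalIntegral_eq_integral_uIoc]
  rw [Complex.real_smul, Complex.real_smul, map_mul, Complex.conj_ofReal, ← integral_conj]
  congr 2
  ext v
  rw [map_mul, map_mul, ← Complex.exp_conj, Complex.conj_ofReal, kpW, ← Complex.exp_conj]
  simp only [map_mul, map_add, Complex.conj_I, Complex.conj_ofReal, kpW, kpPhi]
  congr 2
  · congr 1; push_cast; ring
  · push_cast; ring

lemma kpJ_core' (α : ℝ) : ∃ C : ℝ, 0 < C ∧ ∀ t : ℝ, t ≠ 0 → |t| ≤ 2 → ∀ X c η a b : ℝ,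
    0 < a → a ≤ b → 0 ≤ c → ‖kpJ α t X c η a b‖ ≤ C * (1 + |η|) / Real.sqrt |t| := by
  obtain ⟨C, hC, h⟩ := kpJ_core α
  refine ⟨C, hC, ?_⟩
  intro t ht ht2 X c η a b ha hab hc
  have hp : 0 < |t| := abs_pos.2 ht
  have hs : 0 < Real.sqrt |t| := Real.sqrt_pos.2 hp
  have hs2 : Real.sqrt |t| ≤ 2 := by
    rw [Real.sqrt_le_left (by norm_num)]; linarith
  have hsq : Real.sqrt |t| ^ 2 = |t| := Real.sq_sqrt hp.le
  have key := h _ hs hs2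
  rw [hsq] at key
  rcases lt_or_gt_of_ne ht with h0 | h0
  · have h1 := key (-X) c (-η) a b ha hab hc
    rw [← Complex.norm_conj, kpJ_conj]
    nth_rewrite 1 [abs_of_neg h0] at h1
    rwa [abs_neg] at h1
  · have h1 := key X c η a b ha hab hc
    nth_rewrite 1 [abs_of_pos h0] at h1
    exact h1

lemma kp_half (α a b ε η t x y s : ℝ) (hs : s = 1 ∨ s = -1) (hε : 0 < ε) (ha : 0 < a)
    (hab : a ≤ b) :
    ∫ ξ in Set.Ioi (0 : ℝ), (∫ μ : ℝ, kpKer α a b ε η t x y (s * ξ, μ)) =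
      2 * (Real.pi / ((ε : ℂ) - Complex.I * ((s * t : ℝ) : ℂ))) ^ (1 / 2 : ℂ) *
      kpJ α (s * t) (s * x - y ^ 2 * (s * t) / (4 * (ε ^ 2 + (s * t) ^ 2)))
       (y ^ 2 * ε / (4 * (ε ^ 2 + (s * t) ^ 2))) (2 * η) a b := by
  rw [← integral_comp_rpow_Ioi (fun ξ => ∫ μ : ℝ, kpKer α a b ε η t x y (s * ξ, μ))
    (p := 2) (by norm_num)]
  rw [setIntegral_eq_of_subset_of_forall_sdiff_eq_zero (s := Set.Ioc a b) measurableSet_Ioi]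
  · rw [kpJ, intervalIntegral.integral_of_le hab, ← integral_const_mul]
    refine setIntegral_congr_fun measurableSet_Ioc ?_
    intro v hv
    have hv0 : 0 < v := lt_trans ha hv.1
    have := kp_inner α a b ε η t x y v s hs hε hv0 hv.1 hv.2 ha
    simp only
    rw [mul_assoc, ← this, Complex.real_smul]
    norm_num
    ring
  · intro v hv; exact lt_trans ha hv.1
  · intro v hv
    have hv0 : 0 < v := hv.1
    have : ¬ (a ^ 2 < |s * v ^ 2| ∧ |s * v ^ 2| ≤ b ^ 2) := by
      have habs : |s * v ^ 2| = v ^ 2 := by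
        rcases hs with h | h <;> rw [h] <;> simp
      rw [habs]
      intro h
      apply hv.2
      constructor
      · exact lt_of_pow_lt_pow_left₀ 2 hv0.le h.1
      · exact le_of_sq_le_sq h.2 (ha.le.trans hab)
    have hz : ∀ μ : ℝ, kpKer α a b ε η t x y (s * v ^ (2 : ℝ), μ) = 0 := by
      intro μ
      rw [Real.rpow_two]
      unfold kpKer kpM
      rw [if_neg this]
      simp
    simp only [hz, integral_zero, smul_zero]

lemma kp_sqrt_norm (ε t : ℝ) (ht : t ≠ 0) :
    ‖((Real.pi : ℂ) / ((ε : ℂ) - Complex.I * (t : ℂ))) ^ (1 / 2 : ℂ)‖ ≤ 2 / Real.sqrt |t| := by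
  have hp : 0 < |t| := abs_pos.2 ht
  have h1 : (1 / 2 : ℂ) = ((1 / 2 : ℝ) : ℂ) := by push_cast; rfl
  rw [h1, Complex.norm_cpow_real, norm_div, Complex.norm_real, Real.norm_eq_abs,
    abs_of_pos Real.pi_pos]
  have h2 : |t| ≤ ‖(ε : ℂ) - Complex.I * (t : ℂ)‖ := by
    have := Complex.abs_im_le_norm ((ε : ℂ) - Complex.I * (t : ℂ))
    simpa using this
  rw [← Real.sqrt_eq_rpow]
  have h3 : Real.pi / ‖(ε : ℂ) - Complex.I * (t : ℂ)‖ ≤ 4 / |t| := by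
    have := Real.pi_le_four
    gcongr
  refine (Real.sqrt_le_sqrt h3).trans ?_
  rw [Real.sqrt_div (by norm_num), show (4 : ℝ) = 2 ^ 2 by norm_num, Real.sqrt_sq (by norm_num)]

/-- Dispersive estimate for the regularized kernel. -/
lemma kp_kernel (α : ℝ) : ∃ C : ℝ, 0 < C ∧ ∀ t : ℝ, t ≠ 0 → |t| ≤ 2 → ∀ a b ε : ℝ, 0 < a → a ≤ b →
    0 < ε → ∀ η x y : ℝ, ‖∫ p, kpKer α a b ε η t x y p‖ ≤ C * (1 + |η|) / |t| := by
  obtain ⟨C, hC, h⟩ := kpJ_core' α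
  refine ⟨16 * C, by positivity, ?_⟩
  intro t ht ht2 a b ε ha hab hε η x y
  have hIntg := kpKer_integrable α a b ε η t x y (lt_of_lt_of_le ha hab) hε
  have hint2 := hIntg.integral_prod_left
  have hp : 0 < |t| := abs_pos.2 ht
  have hhalf : ∀ s : ℝ, s = 1 ∨ s = -1 →
      ‖∫ ξ in Set.Ioi (0 : ℝ), (∫ μ : ℝ, kpKer α a b ε η t x y (s * ξ, μ))‖ ≤
        8 * C * (1 + |η|) / |t| := by
    intro s hs
    have hst : |s * t| = |t| := by rcases hs with h | h <;> rw [h] <;> simp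
    have hst0 : s * t ≠ 0 := by rw [← abs_pos, hst]; exact hp
    rw [kp_half α a b ε η t x y s hs hε ha hab, norm_mul, norm_mul]
    have e1 := kp_sqrt_norm ε (s * t) hst0
    have e2 := h (s * t) hst0 (by rw [hst]; exact ht2)
      (s * x - y ^ 2 * (s * t) / (4 * (ε ^ 2 + (s * t) ^ 2)))
       (y ^ 2 * ε / (4 * (ε ^ 2 + (s * t) ^ 2))) (2 * η) a b ha hab (by positivity)
    rw [hst] at e1 e2
    have hsq : Real.sqrt |t| * Real.sqrt |t| = |t| := Real.mul_self_sqrt hp.le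
    have hs0 : 0 < Real.sqrt |t| := Real.sqrt_pos.2 hp
    have hη := abs_nonneg η
    calc _ ≤ 2 * (2 / Real.sqrt |t|) * (C * (1 + |2 * η|) / Real.sqrt |t|) := by
          gcongr
          simp
      _ = 4 * C * (1 + 2 * |η|) / (Real.sqrt |t| * Real.sqrt |t|) := by
          rw [abs_mul, abs_of_pos (by norm_num : (0 : ℝ) < 2)]; field_simp; ring
      _ ≤ 8 * C * (1 + |η|) / |t| := by
          rw [hsq]
          gcongr ?_ / _
          nlinarith
  have hsplit : ∫ p, kpKer α a b ε η t x y p =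
      (∫ ξ in Set.Ioi (0 : ℝ), (∫ μ : ℝ, kpKer α a b ε η t x y (-1 * ξ, μ))) +
      (∫ ξ in Set.Ioi (0 : ℝ), (∫ μ : ℝ, kpKer α a b ε η t x y (1 * ξ, μ))) := by
    have h1 : ∫ p, kpKer α a b ε η t x y p = ∫ ξ, ∫ μ, kpKer α a b ε η t x y (ξ, μ) :=
      integral_prod _ hIntg
    rw [h1, ← intervalIntegral.integral_Iic_add_Ioi (b := 0) hint2.integrableOn hint2.integrableOn]
    congr 1
    · have := integral_comp_neg_Ioi 0 (fun ξ => ∫ μ, kpKer α a b ε η t x y (ξ, μ))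
      rw [neg_zero] at this
      rw [← this]
      simp
    · simp
  rw [hsplit]
  refine (norm_add_le _ _).trans ?_
  have e1 := hhalf (-1) (Or.inr rfl)
  have e2 := hhalf 1 (Or.inl rfl)
  calc _ ≤ _ := add_le_add e1 e2
    _ = _ := by ring


/-- Fubini expansion of a weighted product of two oscillatory integrals. -/
lemma kp_fub {P X Y : Type*} [MeasurableSpace P] [MeasurableSpace X] [MeasurableSpace Y]
    {μ : Measure P} {ν : Measure X} {ρ : Measure Y} [SFinite μ] [SFinite ν] [SFinite ρ]
    (w : P → ℂ) (f : X → ℂ) (g : Y → ℂ) (e : P → X → ℂ) (e' : P → Y → ℂ)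
    (hw : Integrable w μ) (hf : Integrable f ν) (hg : Integrable g ρ)
    (he : Measurable (Function.uncurry e)) (he' : Measurable (Function.uncurry e'))
    (hb : ∀ p x, ‖e p x‖ ≤ 1) (hb' : ∀ p x, ‖e' p x‖ ≤ 1) :
    ∫ p, w p * ((∫ x, f x * e p x ∂ν) * (∫ y, g y * e' p y ∂ρ)) ∂μ =
      ∫ z, f z.1 * g z.2 * ∫ p, w p * (e p z.1 * e' p z.2) ∂μ ∂(ν.prod ρ) := by
  have hIntg : Integrable (Function.uncurry (fun (p : P) (z : X × Y) =>
      w p * ((f z.1 * e p z.1) * (g z.2 * e' p z.2)))) (μ.prod (ν.prod ρ)) := by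
    have h1 : Integrable (fun q : P × (X × Y) => w q.1 * (f q.2.1 * g q.2.2)) (μ.prod (ν.prod ρ)) :=
      hw.mul_prod (hf.mul_prod hg)
    have h2 : Integrable (fun q : P × (X × Y) => (w q.1 * (f q.2.1 * g q.2.2)) *
        (e q.1 q.2.1 * e' q.1 q.2.2)) (μ.prod (ν.prod ρ)) := by
      refine h1.mul_bdd (c := 1) ?_ ?_
      · apply Measurable.aestronglyMeasurable
        have a1 : Measurable (fun q : P × (X × Y) => (q.1, q.2.1)) := by fun_prop
        have a2 : Measurable (fun q : P × (X × Y) => (q.1, q.2.2)) := by fun_prop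
        exact (he.comp a1).mul (he'.comp a2)
      · refine Filter.Eventually.of_forall fun q => ?_
        rw [norm_mul]
        exact mul_le_one₀ (hb _ _) (norm_nonneg _) (hb' _ _)
    refine h2.congr (Filter.Eventually.of_forall fun q => ?_)
    simp only [Function.uncurry]; ring
  have := integral_integral_swap hIntg
  calc _ = ∫ p, ∫ z, w p * ((f z.1 * e p z.1) * (g z.2 * e' p z.2)) ∂(ν.prod ρ) ∂μ := by
        congr 1; ext p
        rw [integral_const_mul, integral_prod_mul (fun x => f x * e p x) (fun y => g y * e' p y)]
    _ = _ := this
    _ = _ := by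
        congr 1; ext z
        rw [← integral_const_mul]
        congr 1; ext p
        ring

/-- A weighted square integral as the norm of a complex integral. -/
lemma kp_sq_form {P : Type*} [MeasurableSpace P] {μ : Measure P} (w : P → ℝ) (F : P → ℂ)
    (hw : Integrable w μ) (hw0 : ∀ p, 0 ≤ w p) (hF : Measurable F) (B : ℝ) (hB : ∀ p, ‖F p‖ ≤ B) :
    ∫⁻ p, ENNReal.ofReal (w p) * ‖F p‖ₑ ^ 2 ∂μ =
      ‖∫ p, (w p : ℂ) * (F p * (starRingEnd ℂ) (F p)) ∂μ‖ₑ := by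
  have hreal : ∀ p, (w p : ℂ) * (F p * (starRingEnd ℂ) (F p)) = ((w p * ‖F p‖ ^ 2 : ℝ) : ℂ) := by
    intro p; rw [Complex.mul_conj']; push_cast; ring
  have hIntg : Integrable (fun p => w p * ‖F p‖ ^ 2) μ := by
    refine hw.mul_bdd (c := B ^ 2) (by fun_prop) ?_
    refine Filter.Eventually.of_forall fun p => ?_
    rw [Real.norm_of_nonneg (by positivity)]
    have := hB p
    gcongr
  simp_rw [hreal]
  rw [integral_complex_ofReal, ← ofReal_norm, Complex.norm_real, Real.norm_of_nonneg
    (integral_nonneg fun p => mul_nonneg (hw0 p) (by positivity)),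
    ofReal_integral_eq_lintegral_ofReal hIntg (Filter.Eventually.of_forall fun p => mul_nonneg (hw0 p) (by positivity))]
  congr 1; ext p
  rw [ENNReal.ofReal_mul (hw0 p), ENNReal.ofReal_pow (norm_nonneg _), ofReal_norm]

lemma kp_gauss1 (ε u : ℝ) (hε : 0 < ε) :
    ‖∫ x : ℝ, Complex.exp (Complex.I * u * x) * Complex.exp (-(ε:ℂ) * x ^ 2)‖ =
      (Real.pi / ε) ^ (1 / 2 : ℝ) * Real.exp (-(u ^ 2 / (4 * ε))) := by
  have := fourierIntegral_gaussian (b := (ε : ℂ)) (by simpa using hε) (u : ℂ)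
  rw [this, norm_mul]
  congr 1
  · rw [← Complex.ofReal_div, Complex.norm_cpow_eq_rpow_re_of_pos (by positivity)]
    norm_num
  · rw [Complex.norm_exp]
    congr 1
    rw [show -(u:ℂ) ^ 2 / (4 * (ε:ℂ)) = ((-(u ^ 2 / (4 * ε)) : ℝ) : ℂ) by push_cast; ring]
    exact Complex.ofReal_re _

noncomputable def kpGs (ε : ℝ) (p : ℝ × ℝ) : ℝ := Real.exp (-ε * p.1 ^ 2) * Real.exp (-ε * p.2 ^ 2)
noncomputable def kpGh (ε : ℝ) (p : ℝ × ℝ) : ℝ :=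
  (Real.pi / ε) * (Real.exp (-(1 / (4 * ε)) * p.1 ^ 2) * Real.exp (-(1 / (4 * ε)) * p.2 ^ 2))

lemma kpGs_hat (ε : ℝ) (hε : 0 < ε) (u : ℝ × ℝ) :
    ‖∫ p : ℝ × ℝ, (kpGs ε p : ℂ) * Complex.exp (Complex.I * ((u.1 * p.1 + u.2 * p.2 : ℝ) : ℂ))‖
      = kpGh ε u := by
  have : ∀ p : ℝ × ℝ, (kpGs ε p : ℂ) * Complex.exp (Complex.I * ((u.1 * p.1 + u.2 * p.2 : ℝ) : ℂ))
      = (Complex.exp (Complex.I * u.1 * p.1) * Complex.exp (-(ε:ℂ) * p.1 ^ 2)) *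
        (Complex.exp (Complex.I * u.2 * p.2) * Complex.exp (-(ε:ℂ) * p.2 ^ 2)) := by
    intro p
    unfold kpGs
    push_cast
    rw [← Complex.exp_add, ← Complex.exp_add, ← Complex.exp_add, ← Complex.exp_add, ← Complex.exp_add]
    congr 1; ring
  simp_rw [this]
  rw [Measure.volume_eq_prod, integral_prod_mul (fun x : ℝ => Complex.exp (Complex.I * u.1 * x) * Complex.exp (-(ε:ℂ) * x ^ 2))
    (fun x : ℝ => Complex.exp (Complex.I * u.2 * x) * Complex.exp (-(ε:ℂ) * x ^ 2)), norm_mul, kp_gauss1 _ _ hε, kp_gauss1 _ _ hε]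
  unfold kpGh
  have h : (Real.pi / ε) ^ (1 / 2 : ℝ) * (Real.pi / ε) ^ (1 / 2 : ℝ) = Real.pi / ε := by
    rw [← Real.rpow_add (by positivity)]; norm_num
  rw [mul_mul_mul_comm, h]
  congr 2
  · congr 1; ring
  · congr 1; ring

lemma kpGs_integrable (ε : ℝ) (hε : 0 < ε) : Integrable (kpGs ε) :=
  (integrable_exp_neg_mul_sq hε).mul_prod (integrable_exp_neg_mul_sq hε)

lemma kpGh_meas (ε : ℝ) : Measurable (kpGh ε) := by unfold kpGh; fun_prop

lemma kpGh_lint (ε : ℝ) (hε : 0 < ε) :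
    ∫⁻ u : ℝ × ℝ, ENNReal.ofReal (kpGh ε u) = ENNReal.ofReal ((2 * Real.pi) ^ 2) := by
  have h4 : 0 < 1 / (4 * ε) := by positivity
  have hi : Integrable (kpGh ε) :=
    ((integrable_exp_neg_mul_sq h4).mul_prod (integrable_exp_neg_mul_sq h4)).const_mul _
  rw [← ofReal_integral_eq_lintegral_ofReal hi (Filter.Eventually.of_forall fun u => by
    unfold kpGh; positivity)]
  congr 1
  unfold kpGh
  rw [integral_const_mul, Measure.volume_eq_prod,
    integral_prod_mul (fun x : ℝ => Real.exp (-(1 / (4 * ε)) * x ^ 2)) (fun x : ℝ => Real.exp (-(1 / (4 * ε)) * x ^ 2)),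
    integral_gaussian, Real.mul_self_sqrt (by positivity)]
  field_simp
  ring

noncomputable def kpFT (f : ℝ × ℝ → ℂ) (p : ℝ × ℝ) : ℂ :=
  ∫ x : ℝ × ℝ, f x * Complex.exp (Complex.I * ((x.1 * p.1 + x.2 * p.2 : ℝ) : ℂ))

lemma kpFT_meas (f : ℝ × ℝ → ℂ) (hf : Measurable f) : Measurable (kpFT f) := by
  unfold kpFT
  apply StronglyMeasurable.measurable
  apply StronglyMeasurable.integral_prod_right'
    (f := fun q : (ℝ × ℝ) × (ℝ × ℝ) => f q.2 * Complex.exp (Complex.I * ((q.2.1 * q.1.1 + q.2.2 * q.1.2 : ℝ) : ℂ)))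
  apply Measurable.stronglyMeasurable
  fun_prop

lemma kp_normE (x : ℝ) : ‖Complex.exp (Complex.I * (x : ℂ))‖ = 1 := by
  rw [mul_comm]; exact Complex.norm_exp_ofReal_mul_I x

lemma kpFT_conj (f : ℝ × ℝ → ℂ) (p : ℝ × ℝ) : (starRingEnd ℂ) (kpFT f p) =
    ∫ x : ℝ × ℝ, (starRingEnd ℂ) (f x) * Complex.exp (-Complex.I * ((x.1 * p.1 + x.2 * p.2 : ℝ) : ℂ)) := by
  unfold kpFT
  rw [← integral_conj]
  congr 1; ext x
  rw [map_mul, ← Complex.exp_conj, map_mul, Complex.conj_I, Complex.conj_ofReal]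

lemma kp_bessel_eps (f : ℝ × ℝ → ℂ) (hf : Integrable f) (hm : Measurable f) (ε : ℝ) (hε : 0 < ε) :
    ∫⁻ p, ENNReal.ofReal (kpGs ε p) * ‖kpFT f p‖ₑ ^ 2 ≤
      ENNReal.ofReal ((2 * Real.pi) ^ 2) * ∫⁻ x, ‖f x‖ₑ ^ 2 := by
  have hE := kp_fub (μ := (volume : Measure (ℝ × ℝ))) (ν := (volume : Measure (ℝ × ℝ)))
    (ρ := (volume : Measure (ℝ × ℝ))) (fun p => (kpGs ε p : ℂ)) f (fun x => (starRingEnd ℂ) (f x))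
    (fun p x => Complex.exp (Complex.I * ((x.1 * p.1 + x.2 * p.2 : ℝ) : ℂ)))
    (fun p x => Complex.exp (-Complex.I * ((x.1 * p.1 + x.2 * p.2 : ℝ) : ℂ)))
    (kpGs_integrable ε hε).ofReal hf (by
      exact (Complex.conjLIE.toContinuousLinearEquiv : ℂ →L[ℝ] ℂ).integrable_comp hf)
    (by unfold Function.uncurry; fun_prop)
    (by unfold Function.uncurry; fun_prop) (fun p x => (kp_normE _).le) (fun p x => by
      rw [show -Complex.I * ((x.1 * p.1 + x.2 * p.2 : ℝ) : ℂ) = Complex.I * ((-(x.1 * p.1 + x.2 * p.2) : ℝ) : ℂ) by push_cast; ring]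
      exact (kp_normE _).le)
  simp_rw [← kpFT_conj] at hE
  change ∫ p, (kpGs ε p : ℂ) * (kpFT f p * _) = _ at hE
  have hb : ∀ p, ‖kpFT f p‖ ≤ ∫ x, ‖f x‖ := by
    intro p
    refine (norm_integral_le_integral_norm _).trans (le_of_eq ?_)
    congr 1; ext x; rw [norm_mul, kp_normE, mul_one]
  have hFm := kpFT_meas f hm
  have hGs0 : ∀ p, 0 ≤ kpGs ε p := fun p => by unfold kpGs; positivity
  have hL := kp_sq_form (kpGs ε) (kpFT f) (kpGs_integrable ε hε) hGs0 hFm _ hb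
  rw [hL, hE]
  refine (enorm_integral_le_lintegral_enorm _).trans ?_
  have hk : ∀ z : (ℝ × ℝ) × (ℝ × ℝ), ‖f z.1 * (starRingEnd ℂ) (f z.2) * ∫ p : ℝ × ℝ, (kpGs ε p : ℂ) *
      (Complex.exp (Complex.I * ((z.1.1 * p.1 + z.1.2 * p.2 : ℝ) : ℂ)) *
      Complex.exp (-Complex.I * ((z.2.1 * p.1 + z.2.2 * p.2 : ℝ) : ℂ)))‖ₑ ≤
      2⁻¹ * (‖f z.1‖ₑ ^ 2 * ENNReal.ofReal (kpGh ε (z.1 - z.2))) +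
      2⁻¹ * (‖f z.2‖ₑ ^ 2 * ENNReal.ofReal (kpGh ε (z.1 - z.2))) := by
    intro z
    have : ∀ p : ℝ × ℝ, (Complex.exp (Complex.I * ((z.1.1 * p.1 + z.1.2 * p.2 : ℝ) : ℂ)) *
      Complex.exp (-Complex.I * ((z.2.1 * p.1 + z.2.2 * p.2 : ℝ) : ℂ))) =
        Complex.exp (Complex.I * (((z.1 - z.2).1 * p.1 + (z.1 - z.2).2 * p.2 : ℝ) : ℂ)) := by
      intro p; rw [← Complex.exp_add]; congr 1; push_cast [Prod.fst_sub, Prod.snd_sub]; ring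
    simp_rw [this]
    rw [enorm_mul, enorm_mul, ← ofReal_norm (∫ p : ℝ × ℝ, _), kpGs_hat ε hε, RCLike.enorm_conj,
      ← mul_add, ← add_mul, ← mul_assoc]
    refine mul_le_mul_left ?_ _
    rw [← ofReal_norm, ← ofReal_norm, ← ENNReal.ofReal_pow (norm_nonneg _),
      ← ENNReal.ofReal_pow (norm_nonneg _), ← ENNReal.ofReal_add (by positivity) (by positivity),
      ← ENNReal.ofReal_mul (by positivity),
      show (2⁻¹ : ℝ≥0∞) = ENNReal.ofReal 2⁻¹ by rw [ENNReal.ofReal_inv_of_pos (by norm_num)]; norm_num,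
      ← ENNReal.ofReal_mul (by positivity)]
    apply ENNReal.ofReal_le_ofReal
    nlinarith [sq_nonneg (‖f z.1‖ - ‖f z.2‖)]
  refine (lintegral_mono hk).trans ?_
  have hGm := kpGh_meas ε
  have m1 : Measurable (fun z : (ℝ × ℝ) × (ℝ × ℝ) => ‖f z.1‖ₑ ^ 2 * ENNReal.ofReal (kpGh ε (z.1 - z.2))) := by fun_prop
  have m2 : Measurable (fun z : (ℝ × ℝ) × (ℝ × ℝ) => ‖f z.2‖ₑ ^ 2 * ENNReal.ofReal (kpGh ε (z.1 - z.2))) := by fun_prop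
  rw [lintegral_add_left (by fun_prop), lintegral_const_mul _ m1, lintegral_const_mul _ m2,
    lintegral_prod _ m1.aemeasurable, lintegral_prod_symm _ m2.aemeasurable]
  have i1 : ∀ x : ℝ × ℝ, ∫⁻ y : ℝ × ℝ, ‖f x‖ₑ ^ 2 * ENNReal.ofReal (kpGh ε (x - y)) =
      ‖f x‖ₑ ^ 2 * ENNReal.ofReal ((2 * Real.pi) ^ 2) := by
    intro x
    rw [lintegral_const_mul _ (by fun_prop)]
    have e := lintegral_sub_left_eq_self (μ := (volume : Measure (ℝ × ℝ))) (fun u => ENNReal.ofReal (kpGh ε u)) x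
    rw [e, kpGh_lint ε hε]
  have i2 : ∀ y : ℝ × ℝ, ∫⁻ x : ℝ × ℝ, ‖f y‖ₑ ^ 2 * ENNReal.ofReal (kpGh ε (x - y)) =
      ‖f y‖ₑ ^ 2 * ENNReal.ofReal ((2 * Real.pi) ^ 2) := by
    intro x
    rw [lintegral_const_mul _ (by fun_prop)]
    have e := lintegral_sub_right_eq_self (μ := (volume : Measure (ℝ × ℝ))) (fun u => ENNReal.ofReal (kpGh ε u)) x
    rw [e, kpGh_lint ε hε]
  simp only [i1, i2]
  rw [lintegral_mul_const _ (by fun_prop), ← add_mul, ENNReal.inv_two_add_inv_two, one_mul, mul_comm]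

/-- Bessel inequality for the two dimensional Fourier transform. -/
lemma kp_bessel (f : ℝ × ℝ → ℂ) (hf : Integrable f) (hm : Measurable f) :
    ∫⁻ p, ‖kpFT f p‖ₑ ^ 2 ≤ ENNReal.ofReal ((2 * Real.pi) ^ 2) * ∫⁻ x, ‖f x‖ₑ ^ 2 := by
  have hFm := kpFT_meas f hm
  have hlim : ∀ p, Filter.Tendsto (fun n : ℕ => ENNReal.ofReal (kpGs (1 / ((n : ℝ) + 1)) p) * ‖kpFT f p‖ₑ ^ 2)
      Filter.atTop (nhds (‖kpFT f p‖ₑ ^ 2)) := by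
    intro p
    have h1 : Filter.Tendsto (fun n : ℕ => ENNReal.ofReal (kpGs (1 / ((n : ℝ) + 1)) p)) Filter.atTop (nhds 1) := by
      rw [← ENNReal.ofReal_one]
      apply ENNReal.tendsto_ofReal
      have hc : Continuous (fun ε : ℝ => kpGs ε p) := by unfold kpGs; fun_prop
      have := (hc.tendsto 0).comp (tendsto_one_div_add_atTop_nhds_zero_nat (𝕜 := ℝ))
      simpa [kpGs, Function.comp_def] using this
    have := ENNReal.Tendsto.mul_const (b := ‖kpFT f p‖ₑ ^ 2) h1 (Or.inl one_ne_zero)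
    simpa using this
  calc ∫⁻ p, ‖kpFT f p‖ₑ ^ 2 = ∫⁻ p, Filter.liminf (fun n : ℕ => ENNReal.ofReal (kpGs (1 / ((n : ℝ) + 1)) p) * ‖kpFT f p‖ₑ ^ 2) Filter.atTop := by
        congr 1; ext p; exact (hlim p).liminf_eq.symm
    _ ≤ Filter.liminf (fun n : ℕ => ∫⁻ p, ENNReal.ofReal (kpGs (1 / ((n : ℝ) + 1)) p) * ‖kpFT f p‖ₑ ^ 2) Filter.atTop := by
        apply lintegral_liminf_le
        intro n; unfold kpGs; fun_prop
    _ ≤ _ := by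
        refine Filter.liminf_le_of_frequently_le' (Filter.Frequently.of_forall fun n => ?_)
        exact kp_bessel_eps f hf hm _ (by positivity)


lemma kp_exp_bd (s l : ℝ) (h0 : 0 ≤ s) (h1 : s ≤ 1) : Real.exp (s * l) ≤ 1 + Real.exp l := by
  rcases le_total 0 l with h | h
  · have : Real.exp (s * l) ≤ Real.exp l := Real.exp_le_exp.2 (by nlinarith)
    linarith
  · have : Real.exp (s * l) ≤ 1 := Real.exp_le_one_iff.2 (by nlinarith)
    have := Real.exp_pos l
    linarith

lemma kp_exp_bd' (k s l : ℝ) (hk : 0 < k) (h0 : k ≤ s) (h1 : s ≤ 1 - k) :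
    |l| * Real.exp (s * l) ≤ (1 + Real.exp l) / k := by
  rw [le_div_iff₀ hk]
  rcases le_total 0 l with h | h
  · rw [abs_of_nonneg h]
    have e1 : k * l ≤ Real.exp (k * l) := by linarith [Real.add_one_le_exp (k * l)]
    calc l * Real.exp (s * l) * k = (k * l) * Real.exp (s * l) := by ring
      _ ≤ Real.exp (k * l) * Real.exp (s * l) := by gcongr
      _ = Real.exp ((k + s) * l) := by rw [← Real.exp_add]; ring_nf
      _ ≤ _ := kp_exp_bd _ _ (by linarith) (by linarith)
  · rw [abs_of_nonpos h]
    have e1 : k * (-l) ≤ Real.exp (k * (-l)) := by linarith [Real.add_one_le_exp (k * (-l))]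
    calc (-l) * Real.exp (s * l) * k = (k * (-l)) * Real.exp (s * l) := by ring
      _ ≤ Real.exp (k * (-l)) * Real.exp (s * l) := by gcongr
      _ = Real.exp ((s - k) * l) := by rw [← Real.exp_add]; ring_nf
      _ ≤ _ := kp_exp_bd _ _ (by linarith) (by linarith)

/-- Abstract form of Stein's interpolation argument for an exponential family of integrals. -/
lemma kp_stein {Ω : Type*} [MeasurableSpace Ω] {μ : Measure Ω} (c : Ω → ℂ) (L : Ω → ℝ)
    (hL : Measurable L) (hc : Integrable c μ)
    (hcL : Integrable (fun w => c w * (Real.exp (L w) : ℂ)) μ) (δ B0 B1 : ℝ) (hδ0 : 0 ≤ δ) (hδ1 : δ ≤ 1)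
    (hB0 : 0 ≤ B0) (hB1 : 0 ≤ B1)
    (h0 : ∀ η : ℝ, ‖∫ w, c w * Complex.exp ((η * Complex.I) * L w) ∂μ‖ ≤ B0)
    (h1 : ∀ η : ℝ, ‖∫ w, c w * Complex.exp ((1 + η * Complex.I) * L w) ∂μ‖ ≤ B1 * (1 + |η|)) :
    ‖∫ w, c w * Complex.exp ((δ : ℂ) * L w) ∂μ‖ ≤ 6 * (B0 ^ (1 - δ) * B1 ^ δ) := by
  set J : ℂ → ℂ := fun z => ∫ w, c w * Complex.exp (z * L w) ∂μ with hJ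
  set bd : Ω → ℝ := fun w => ‖c w‖ * (1 + Real.exp (L w)) with hbd
  have hbdi : Integrable bd μ := by
    have := hc.norm.add hcL.norm
    refine this.congr (Filter.Eventually.of_forall fun w => ?_)
    simp only [Pi.add_apply, hbd, norm_mul, Complex.norm_real, Real.norm_of_nonneg (Real.exp_pos _).le]
    ring
  have hnorm : ∀ (z : ℂ) w, ‖c w * Complex.exp (z * L w)‖ = ‖c w‖ * Real.exp (z.re * L w) := by
    intro z w
    rw [norm_mul, Complex.norm_exp]; simp
  have hpt : ∀ z : ℂ, 0 ≤ z.re → z.re ≤ 1 → ∀ w, ‖c w * Complex.exp (z * L w)‖ ≤ bd w := by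
    intro z hz0 hz1 w
    rw [hnorm]
    exact mul_le_mul_of_nonneg_left (kp_exp_bd _ _ hz0 hz1) (norm_nonneg _)
  have hmeas : ∀ z : ℂ, AEStronglyMeasurable (fun w => c w * Complex.exp (z * L w)) μ := by
    intro z
    exact hc.1.mul (by fun_prop)
  have hcont : ContinuousOn J (Complex.re ⁻¹' Set.Icc 0 1) := by
    apply continuousOn_of_dominated (bound := bd) (fun z _ => hmeas z)
    · intro z hz
      exact Filter.Eventually.of_forall (hpt z hz.1 hz.2)
    · exact hbdi
    · exact Filter.Eventually.of_forall fun w => by fun_prop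
  have hdiff : DifferentiableOn ℂ J (Complex.re ⁻¹' Set.Ioo 0 1) := by
    intro z hz
    have hz' : 0 < z.re ∧ z.re < 1 := hz
    set k := min z.re (1 - z.re) / 2 with hk
    have hk0 : 0 < k := by
      have : 0 < min z.re (1 - z.re) := lt_min hz'.1 (by linarith [hz'.2])
      positivity
    have hk1 : k ≤ z.re / 2 := by have := min_le_left z.re (1 - z.re); linarith
    have hk2 : k ≤ (1 - z.re) / 2 := by have := min_le_right z.re (1 - z.re); linarith
    have hball : ∀ y ∈ Metric.ball z k, k ≤ y.re ∧ y.re ≤ 1 - k := by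
      intro y hy
      have h1 : |(y - z).re| ≤ ‖y - z‖ := Complex.abs_re_le_norm _
      have h2 : ‖y - z‖ < k := by rwa [← dist_eq_norm]
      rw [Complex.sub_re] at h1
      have h3 := abs_le.1 (h1.trans h2.le)
      constructor <;> linarith
    have := hasDerivAt_integral_of_dominated_loc_of_deriv_le (μ := μ) (𝕜 := ℂ)
      (F := fun z w => c w * Complex.exp (z * L w))
      (F' := fun z w => c w * (L w * Complex.exp (z * L w)))
      (bound := fun w => bd w / k) (x₀ := z) (Metric.ball_mem_nhds z hk0)
      (Filter.Eventually.of_forall hmeas)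
      (hbdi.mono' (hmeas z) (Filter.Eventually.of_forall (hpt z hz'.1.le hz'.2.le)))
      (hc.1.mul (by fun_prop))
      (Filter.Eventually.of_forall fun w y hy => by
        rw [norm_mul, norm_mul, Complex.norm_exp, Complex.norm_real]
        have e : (y * (L w : ℂ)).re = y.re * L w := by simp
        rw [e, hbd]
        simp only
        rw [mul_div_assoc]
        exact mul_le_mul_of_nonneg_left (kp_exp_bd' k _ _ hk0 (hball y hy).1 (hball y hy).2) (norm_nonneg _))
      (hbdi.div_const k)
      (Filter.Eventually.of_forall fun w y hy => by
        have h := ((hasDerivAt_id y).mul_const (L w : ℂ)).cexp.const_mul (c w)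
        convert! h using 1
        simp only [id]; ring)
    exact this.2.differentiableAt.differentiableWithinAt
  have hne : ∀ z : ℂ, 0 ≤ z.re → z + 2 ≠ 0 := by
    intro z hz h
    have := congrArg Complex.re h
    simp at this; linarith
  have hn2 : ∀ z : ℂ, 0 ≤ z.re → 2 ≤ ‖z + 2‖ := by
    intro z hz
    refine le_trans ?_ (Complex.re_le_norm _)
    simp; exact hz
  set Φ : ℂ → ℂ := fun z => J z / (z + 2) with hΦ
  have hd : DiffContOnCl ℂ Φ (Complex.HadamardThreeLines.verticalStrip 0 1) := by
    constructor
    · refine DifferentiableOn.div hdiff (by fun_prop) ?_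
      intro z hz; exact hne z hz.1.le
    · rw [Complex.HadamardThreeLines.verticalStrip, Complex.closure_preimage_re, closure_Ioo zero_ne_one]
      refine ContinuousOn.div hcont (by fun_prop) ?_
      intro z hz; exact hne z hz.1
  have hJb : ∀ z : ℂ, 0 ≤ z.re → z.re ≤ 1 → ‖J z‖ ≤ ∫ w, bd w ∂μ := by
    intro z hz0 hz1
    exact norm_integral_le_of_norm_le hbdi (Filter.Eventually.of_forall (hpt z hz0 hz1))
  have hB : BddAbove ((norm ∘ Φ) '' Complex.HadamardThreeLines.verticalClosedStrip 0 1) := by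
    refine ⟨∫ w, bd w ∂μ, ?_⟩
    rintro _ ⟨z, hz, rfl⟩
    simp only [Function.comp, hΦ, norm_div]
    have h2 := hn2 z hz.1
    refine (div_le_self (norm_nonneg _) (by linarith)).trans (hJb z hz.1 hz.2)
  have key := Complex.HadamardThreeLines.norm_le_interp_of_mem_verticalClosedStrip₀₁' Φ
    (z := (δ : ℂ)) (a := B0) (b := 2 * B1) (by
      simp [Complex.HadamardThreeLines.verticalClosedStrip]; exact ⟨hδ0, hδ1⟩) hd hB
    (by
      intro z hz
      have hz0 : z.re = 0 := hz
      have e : z = z.im * Complex.I := by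
        apply Complex.ext <;> simp [hz0]
      simp only [hΦ, norm_div]
      have h2 := hn2 z hz0.ge
      refine (div_le_self (norm_nonneg _) (by linarith)).trans ?_
      rw [e]; exact h0 _)
    (by
      intro z hz
      have hz0 : z.re = 1 := hz
      have e : z = 1 + z.im * Complex.I := by
        apply Complex.ext <;> simp [hz0]
      simp only [hΦ, norm_div]
      have hp : 0 < ‖z + 2‖ := by linarith [hn2 z (by rw [hz0]; norm_num)]
      rw [div_le_iff₀ hp]
      have hJz : ‖J z‖ ≤ B1 * (1 + |z.im|) := by
        rw [e]; simpa using h1 z.im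
      have a1 : |z.im| ≤ ‖z + 2‖ := by
        have := Complex.abs_im_le_norm (z + 2); simpa using this
      have a2 : 3 ≤ ‖z + 2‖ := by
        refine le_trans ?_ (Complex.re_le_norm _)
        simp [hz0]; norm_num
      refine hJz.trans ?_
      nlinarith)
  rw [Complex.ofReal_re] at key
  have hδ2 : ‖(δ : ℂ) + 2‖ ≤ 3 := by
    rw [show (δ : ℂ) + 2 = ((δ + 2 : ℝ) : ℂ) by push_cast; ring, Complex.norm_real,
      Real.norm_of_nonneg (by linarith)]
    linarith
  have hδn : 0 < ‖(δ : ℂ) + 2‖ := by linarith [hn2 (δ : ℂ) (by simpa using hδ0)]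
  have hfin : ‖J δ‖ ≤ (B0 ^ (1 - δ) * (2 * B1) ^ δ) * 3 := by
    simp only [hΦ, norm_div] at key
    rw [div_le_iff₀ hδn] at key
    refine key.trans ?_
    gcongr
  refine hfin.trans ?_
  rw [Real.mul_rpow (by norm_num) hB1]
  have h2δ : (2 : ℝ) ^ δ ≤ 2 := by
    calc (2 : ℝ) ^ δ ≤ 2 ^ (1 : ℝ) := Real.rpow_le_rpow_of_exponent_le (by norm_num) hδ1
      _ = 2 := by norm_num
  have : 0 ≤ B0 ^ (1 - δ) * B1 ^ δ := by positivity
  nlinarith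


lemma kp_fub' {P X Y : Type*} [MeasurableSpace P] [MeasurableSpace X] [MeasurableSpace Y]
    {μ : Measure P} {ν : Measure X} {ρ : Measure Y} [SFinite μ] [SFinite ν] [SFinite ρ]
    (w : P → ℂ) (f : X → ℂ) (g : Y → ℂ) (e : P → X → ℂ) (e' : P → Y → ℂ)
    (hw : Integrable w μ) (hf : Integrable f ν) (hg : Integrable g ρ)
    (he : Measurable (Function.uncurry e)) (he' : Measurable (Function.uncurry e'))
    (hb : ∀ p x, ‖e p x‖ ≤ 1) (hb' : ∀ p x, ‖e' p x‖ ≤ 1) :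
    Integrable (fun q : P × (X × Y) => w q.1 * ((f q.2.1 * e q.1 q.2.1) * (g q.2.2 * e' q.1 q.2.2)))
      (μ.prod (ν.prod ρ)) ∧
    ∫ q : P × (X × Y), w q.1 * ((f q.2.1 * e q.1 q.2.1) * (g q.2.2 * e' q.1 q.2.2)) ∂(μ.prod (ν.prod ρ)) =
    ∫ p, w p * ((∫ x, f x * e p x ∂ν) * (∫ y, g y * e' p y ∂ρ)) ∂μ := by
  have hIntg : Integrable (fun q : P × (X × Y) =>
      w q.1 * ((f q.2.1 * e q.1 q.2.1) * (g q.2.2 * e' q.1 q.2.2))) (μ.prod (ν.prod ρ)) := by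
    have h1 : Integrable (fun q : P × (X × Y) => w q.1 * (f q.2.1 * g q.2.2)) (μ.prod (ν.prod ρ)) :=
      hw.mul_prod (hf.mul_prod hg)
    have h2 : Integrable (fun q : P × (X × Y) => (w q.1 * (f q.2.1 * g q.2.2)) *
        (e q.1 q.2.1 * e' q.1 q.2.2)) (μ.prod (ν.prod ρ)) := by
      refine h1.mul_bdd (c := 1) ?_ ?_
      · apply Measurable.aestronglyMeasurable
        have a1 : Measurable (fun q : P × (X × Y) => (q.1, q.2.1)) := by fun_prop
        have a2 : Measurable (fun q : P × (X × Y) => (q.1, q.2.2)) := by fun_prop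
        exact (he.comp a1).mul (he'.comp a2)
      · refine Filter.Eventually.of_forall fun q => ?_
        rw [norm_mul]
        exact mul_le_one₀ (hb _ _) (norm_nonneg _) (hb' _ _)
    refine h2.congr (Filter.Eventually.of_forall fun q => ?_)
    simp only; ring
  refine ⟨hIntg, ?_⟩
  rw [integral_prod _ hIntg]
  congr 1; ext p
  simp only
  rw [integral_const_mul, integral_prod_mul (fun x => f x * e p x) (fun y => g y * e' p y)]

/-- Fourier integral with the opposite sign. -/
noncomputable def kpFm (g : ℝ × ℝ → ℂ) (p : ℝ × ℝ) : ℂ :=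
  ∫ x : ℝ × ℝ, g x * Complex.exp (-Complex.I * ((x.1 * p.1 + x.2 * p.2 : ℝ) : ℂ))

lemma kpFm_eq (g : ℝ × ℝ → ℂ) (p : ℝ × ℝ) :
    kpFm g p = (starRingEnd ℂ) (kpFT (fun x => (starRingEnd ℂ) (g x)) p) := by
  rw [kpFT_conj]; simp [kpFm]

lemma kp_conj_integrable {X : Type*} [MeasurableSpace X] {μ : Measure X} {f : X → ℂ} (hf : Integrable f μ) :
    Integrable (fun x => (starRingEnd ℂ) (f x)) μ :=
  (Complex.conjLIE.toContinuousLinearEquiv : ℂ →L[ℝ] ℂ).integrable_comp hf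

lemma kp_conj_measurable {X : Type*} [MeasurableSpace X] {f : X → ℂ} (hf : Measurable f) :
    Measurable (fun x => (starRingEnd ℂ) (f x)) :=
  Complex.continuous_conj.measurable.comp hf

lemma kp_normE' (x : ℝ) : ‖Complex.exp (-Complex.I * (x : ℂ))‖ = 1 := by
  rw [show -Complex.I * (x : ℂ) = Complex.I * ((-x : ℝ) : ℂ) by push_cast; ring]
  exact kp_normE _

lemma kpFm_meas (g : ℝ × ℝ → ℂ) (hg : Measurable g) : Measurable (kpFm g) := by
  have : kpFm g = fun p => (starRingEnd ℂ) (kpFT (fun x => (starRingEnd ℂ) (g x)) p) := by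
    ext p; exact kpFm_eq g p
  rw [this]
  exact kp_conj_measurable (kpFT_meas _ (kp_conj_measurable hg))

lemma kp_besselm (g : ℝ × ℝ → ℂ) (hg : Integrable g) (hgm : Measurable g) :
    ∫⁻ p, ‖kpFm g p‖ₑ ^ 2 ≤ ENNReal.ofReal ((2 * Real.pi) ^ 2) * ∫⁻ x, ‖g x‖ₑ ^ 2 := by
  have := kp_bessel _ (kp_conj_integrable hg) (kp_conj_measurable hgm)
  simp only [RCLike.enorm_conj] at this
  simpa only [kpFm_eq, RCLike.enorm_conj] using this

lemma kp_L2form (w : ℝ × ℝ → ℂ) (f g : ℝ × ℝ → ℂ) (hw1 : ∀ p, ‖w p‖ ≤ 1) (hf : Integrable f)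
    (hfm : Measurable f) (hg : Integrable g) (hgm : Measurable g) :
    ‖∫ p, w p * (kpFT f p * kpFm g p)‖ₑ ≤ ENNReal.ofReal ((2 * Real.pi) ^ 2) *
      ((∫⁻ x, ‖f x‖ₑ ^ 2) ^ (1 / 2 : ℝ) * (∫⁻ x, ‖g x‖ₑ ^ 2) ^ (1 / 2 : ℝ)) := by
  have m1 := kpFT_meas f hfm
  have m2 := kpFm_meas g hgm
  calc ‖∫ p, w p * (kpFT f p * kpFm g p)‖ₑ ≤ ∫⁻ p, ‖w p * (kpFT f p * kpFm g p)‖ₑ :=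
        enorm_integral_le_lintegral_enorm _
    _ ≤ ∫⁻ p, ((fun p => ‖kpFT f p‖ₑ) * (fun p => ‖kpFm g p‖ₑ)) p := by
        refine lintegral_mono fun p => ?_
        rw [enorm_mul, enorm_mul]
        refine mul_le_of_le_one_left zero_le ?_
        rw [← ofReal_norm, ← ENNReal.ofReal_one]
        exact ENNReal.ofReal_le_ofReal (hw1 p)
    _ ≤ (∫⁻ p, ‖kpFT f p‖ₑ ^ (2 : ℝ)) ^ (1 / 2 : ℝ) * (∫⁻ p, ‖kpFm g p‖ₑ ^ (2 : ℝ)) ^ (1 / 2 : ℝ) :=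
        ENNReal.lintegral_mul_le_Lp_mul_Lq volume Real.HolderConjugate.two_two (by fun_prop) (by fun_prop)
    _ ≤ (ENNReal.ofReal ((2 * Real.pi) ^ 2) * ∫⁻ x, ‖f x‖ₑ ^ 2) ^ (1 / 2 : ℝ) *
        (ENNReal.ofReal ((2 * Real.pi) ^ 2) * ∫⁻ x, ‖g x‖ₑ ^ 2) ^ (1 / 2 : ℝ) := by
        simp only [ENNReal.rpow_two]
        gcongr
        · exact kp_bessel f hf hfm
        · exact kp_besselm g hg hgm
    _ = _ := by
        rw [ENNReal.mul_rpow_of_nonneg _ _ (by norm_num), ENNReal.mul_rpow_of_nonneg _ _ (by norm_num),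
          mul_mul_mul_comm, ← ENNReal.rpow_add_of_nonneg _ _ (by norm_num) (by norm_num)]
        norm_num

/-- The analytic family of functions in Stein interpolation. -/
noncomputable def kpU (ρ : ℝ) (f : ℝ × ℝ → ℂ) (z : ℂ) (x : ℝ × ℝ) : ℂ :=
  f x * ((‖f x‖ ^ (ρ - 1) : ℝ) : ℂ) * Complex.exp (z * ((ρ * Real.log ‖f x‖ : ℝ) : ℂ))

lemma kpU_meas (ρ : ℝ) (f : ℝ × ℝ → ℂ) (hf : Measurable f) (z : ℂ) : Measurable (kpU ρ f z) := by
  unfold kpU; fun_prop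

lemma kpU_norm (ρ : ℝ) (hρ : 0 < ρ) (f : ℝ × ℝ → ℂ) (z : ℂ) (hz : 0 ≤ z.re) (x : ℝ × ℝ) :
    ‖kpU ρ f z x‖ = ‖f x‖ ^ (ρ * (1 + z.re)) := by
  unfold kpU
  rw [norm_mul, norm_mul, Complex.norm_real, Complex.norm_exp, Real.norm_of_nonneg (by positivity)]
  have e : (z * ((ρ * Real.log ‖f x‖ : ℝ) : ℂ)).re = Real.log ‖f x‖ * (z.re * ρ) := by
    rw [Complex.mul_re, Complex.ofReal_re, Complex.ofReal_im]; ring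
  rw [e]
  rcases eq_or_ne (f x) 0 with h | h
  · rw [h]; simp
    rw [Real.zero_rpow (by positivity)]
  · have hp : 0 < ‖f x‖ := norm_pos_iff.2 h
    rw [← Real.rpow_def_of_pos hp]
    nth_rw 1 [← Real.rpow_one ‖f x‖]
    rw [← Real.rpow_add hp, ← Real.rpow_add hp]
    congr 1; ring

lemma kpU_at (ρ δ : ℝ) (h : ρ * (1 + δ) = 1) (f : ℝ × ℝ → ℂ) (x : ℝ × ℝ) : kpU ρ f (δ : ℂ) x = f x := by
  unfold kpU
  rcases eq_or_ne (f x) 0 with h0 | h0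
  · rw [h0]; simp
  · have hp : 0 < ‖f x‖ := norm_pos_iff.2 h0
    rw [← Complex.ofReal_mul, ← Complex.ofReal_exp, mul_assoc, ← Complex.ofReal_mul,
      show δ * (ρ * Real.log ‖f x‖) = Real.log ‖f x‖ * (δ * ρ) by ring, ← Real.rpow_def_of_pos hp,
      ← Real.rpow_add hp, show ρ - 1 + δ * ρ = 0 by linarith, Real.rpow_zero]
    simp

lemma kpU_integrable (ρ : ℝ) (hρ : 0 < ρ) (f : ℝ × ℝ → ℂ) (hf : Measurable f) (z : ℂ) (hz : 0 ≤ z.re)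
    (hi : Integrable (fun x => ‖f x‖ ^ (ρ * (1 + z.re)))) : Integrable (kpU ρ f z) := by
  refine (integrable_norm_iff (kpU_meas ρ f hf z).aestronglyMeasurable).1 ?_
  refine hi.congr (Filter.Eventually.of_forall fun x => ?_)
  simp only
  rw [kpU_norm ρ hρ f z hz]

/-- The frequency weight of the analytic family. -/
noncomputable def kpWt (α a b ε t : ℝ) (z : ℂ) (p : ℝ × ℝ) : ℂ :=
  (kpM a b ε p : ℂ) * Complex.exp (Complex.I * ((t * omega5 α p.1 p.2 : ℝ) : ℂ)) *
    Complex.exp (z * (Real.log |p.1| : ℂ))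

lemma kpWt_meas (α a b ε t : ℝ) (z : ℂ) : Measurable (kpWt α a b ε t z) := by
  have h1 := kpM_measurable a b ε
  have h2 := omega5_measurable α
  unfold kpWt
  fun_prop

lemma kpM_supp (a b ε : ℝ) (p : ℝ × ℝ) (h : p.1 = 0) : kpM a b ε p = 0 := by
  unfold kpM
  rw [if_neg]
  rw [h, abs_zero]
  intro h'
  nlinarith [h'.1, sq_nonneg a]

lemma kpWt_norm (α a b ε t : ℝ) (z : ℂ) (p : ℝ × ℝ) :
    ‖kpWt α a b ε t z p‖ = kpM a b ε p * |p.1| ^ z.re := by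
  unfold kpWt
  rw [norm_mul, norm_mul, kp_normE, Complex.norm_real, Real.norm_of_nonneg (kpM_nonneg _ _ _ _), mul_one,
    Complex.norm_exp]
  rcases eq_or_ne p.1 0 with h | h
  · rw [kpM_supp _ _ _ _ h]; simp
  · have hp : 0 < |p.1| := abs_pos.2 h
    rw [Real.rpow_def_of_pos hp]
    congr 2
    rw [Complex.mul_re, Complex.ofReal_re, Complex.ofReal_im]; ring

lemma kpWt_integrable (α a b ε t : ℝ) (hb : 0 < b) (hε : 0 < ε) (z : ℂ) (hz : z.re = 0 ∨ z.re = 1) :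
    Integrable (kpWt α a b ε t z) := by
  refine (integrable_norm_iff (kpWt_meas α a b ε t z).aestronglyMeasurable).1 ?_
  simp only [kpWt_norm]
  rcases hz with h | h
  · simp only [h, Real.rpow_zero, mul_one]
    exact kpM_integrable a b ε hb hε
  · simp only [h, Real.rpow_one]
    exact kpM_mul_integrable a b ε hb hε

lemma kpWt_at (α a b ε t δ : ℝ) (p : ℝ × ℝ) : kpWt α a b ε t (δ : ℂ) p =
    ((kpM a b ε p * |p.1| ^ δ : ℝ) : ℂ) * Complex.exp (Complex.I * ((t * omega5 α p.1 p.2 : ℝ) : ℂ)) := by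
  unfold kpWt
  rcases eq_or_ne p.1 0 with h | h
  · rw [kpM_supp _ _ _ _ h]; simp
  · have hp : 0 < |p.1| := abs_pos.2 h
    rw [← Complex.ofReal_mul δ, ← Complex.ofReal_exp, mul_comm δ, ← Real.rpow_def_of_pos hp]
    push_cast; ring


lemma kp_lint_U (ρ : ℝ) (hρ : 0 < ρ) (f : ℝ × ℝ → ℂ) (z : ℂ) (hz : z.re = 0)
    (hi : Integrable (fun x => ‖f x‖ ^ (2 * ρ))) :
    ∫⁻ x, ‖kpU ρ f z x‖ₑ ^ 2 = ENNReal.ofReal (∫ x, ‖f x‖ ^ (2 * ρ)) := by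
  rw [ofReal_integral_eq_lintegral_ofReal hi (Filter.Eventually.of_forall fun x => by positivity)]
  congr 1; ext x
  rw [← ofReal_norm, kpU_norm ρ hρ f z hz.ge, hz, add_zero, mul_one, ← ENNReal.ofReal_pow (by positivity),
    ← Real.rpow_natCast, ← Real.rpow_mul (norm_nonneg _)]
  congr 2; push_cast; ring

/-- Fixed time dispersive estimate (by Stein interpolation). -/
lemma kp_fixed (α δ : ℝ) (hδ0 : 0 < δ) (hδ1 : δ < 1) : ∃ C : ℝ, 0 < C ∧ ∀ t : ℝ, t ≠ 0 → |t| ≤ 2 →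
    ∀ a b ε : ℝ, 0 < a → a ≤ b → 0 < ε → ∀ f g : ℝ × ℝ → ℂ, Measurable f → Measurable g →
    ∀ ρ : ℝ, 0 < ρ → ρ * (1 + δ) = 1 →
    Integrable (fun x => ‖f x‖ ^ ρ) → Integrable (fun x => ‖f x‖ ^ (2 * ρ)) →
    Integrable (fun x => ‖g x‖ ^ ρ) → Integrable (fun x => ‖g x‖ ^ (2 * ρ)) →
    ‖∫ p, kpWt α a b ε t (δ : ℂ) p * (kpFT f p * kpFm g p)‖ ≤
      C * |t| ^ (-δ) * (((∫ x, ‖f x‖ ^ (2 * ρ)) ^ ((1 + δ) / 2)) * ((∫ x, ‖g x‖ ^ (2 * ρ)) ^ ((1 + δ) / 2))) := by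
  obtain ⟨K, hK, hker⟩ := kp_kernel α
  refine ⟨6 * (((2 * Real.pi) ^ 2) ^ (1 - δ) * K ^ δ), by positivity, ?_⟩
  intro t ht0 ht2 a b ε ha hab hε f g hfm hgm ρ hρ hρδ hf1 hf2 hg1 hg2
  have hb : 0 < b := ha.trans_le hab
  have htp : 0 < |t| := abs_pos.2 ht0
  set A := ∫ x, ‖f x‖ ^ (2 * ρ) with hA
  set B := ∫ x, ‖g x‖ ^ (2 * ρ) with hB
  have hA0 : 0 ≤ A := integral_nonneg fun x => by positivity
  have hB0 : 0 ≤ B := integral_nonneg fun x => by positivity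
  set e : ℝ × ℝ → ℝ × ℝ → ℂ := fun p x => Complex.exp (Complex.I * ((x.1 * p.1 + x.2 * p.2 : ℝ) : ℂ)) with he
  set e' : ℝ × ℝ → ℝ × ℝ → ℂ := fun p x => Complex.exp (-Complex.I * ((x.1 * p.1 + x.2 * p.2 : ℝ) : ℂ)) with he'
  have hem : Measurable (Function.uncurry e) := by
    simp only [he]; unfold Function.uncurry; fun_prop
  have hem' : Measurable (Function.uncurry e') := by
    simp only [he']; unfold Function.uncurry; fun_prop
  have hen : ∀ p x, ‖e p x‖ ≤ 1 := fun p x => (kp_normE _).le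
  have hen' : ∀ p x, ‖e' p x‖ ≤ 1 := fun p x => (kp_normE' _).le
  -- integrability
  have hUf : ∀ z : ℂ, z.re = 0 ∨ z.re = 1 → Integrable (kpU ρ f z) := by
    intro z hz
    rcases hz with h | h
    · exact kpU_integrable ρ hρ f hfm z h.ge (by simpa [h] using hf1)
    · exact kpU_integrable ρ hρ f hfm z (by rw [h]; norm_num) (by
        rw [h, show ρ * (1 + 1) = 2 * ρ by ring]; exact hf2)
  have hUg : ∀ z : ℂ, z.re = 0 ∨ z.re = 1 → Integrable (kpU ρ g z) := by
    intro z hz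
    rcases hz with h | h
    · exact kpU_integrable ρ hρ g hgm z h.ge (by simpa [h] using hg1)
    · exact kpU_integrable ρ hρ g hgm z (by rw [h]; norm_num) (by
        rw [h, show ρ * (1 + 1) = 2 * ρ by ring]; exact hg2)
  have hW : ∀ z : ℂ, z.re = 0 ∨ z.re = 1 → Integrable (kpWt α a b ε t z) :=
    fun z hz => kpWt_integrable α a b ε t hb hε z hz
  set I : ℂ → (ℝ × ℝ) × ((ℝ × ℝ) × (ℝ × ℝ)) → ℂ := fun z q =>
    kpWt α a b ε t z q.1 * ((kpU ρ f z q.2.1 * e q.1 q.2.1) * (kpU ρ g z q.2.2 * e' q.1 q.2.2)) with hI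
  have hfub : ∀ z : ℂ, z.re = 0 ∨ z.re = 1 → Integrable (I z) ∧ ∫ q, I z q =
      ∫ p, kpWt α a b ε t z p * (kpFT (kpU ρ f z) p * kpFm (kpU ρ g z) p) := by
    intro z hz
    exact kp_fub' (μ := (volume : Measure (ℝ × ℝ))) (ν := (volume : Measure (ℝ × ℝ)))
      (ρ := (volume : Measure (ℝ × ℝ))) _ _ _ e e' (hW z hz) (hUf z hz) (hUg z hz) hem hem' hen hen'
  set L : (ℝ × ℝ) × ((ℝ × ℝ) × (ℝ × ℝ)) → ℝ := fun q =>
    Real.log |q.1.1| + ρ * Real.log ‖f q.2.1‖ + ρ * Real.log ‖g q.2.2‖ with hL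
  have hLm : Measurable L := by simp only [hL]; fun_prop
  have hIz : ∀ z q, I z q = I 0 q * Complex.exp (z * (L q : ℂ)) := by
    intro z q
    simp only [hI, hL, kpWt, kpU, zero_mul, Complex.exp_zero, mul_one]
    push_cast
    rw [mul_add, mul_add, Complex.exp_add, Complex.exp_add]
    ring
  have h0 : ∀ η : ℝ, ‖∫ q, I 0 q * Complex.exp ((η * Complex.I) * L q)‖ ≤
      (2 * Real.pi) ^ 2 * (A ^ (1 / 2 : ℝ) * B ^ (1 / 2 : ℝ)) := by
    intro η
    simp_rw [← hIz]
    have hre : ((η : ℂ) * Complex.I).re = 0 := by simp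
    rw [(hfub _ (Or.inl hre)).2]
    have := kp_L2form (kpWt α a b ε t (η * Complex.I)) (kpU ρ f (η * Complex.I)) (kpU ρ g (η * Complex.I))
      (fun p => by
        rw [kpWt_norm, hre, Real.rpow_zero, mul_one]; exact kpM_le_one a b ε hε.le p)
      (hUf _ (Or.inl hre)) (kpU_meas ρ f hfm _) (hUg _ (Or.inl hre)) (kpU_meas ρ g hgm _)
    rw [kp_lint_U ρ hρ f _ hre hf2, kp_lint_U ρ hρ g _ hre hg2, ← hA, ← hB,
      ENNReal.ofReal_rpow_of_nonneg hA0 (by norm_num), ENNReal.ofReal_rpow_of_nonneg hB0 (by norm_num),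
      ← ENNReal.ofReal_mul (by positivity), ← ENNReal.ofReal_mul (by positivity), ← ofReal_norm] at this
    exact (ENNReal.ofReal_le_ofReal_iff (by positivity)).1 this
  have h1 : ∀ η : ℝ, ‖∫ q, I 0 q * Complex.exp ((1 + η * Complex.I) * L q)‖ ≤
      (K / |t| * (A * B)) * (1 + |η|) := by
    intro η
    simp_rw [← hIz]
    have hre : (1 + (η : ℂ) * Complex.I).re = 1 := by simp
    rw [(hfub _ (Or.inr hre)).2]
    have hE := kp_fub (μ := (volume : Measure (ℝ × ℝ))) (ν := (volume : Measure (ℝ × ℝ)))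
      (ρ := (volume : Measure (ℝ × ℝ))) _ _ _ e e' (hW _ (Or.inr hre)) (hUf _ (Or.inr hre)) (hUg _ (Or.inr hre))
      hem hem' hen hen'
    change ∫ p, kpWt α a b ε t _ p * (kpFT (kpU ρ f _) p * kpFm (kpU ρ g _) p) = _ at hE
    rw [hE]
    have hk : ∀ z : (ℝ × ℝ) × (ℝ × ℝ), ‖∫ p, kpWt α a b ε t (1 + η * Complex.I) p * (e p z.1 * e' p z.2)‖ ≤
        K * (1 + |η|) / |t| := by
      intro z
      have := hker t ht0 ht2 a b ε ha hab hε η (z.1.1 - z.2.1) (z.1.2 - z.2.2)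
      convert! this using 2
      congr 1; ext p
      unfold kpWt kpKer
      simp only [he, he']
      rcases eq_or_ne p.1 0 with h | h
      · rw [kpM_supp _ _ _ _ h]; simp
      · have hp : 0 < |p.1| := abs_pos.2 h
        have e1 : ((kpM a b ε p * |p.1| : ℝ) : ℂ) = (kpM a b ε p : ℂ) * Complex.exp ((Real.log |p.1| : ℝ) : ℂ) := by
          rw [← Complex.ofReal_exp, Real.exp_log hp]; push_cast; ring
        rw [e1]
        simp only [mul_assoc, ← Complex.exp_add]
        congr 2
        push_cast; ring
    have hUn : ∀ (h : ℝ × ℝ → ℂ) x, ‖kpU ρ h (1 + η * Complex.I) x‖ = ‖h x‖ ^ (2 * ρ) := by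
      intro h x
      rw [kpU_norm ρ hρ h _ (by rw [hre]; norm_num), hre]; congr 1; ring
    have hii : Integrable (fun z : (ℝ × ℝ) × (ℝ × ℝ) => ‖f z.1‖ ^ (2 * ρ) * ‖g z.2‖ ^ (2 * ρ) * (K * (1 + |η|) / |t|))
        ((volume : Measure (ℝ × ℝ)).prod volume) := (hf2.mul_prod hg2).mul_const _
    refine (norm_integral_le_of_norm_le hii (Filter.Eventually.of_forall fun z => ?_)).trans (le_of_eq ?_)
    · rw [norm_mul, norm_mul, hUn, hUn]
      exact mul_le_mul_of_nonneg_left (hk z) (by positivity)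
    · rw [integral_mul_const, integral_prod_mul (fun x => ‖f x‖ ^ (2 * ρ)) (fun x => ‖g x‖ ^ (2 * ρ)), ← hA, ← hB]
      ring
  have hcL : Integrable (fun q => I 0 q * (Real.exp (L q) : ℂ)) := by
    have := (hfub 1 (Or.inr (by simp))).1
    refine this.congr (Filter.Eventually.of_forall fun q => ?_)
    simp only
    rw [hIz 1 q]; push_cast; rw [one_mul]
  have key := kp_stein (I 0) L hLm (hfub 0 (Or.inl (by simp))).1 hcL δ _ _ hδ0.le hδ1.le (by positivity) (by positivity) h0 h1
  simp_rw [← hIz] at key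
  -- identify the integral at δ
  have hUat : ∀ h : ℝ × ℝ → ℂ, kpU ρ h (δ : ℂ) = h := fun h => by ext x; exact kpU_at ρ δ hρδ h x
  have hIδ : ∫ q, I (δ : ℂ) q = ∫ p, kpWt α a b ε t (δ : ℂ) p * (kpFT f p * kpFm g p) := by
    have hint1 : ∀ h : ℝ × ℝ → ℂ, Measurable h → Integrable (fun x => ‖h x‖ ^ ρ) → Integrable (fun x => ‖h x‖ ^ (2 * ρ)) →
        Integrable h := by
      intro h hm i1 i2
      refine (i1.add i2).mono' hm.aestronglyMeasurable (Filter.Eventually.of_forall fun x => ?_)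
      simp only [Pi.add_apply]
      have hρ1 : ρ ≤ 1 := by nlinarith
      have hρ2 : 1 ≤ 2 * ρ := by nlinarith
      rcases le_total ‖h x‖ 1 with hh | hh
      · have : ‖h x‖ ≤ ‖h x‖ ^ ρ := by
          rcases eq_or_lt_of_le (norm_nonneg (h x)) with h00 | h00
          · rw [← h00]; positivity
          · nth_rw 1 [← Real.rpow_one ‖h x‖]
            exact Real.rpow_le_rpow_of_exponent_ge h00 hh hρ1
        have : 0 ≤ ‖h x‖ ^ (2 * ρ) := by positivity
        linarith
      · have : ‖h x‖ ≤ ‖h x‖ ^ (2 * ρ) := by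
          nth_rw 1 [← Real.rpow_one ‖h x‖]
          exact Real.rpow_le_rpow_of_exponent_le hh hρ2
        have : 0 ≤ ‖h x‖ ^ ρ := by positivity
        linarith
    have hWδ : Integrable (kpWt α a b ε t (δ : ℂ)) := by
      refine ((kpM_integrable a b ε hb hε).add (kpM_mul_integrable a b ε hb hε)).mono'
        (kpWt_meas α a b ε t _).aestronglyMeasurable (Filter.Eventually.of_forall fun p => ?_)
      rw [kpWt_norm, Complex.ofReal_re, Pi.add_apply]
      have : |p.1| ^ δ ≤ 1 + |p.1| := by
        rcases le_total |p.1| 1 with hh | hh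
        · have := Real.rpow_le_one (abs_nonneg p.1) hh hδ0.le
          linarith [abs_nonneg p.1]
        · have : |p.1| ^ δ ≤ |p.1| ^ (1 : ℝ) := Real.rpow_le_rpow_of_exponent_le hh hδ1.le
          rw [Real.rpow_one] at this; linarith
      have := mul_le_mul_of_nonneg_left this (kpM_nonneg a b ε p)
      linarith
    have := (kp_fub' (μ := (volume : Measure (ℝ × ℝ))) (ν := (volume : Measure (ℝ × ℝ)))
      (ρ := (volume : Measure (ℝ × ℝ))) _ _ _ e e' hWδ (hint1 f hfm hf1 hf2) (hint1 g hgm hg1 hg2) hem hem' hen hen').2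
    simp only [hI, hUat]
    exact this
  rw [hIδ] at key
  refine key.trans (le_of_eq ?_)
  rw [Real.mul_rpow (by positivity) (by positivity), Real.mul_rpow (by positivity) (by positivity),
    Real.mul_rpow (by positivity) (by positivity), Real.mul_rpow (by positivity) (by positivity),
    ← Real.rpow_mul hA0, ← Real.rpow_mul hB0, Real.div_rpow hK.le htp.le, Real.rpow_neg htp.le]
  have hs : ∀ D : ℝ, 0 ≤ D → D ^ ((1 + δ) / 2) = D ^ (1 / 2 * (1 - δ)) * D ^ δ := by
    intro D hD
    rw [← Real.rpow_add_of_nonneg hD (by linarith) hδ0.le]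
    congr 1; ring
  rw [hs A hA0, hs B hB0]
  field_simp


lemma kp_fubB {P X Y : Type*} [MeasurableSpace P] [MeasurableSpace X] [MeasurableSpace Y]
    {μ : Measure P} {ν : Measure X} {ρ : Measure Y} [SFinite μ] [IsFiniteMeasure ν] [IsFiniteMeasure ρ]
    (w : P → ℂ) (e : P → X → ℂ) (e' : P → Y → ℂ) (hw : Integrable w μ)
    (he : Measurable (Function.uncurry e)) (he' : Measurable (Function.uncurry e')) (B : ℝ)
    (hb : ∀ p x, ‖e p x‖ ≤ B) (hb' : ∀ p x, ‖e' p x‖ ≤ B) :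
    ∫ p, w p * ((∫ x, e p x ∂ν) * (∫ y, e' p y ∂ρ)) ∂μ =
      ∫ z, ∫ p, w p * (e p z.1 * e' p z.2) ∂μ ∂(ν.prod ρ) := by
  have hIntg : Integrable (Function.uncurry (fun (p : P) (z : X × Y) =>
      w p * (e p z.1 * e' p z.2))) (μ.prod (ν.prod ρ)) := by
    have h1 : Integrable (fun q : P × (X × Y) => w q.1 * (1 : ℂ)) (μ.prod (ν.prod ρ)) :=
      hw.mul_prod (integrable_const 1)
    have h2 : Integrable (fun q : P × (X × Y) => (w q.1 * 1) *
        (e q.1 q.2.1 * e' q.1 q.2.2)) (μ.prod (ν.prod ρ)) := by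
      refine h1.mul_bdd (c := B * B) ?_ ?_
      · apply Measurable.aestronglyMeasurable
        have a1 : Measurable (fun q : P × (X × Y) => (q.1, q.2.1)) := by fun_prop
        have a2 : Measurable (fun q : P × (X × Y) => (q.1, q.2.2)) := by fun_prop
        exact (he.comp a1).mul (he'.comp a2)
      · refine Filter.Eventually.of_forall fun q => ?_
        rw [norm_mul]
        exact mul_le_mul (hb _ _) (hb' _ _) (norm_nonneg _) ((norm_nonneg _).trans (hb q.1 q.2.1))
    refine h2.congr (Filter.Eventually.of_forall fun q => ?_)
    simp only [Function.uncurry]; ring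
  have := integral_integral_swap hIntg
  calc _ = ∫ p, ∫ z, w p * (e p z.1 * e' p z.2) ∂(ν.prod ρ) ∂μ := by
        congr 1; ext p
        rw [integral_const_mul, integral_prod_mul (fun x => e p x) (fun y => e' p y)]
    _ = _ := this

lemma kpMd_integrable (a b ε δ : ℝ) (hb : 0 < b) (hε : 0 < ε) (hδ0 : 0 < δ) (hδ1 : δ < 1) :
    Integrable (fun p : ℝ × ℝ => kpM a b ε p * |p.1| ^ δ) := by
  have hm := kpM_measurable a b ε
  refine ((kpM_integrable a b ε hb hε).add (kpM_mul_integrable a b ε hb hε)).mono'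
    (by fun_prop) (Filter.Eventually.of_forall fun p => ?_)
  rw [Real.norm_of_nonneg (mul_nonneg (kpM_nonneg _ _ _ _) (by positivity)), Pi.add_apply]
  have : |p.1| ^ δ ≤ 1 + |p.1| := by
    rcases le_total |p.1| 1 with hh | hh
    · have := Real.rpow_le_one (abs_nonneg p.1) hh hδ0.le
      linarith [abs_nonneg p.1]
    · have : |p.1| ^ δ ≤ |p.1| ^ (1 : ℝ) := Real.rpow_le_rpow_of_exponent_le hh hδ1.le
      rw [Real.rpow_one] at this; linarith
  have := mul_le_mul_of_nonneg_left this (kpM_nonneg a b ε p)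
  linarith

lemma kp_bdd_supp_integrable {K : Set (ℝ × ℝ)} (hK : volume K < ∞) (f : ℝ × ℝ → ℝ)
    (hf : Measurable f) (B : ℝ) (hB : ∀ x, ‖f x‖ ≤ B) (h0 : ∀ x, x ∉ K → f x = 0) : Integrable f := by
  have : IntegrableOn f K := by
    refine Measure.integrableOn_of_bounded (M := B) hK.ne hf.aestronglyMeasurable ?_
    exact Filter.Eventually.of_forall hB
  rwa [integrableOn_iff_integrable_of_support_subset] at this
  intro x hx
  by_contra h
  exact hx (h0 x h)

lemma kpM_lim (p : ℝ × ℝ) (hp : p.1 ≠ 0) : Filter.Tendsto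
    (fun n : ℕ => kpM (1 / ((n : ℝ) + 1)) ((n : ℝ) + 1) (1 / ((n : ℝ) + 1)) p) Filter.atTop (nhds 1) := by
  have hp' : 0 < |p.1| := abs_pos.2 hp
  have h0 := tendsto_one_div_add_atTop_nhds_zero_nat (𝕜 := ℝ)
  have h1 : Filter.Tendsto (fun n : ℕ => Real.exp (-(1 / ((n : ℝ) + 1) * (p.2 ^ 2 / |p.1|)))) Filter.atTop (nhds 1) := by
    have hc : Continuous (fun ε : ℝ => Real.exp (-(ε * (p.2 ^ 2 / |p.1|)))) := by fun_prop
    have := (hc.tendsto 0).comp h0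
    simpa [Function.comp_def] using this
  refine h1.congr' ?_
  have e1 : ∀ᶠ n : ℕ in Filter.atTop, (1 / ((n : ℝ) + 1)) ^ 2 < |p.1| := by
    have := h0.pow 2
    rw [zero_pow two_ne_zero] at this
    exact this.eventually (gt_mem_nhds hp')
  have e2 : ∀ᶠ n : ℕ in Filter.atTop, |p.1| ≤ ((n : ℝ) + 1) ^ 2 := by
    have := tendsto_natCast_atTop_atTop (R := ℝ)
    filter_upwards [this.eventually_ge_atTop |p.1|] with n hn
    nlinarith [abs_nonneg p.1]
  filter_upwards [e1, e2] with n h1 h2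
  unfold kpM
  rw [if_pos ⟨h1, h2⟩]

/-- The dual object. -/
noncomputable def kpG (α : ℝ) (F : ℝ → ℝ × ℝ → ℂ) (p : ℝ × ℝ) : ℂ :=
  ∫ t in Set.Ioo (-1 : ℝ) 1, Complex.exp (Complex.I * ((t * omega5 α p.1 p.2 : ℝ) : ℂ)) * kpFT (F t) p

lemma kpE_meas (α : ℝ) (F : ℝ → ℝ × ℝ → ℂ) (hF : Measurable (Function.uncurry F)) :
    Measurable (Function.uncurry (fun (p : ℝ × ℝ) (t : ℝ) =>
      Complex.exp (Complex.I * ((t * omega5 α p.1 p.2 : ℝ) : ℂ)) * kpFT (F t) p)) := by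
  have h2 := omega5_measurable α
  have h2' : Measurable (fun q : (ℝ × ℝ) × ℝ => omega5 α q.1.1 q.1.2) := h2.comp measurable_fst
  unfold Function.uncurry
  refine Measurable.mul (by fun_prop) ?_
  unfold kpFT
  apply StronglyMeasurable.measurable
  apply StronglyMeasurable.integral_prod_right'
    (f := fun q : ((ℝ × ℝ) × ℝ) × (ℝ × ℝ) => F q.1.2 q.2 * Complex.exp (Complex.I * ((q.2.1 * q.1.1.1 + q.2.2 * q.1.1.2 : ℝ) : ℂ)))
  apply Measurable.stronglyMeasurable
  have h3 : Measurable (fun q : ((ℝ × ℝ) × ℝ) × (ℝ × ℝ) => F q.1.2 q.2) :=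
    hF.comp (f := fun q : ((ℝ × ℝ) × ℝ) × (ℝ × ℝ) => (q.1.2, q.2)) (by fun_prop)
  fun_prop

lemma kpFT_bd {K : Set (ℝ × ℝ)} (hK : volume K < ∞) (f : ℝ × ℝ → ℂ)
    (B : ℝ) (hB : ∀ x, ‖f x‖ ≤ B) (h0 : ∀ x, x ∉ K → f x = 0) (p : ℝ × ℝ) :
    ‖kpFT f p‖ ≤ B * volume.real K := by
  unfold kpFT
  rw [← setIntegral_eq_integral_of_forall_compl_eq_zero (s := K) (by intro x hx; rw [h0 x hx, zero_mul])]
  refine norm_setIntegral_le_of_norm_le_const hK ?_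
  intro x _
  rw [norm_mul, kp_normE, mul_one]; exact hB x

lemma kpG_meas (α : ℝ) (F : ℝ → ℝ × ℝ → ℂ) (hF : Measurable (Function.uncurry F)) : Measurable (kpG α F) := by
  unfold kpG
  apply StronglyMeasurable.measurable
  exact StronglyMeasurable.integral_prod_right' (kpE_meas α F hF).stronglyMeasurable

lemma kpG_conj (α : ℝ) (F : ℝ → ℝ × ℝ → ℂ) (p : ℝ × ℝ) : (starRingEnd ℂ) (kpG α F p) =
    ∫ t in Set.Ioo (-1 : ℝ) 1, (starRingEnd ℂ) (Complex.exp (Complex.I * ((t * omega5 α p.1 p.2 : ℝ) : ℂ)) * kpFT (F t) p) := by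
  unfold kpG; rw [← integral_conj]

lemma kp_dual (α δ : ℝ) (hδ0 : 0 < δ) (hδ1 : δ < 1) : ∃ C : ℝ, 0 < C ∧ ∀ (F : ℝ → ℝ × ℝ → ℂ) (B : ℝ)
    (K : Set (ℝ × ℝ)) (ρ A : ℝ), Measurable (Function.uncurry F) → (∀ t x, ‖F t x‖ ≤ B) → MeasurableSet K →
    volume K < ∞ → (∀ t x, x ∉ K → F t x = 0) → 0 < ρ → ρ * (1 + δ) = 1 → 0 < A →
    ∫⁻ t, ENNReal.ofReal ((∫ x, ‖F t x‖ ^ (2 * ρ)) ^ ((1 + δ) / 2)) ^ (2 / (2 - δ)) = ENNReal.ofReal A →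
    ∫⁻ p, ENNReal.ofReal (|p.1| ^ δ) * ‖kpG α F p‖ₑ ^ 2 ≤ ENNReal.ofReal (C * A ^ (2 - δ)) := by
  obtain ⟨C, hC, hfix⟩ := kp_fixed α δ hδ0 hδ1
  have h1δ : 0 < 1 - δ := by linarith
  refine ⟨C * (2 * (2 / (1 - δ) + 2)), by positivity, ?_⟩
  intro F B K ρ A hF hFB hKm hK hFK hρ hρδ hA hFA
  have hB0 : 0 ≤ B := (norm_nonneg _).trans (hFB 0 0)
  set φ : ℝ → ℝ := fun t => (∫ x, ‖F t x‖ ^ (2 * ρ)) ^ ((1 + δ) / 2) with hφ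
  have hφ0 : ∀ t, 0 ≤ φ t := fun t => Real.rpow_nonneg (integral_nonneg fun x => by positivity) _
  have hφm : Measurable φ := by
    refine Measurable.pow_const ?_ _
    apply StronglyMeasurable.measurable
    apply StronglyMeasurable.integral_prod_right' (f := fun q : ℝ × (ℝ × ℝ) => ‖F q.1 q.2‖ ^ (2 * ρ))
    apply Measurable.stronglyMeasurable
    exact (hF.norm.pow_const _)
  have hFt : ∀ t, Measurable (F t) := fun t => hF.of_uncurry_left
  have hpw : ∀ (s : ℝ), 0 < s → ∀ t, Integrable (fun x => ‖F t x‖ ^ s) := by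
    intro s hs t
    refine kp_bdd_supp_integrable hK _ ((hFt t).norm.pow_const _) (B ^ s) ?_ ?_
    · intro x
      rw [Real.norm_of_nonneg (by positivity)]
      exact Real.rpow_le_rpow (norm_nonneg _) (hFB t x) hs.le
    · intro x hx
      rw [hFK t x hx, norm_zero, Real.zero_rpow hs.ne']
  set E : ℝ × ℝ → ℝ → ℂ := fun p t =>
    Complex.exp (Complex.I * ((t * omega5 α p.1 p.2 : ℝ) : ℂ)) * kpFT (F t) p with hE
  have hEm : Measurable (Function.uncurry E) := kpE_meas α F hF
  have hEb : ∀ p t, ‖E p t‖ ≤ B * volume.real K := by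
    intro p t
    simp only [hE, norm_mul, kp_normE, one_mul]
    exact kpFT_bd hK (F t) B (hFB t) (hFK t) p
  have hGm := kpG_meas α F hF
  have hGb : ∀ p, ‖kpG α F p‖ ≤ B * volume.real K * 2 := by
    intro p
    have := norm_setIntegral_le_of_norm_le_const (μ := (volume : Measure ℝ)) (s := Set.Ioo (-1 : ℝ) 1)
      (f := E p) (C := B * volume.real K) (by simp) (fun t _ => hEb p t)
    refine this.trans (le_of_eq ?_)
    congr 1
    simp; norm_num
  -- estimate with cutoff
  have hcut : ∀ a b ε : ℝ, 0 < a → a ≤ b → 0 < ε →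
      ∫⁻ p, ENNReal.ofReal (kpM a b ε p * |p.1| ^ δ) * ‖kpG α F p‖ₑ ^ 2 ≤
        ENNReal.ofReal (C * (2 * (2 / (1 - δ) + 2)) * A ^ (2 - δ)) := by
    intro a b ε ha hab hε
    have hwi := kpMd_integrable a b ε δ (ha.trans_le hab) hε hδ0 hδ1
    rw [kp_sq_form (fun p => kpM a b ε p * |p.1| ^ δ) (kpG α F) hwi
      (fun p => mul_nonneg (kpM_nonneg _ _ _ _) (by positivity)) hGm _ hGb]
    simp_rw [kpG_conj]
    have hfub := kp_fubB (μ := (volume : Measure (ℝ × ℝ))) (ν := volume.restrict (Set.Ioo (-1 : ℝ) 1))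
      (ρ := volume.restrict (Set.Ioo (-1 : ℝ) 1)) (fun p => ((kpM a b ε p * |p.1| ^ δ : ℝ) : ℂ)) E
      (fun p t => (starRingEnd ℂ) (E p t)) hwi.ofReal hEm (kp_conj_measurable hEm) _ hEb
      (fun p t => by rw [RCLike.norm_conj]; exact hEb p t)
    change ‖∫ p, ((kpM a b ε p * |p.1| ^ δ : ℝ) : ℂ) * ((∫ t in Set.Ioo (-1 : ℝ) 1, E p t) * (∫ t in Set.Ioo (-1 : ℝ) 1, (starRingEnd ℂ) (E p t)))‖ₑ ≤ _
    rw [hfub]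
    refine (enorm_integral_le_lintegral_enorm _).trans ?_
    have hz : ∀ t ∈ Set.Ioo (-1 : ℝ) 1, ∀ s ∈ Set.Ioo (-1 : ℝ) 1, s ≠ t →
        ‖∫ p : ℝ × ℝ, ((kpM a b ε p * |p.1| ^ δ : ℝ) : ℂ) * (E p t * (starRingEnd ℂ) (E p s))‖ₑ ≤
        ENNReal.ofReal C * (ENNReal.ofReal (φ t) * ENNReal.ofReal (φ s) * ENNReal.ofReal (|t - s| ^ (-δ))) := by
      intro t ht s hs hst
      have hts : |t - s| ≤ 2 := by
        rw [abs_le]; constructor <;> linarith [ht.1, ht.2, hs.1, hs.2]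
      have := hfix (t - s) (sub_ne_zero.2 hst.symm) hts a b ε ha hab hε (F t) (fun x => (starRingEnd ℂ) (F s x))
        (hFt t) (kp_conj_measurable (hFt s)) ρ hρ hρδ (hpw _ hρ t) (hpw _ (by positivity) t)
        (by simp only [RCLike.norm_conj]; exact hpw _ hρ s)
        (by simp only [RCLike.norm_conj]; exact hpw _ (by positivity) s)
      simp only [RCLike.norm_conj] at this
      rw [← ENNReal.ofReal_mul (hφ0 t), ← ENNReal.ofReal_mul (mul_nonneg (hφ0 t) (hφ0 s)),
        ← ENNReal.ofReal_mul hC.le, ← ofReal_norm]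
      apply ENNReal.ofReal_le_ofReal
      refine le_trans (le_of_eq ?_) (this.trans (le_of_eq ?_))
      · congr 1
        congr 1; ext p
        rw [kpWt_at, kpFm_eq]
        simp only [hE, map_mul, ← Complex.exp_conj, Complex.conj_I, Complex.conj_ofReal, Complex.conj_conj]
        have hx : Complex.exp (Complex.I * (((t - s) * omega5 α p.1 p.2 : ℝ) : ℂ)) =
            Complex.exp (Complex.I * ((t * omega5 α p.1 p.2 : ℝ) : ℂ)) *
            Complex.exp (-Complex.I * ((s * omega5 α p.1 p.2 : ℝ) : ℂ)) := by
          rw [← Complex.exp_add]; congr 1; push_cast; ring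
        rw [hx]; ring
      · simp only [hφ]; ring
    calc _ ≤ ∫⁻ t in Set.Ioo (-1 : ℝ) 1, ∫⁻ s in Set.Ioo (-1 : ℝ) 1,
          ‖∫ p : ℝ × ℝ, ((kpM a b ε p * |p.1| ^ δ : ℝ) : ℂ) * (E p t * (starRingEnd ℂ) (E p s))‖ₑ :=
            lintegral_prod_le _
      _ ≤ ∫⁻ t in Set.Ioo (-1 : ℝ) 1, ∫⁻ s in Set.Ioo (-1 : ℝ) 1, ENNReal.ofReal C *
          (ENNReal.ofReal (φ t) * ENNReal.ofReal (φ s) * ENNReal.ofReal (|t - s| ^ (-δ))) := by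
            refine setLIntegral_mono' measurableSet_Ioo fun t ht => ?_
            refine lintegral_mono_ae ?_
            rw [ae_restrict_iff' measurableSet_Ioo]
            have : ∀ᵐ s : ℝ, s ≠ t := by
              rw [ae_iff]; simp
            filter_upwards [this] with s hs hs'
            exact hz t ht s hs' hs
      _ ≤ ∫⁻ t, ∫⁻ s, ENNReal.ofReal C *
          (ENNReal.ofReal (φ t) * ENNReal.ofReal (φ s) * ENNReal.ofReal (|t - s| ^ (-δ))) := by
            refine (setLIntegral_le_lintegral _ _).trans (lintegral_mono fun t => ?_)
            exact setLIntegral_le_lintegral _ _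
      _ = ENNReal.ofReal C * ∫⁻ t, ∫⁻ s, 
          (ENNReal.ofReal (φ t) * ENNReal.ofReal (φ s) * ENNReal.ofReal (|t - s| ^ (-δ))) := by
            simp_rw [lintegral_const_mul' _ _ ENNReal.ofReal_ne_top]
      _ ≤ ENNReal.ofReal C * ENNReal.ofReal (2 * (2 / (1 - δ) + 2) * A ^ (2 - δ)) := by
            gcongr
            exact kp_hls δ _ hδ0 hδ1 rfl φ hφm hφ0 A hA hFA
      _ = _ := by
            rw [← ENNReal.ofReal_mul hC.le]; congr 1; ring
  -- limit
  have hlim : ∀ p : ℝ × ℝ, Filter.Tendsto (fun n : ℕ => ENNReal.ofReal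
      (kpM (1 / ((n : ℝ) + 1)) ((n : ℝ) + 1) (1 / ((n : ℝ) + 1)) p * |p.1| ^ δ) * ‖kpG α F p‖ₑ ^ 2)
      Filter.atTop (nhds (ENNReal.ofReal (|p.1| ^ δ) * ‖kpG α F p‖ₑ ^ 2)) := by
    intro p
    refine ENNReal.Tendsto.mul_const ?_ (Or.inr (ENNReal.pow_ne_top enorm_ne_top))
    apply ENNReal.tendsto_ofReal
    rcases eq_or_ne p.1 0 with h | h
    · simp [h, Real.zero_rpow hδ0.ne']
    · have := (kpM_lim p h).mul_const (|p.1| ^ δ)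
      simpa using this
  calc ∫⁻ p, ENNReal.ofReal (|p.1| ^ δ) * ‖kpG α F p‖ₑ ^ 2 = ∫⁻ p, Filter.liminf (fun n : ℕ => ENNReal.ofReal
      (kpM (1 / ((n : ℝ) + 1)) ((n : ℝ) + 1) (1 / ((n : ℝ) + 1)) p * |p.1| ^ δ) * ‖kpG α F p‖ₑ ^ 2) Filter.atTop := by
        congr 1; ext p; exact (hlim p).liminf_eq.symm
    _ ≤ Filter.liminf (fun n : ℕ => ∫⁻ p, ENNReal.ofReal
      (kpM (1 / ((n : ℝ) + 1)) ((n : ℝ) + 1) (1 / ((n : ℝ) + 1)) p * |p.1| ^ δ) * ‖kpG α F p‖ₑ ^ 2) Filter.atTop := by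
        apply lintegral_liminf_le
        intro n
        have := kpM_measurable (1 / ((n : ℝ) + 1)) ((n : ℝ) + 1) (1 / ((n : ℝ) + 1))
        fun_prop
    _ ≤ _ := by
        refine Filter.liminf_le_of_frequently_le' (Filter.Frequently.of_forall fun n => ?_)
        have h1 : (0 : ℝ) < (n : ℝ) + 1 := by positivity
        refine hcut _ _ _ (by positivity) ?_ (by positivity)
        rw [div_le_iff₀ h1]
        nlinarith [(Nat.cast_nonneg n : (0 : ℝ) ≤ n)]


/-- The (unnormalized) evolution of frequency data. -/
noncomputable def kpEv (α : ℝ) (h : ℝ × ℝ → ℂ) (t : ℝ) (x : ℝ × ℝ) : ℂ :=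
  ∫ p : ℝ × ℝ, h p * Complex.exp (Complex.I * ((x.1 * p.1 + x.2 * p.2 + t * omega5 α p.1 p.2 : ℝ) : ℂ))

lemma kpEvE_meas (α : ℝ) : Measurable (fun q : (ℝ × (ℝ × ℝ)) × (ℝ × ℝ) =>
    Complex.exp (Complex.I * ((q.1.2.1 * q.2.1 + q.1.2.2 * q.2.2 + q.1.1 * omega5 α q.2.1 q.2.2 : ℝ) : ℂ))) := by
  have h2 := omega5_measurable α
  have h2' : Measurable (fun q : (ℝ × (ℝ × ℝ)) × (ℝ × ℝ) => omega5 α q.2.1 q.2.2) := h2.comp measurable_snd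
  fun_prop

lemma kpEv_meas (α : ℝ) (h : ℝ × ℝ → ℂ) (hh : Measurable h) : Measurable (Function.uncurry (kpEv α h)) := by
  unfold kpEv Function.uncurry
  apply StronglyMeasurable.measurable
  apply StronglyMeasurable.integral_prod_right'
    (f := fun q : (ℝ × (ℝ × ℝ)) × (ℝ × ℝ) => h q.2 * Complex.exp (Complex.I * ((q.1.2.1 * q.2.1 + q.1.2.2 * q.2.2 + q.1.1 * omega5 α q.2.1 q.2.2 : ℝ) : ℂ)))
  apply Measurable.stronglyMeasurable
  exact (hh.comp measurable_snd).mul (kpEvE_meas α)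

lemma kpEv_bd (α : ℝ) (h : ℝ × ℝ → ℂ) (t : ℝ) (x : ℝ × ℝ) : ‖kpEv α h t x‖ ≤ ∫ p, ‖h p‖ := by
  refine (norm_integral_le_integral_norm _).trans (le_of_eq ?_)
  congr 1; ext p
  rw [norm_mul, kp_normE, mul_one]

lemma kp_F_integrable (F : ℝ → ℝ × ℝ → ℂ) (B : ℝ) (K : Set (ℝ × ℝ)) (hF : Measurable (Function.uncurry F))
    (hFB : ∀ t x, ‖F t x‖ ≤ B) (hK : volume K < ∞) (hFK : ∀ t x, x ∉ K → F t x = 0) :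
    Integrable (fun z : ℝ × (ℝ × ℝ) => F z.1 z.2) ((volume.restrict (Set.Ioo (-1 : ℝ) 1)).prod volume) := by
  have : IntegrableOn (fun z : ℝ × (ℝ × ℝ) => F z.1 z.2) (Set.univ ×ˢ K)
      ((volume.restrict (Set.Ioo (-1 : ℝ) 1)).prod volume) := by
    refine Measure.integrableOn_of_bounded (M := B) ?_ hF.aestronglyMeasurable
      (Filter.Eventually.of_forall fun z => hFB _ _)
    rw [Measure.prod_prod]
    refine (ENNReal.mul_lt_top ?_ hK).ne
    simp
  rwa [integrableOn_iff_integrable_of_support_subset] at this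
  intro z hz
  refine ⟨Set.mem_univ _, ?_⟩
  by_contra h
  exact hz (hFK _ _ h)

lemma kp_pair (α : ℝ) (h : ℝ × ℝ → ℂ) (hi : Integrable h) (F : ℝ → ℝ × ℝ → ℂ) (B : ℝ)
    (K : Set (ℝ × ℝ)) (hF : Measurable (Function.uncurry F))
    (hFB : ∀ t x, ‖F t x‖ ≤ B) (hK : volume K < ∞) (hFK : ∀ t x, x ∉ K → F t x = 0) :
    ∫ z : ℝ × (ℝ × ℝ), F z.1 z.2 * kpEv α h z.1 z.2 ∂((volume.restrict (Set.Ioo (-1 : ℝ) 1)).prod volume) =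
      ∫ p, h p * kpG α F p := by
  have hFi := kp_F_integrable F B K hF hFB hK hFK
  have hIntg : Integrable (Function.uncurry fun (z : ℝ × (ℝ × ℝ)) (p : ℝ × ℝ) => F z.1 z.2 * h p *
      Complex.exp (Complex.I * ((z.2.1 * p.1 + z.2.2 * p.2 + z.1 * omega5 α p.1 p.2 : ℝ) : ℂ)))
      (((volume.restrict (Set.Ioo (-1 : ℝ) 1)).prod volume).prod volume) := by
    refine (hFi.mul_prod hi).mul_bdd (c := 1) (kpEvE_meas α).aestronglyMeasurable ?_
    exact Filter.Eventually.of_forall fun q => (kp_normE _).le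
  have hsw := integral_integral_swap hIntg
  calc _ = ∫ z : ℝ × (ℝ × ℝ), ∫ p : ℝ × ℝ, F z.1 z.2 * h p *
      Complex.exp (Complex.I * ((z.2.1 * p.1 + z.2.2 * p.2 + z.1 * omega5 α p.1 p.2 : ℝ) : ℂ)) ∂volume ∂((volume.restrict (Set.Ioo (-1 : ℝ) 1)).prod volume) := by
        congr 1; ext z
        unfold kpEv
        rw [← integral_const_mul]
        congr 1; ext p; ring
    _ = _ := hsw
    _ = _ := by
        congr 1; ext p
        have h1 : Integrable (fun z : ℝ × (ℝ × ℝ) => F z.1 z.2 *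
            Complex.exp (Complex.I * ((z.2.1 * p.1 + z.2.2 * p.2 + z.1 * omega5 α p.1 p.2 : ℝ) : ℂ)))
            ((volume.restrict (Set.Ioo (-1 : ℝ) 1)).prod volume) := by
          refine hFi.mul_bdd (c := 1) (by fun_prop) ?_
          exact Filter.Eventually.of_forall fun q => (kp_normE _).le
        have h2 := integral_prod _ h1
        have h3 : ∀ z : ℝ × (ℝ × ℝ), F z.1 z.2 * h p *
          Complex.exp (Complex.I * ((z.2.1 * p.1 + z.2.2 * p.2 + z.1 * omega5 α p.1 p.2 : ℝ) : ℂ)) =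
          h p * (F z.1 z.2 *
            Complex.exp (Complex.I * ((z.2.1 * p.1 + z.2.2 * p.2 + z.1 * omega5 α p.1 p.2 : ℝ) : ℂ))) := by
          intro z; ring
        simp_rw [h3]
        rw [integral_const_mul, h2]
        congr 1
        unfold kpG kpFT
        congr 1; ext t
        rw [← integral_const_mul]
        congr 1; ext x
        simp only
        rw [mul_left_comm, ← Complex.exp_add]
        congr 2
        push_cast; ring

/-- Duality bound. -/
lemma kp_pair_le (α δ : ℝ) (hδ0 : 0 < δ) (v : ℝ × ℝ → ℂ) (hv : Measurable v)
    (hi : Integrable (fun p : ℝ × ℝ => ((|p.1| ^ (δ / 2) : ℝ) : ℂ) * v p)) (F : ℝ → ℝ × ℝ → ℂ) (B : ℝ)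
    (K : Set (ℝ × ℝ)) (hF : Measurable (Function.uncurry F))
    (hFB : ∀ t x, ‖F t x‖ ≤ B) (hK : volume K < ∞) (hFK : ∀ t x, x ∉ K → F t x = 0) (D : ℝ≥0∞)
    (hD : ∫⁻ p, ENNReal.ofReal (|p.1| ^ δ) * ‖kpG α F p‖ₑ ^ 2 ≤ D) :
    ‖∫ z : ℝ × (ℝ × ℝ), F z.1 z.2 * kpEv α (fun p : ℝ × ℝ => ((|p.1| ^ (δ / 2) : ℝ) : ℂ) * v p) z.1 z.2
      ∂((volume.restrict (Set.Ioo (-1 : ℝ) 1)).prod volume)‖ₑ ≤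
      (∫⁻ p, ‖v p‖ₑ ^ 2) ^ (1 / 2 : ℝ) * D ^ (1 / 2 : ℝ) := by
  rw [kp_pair α _ hi F B K hF hFB hK hFK]
  have hGm := kpG_meas α F hF
  refine (enorm_integral_le_lintegral_enorm _).trans ?_
  calc _ = ∫⁻ p, ((fun p => ‖v p‖ₑ) * (fun p : ℝ × ℝ => ENNReal.ofReal (|p.1| ^ (δ / 2)) * ‖kpG α F p‖ₑ)) p := by
        congr 1; ext p
        rw [enorm_mul, enorm_mul, Pi.mul_apply, ← ofReal_norm (((|p.1| ^ (δ / 2) : ℝ) : ℂ)), Complex.norm_real,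
          Real.norm_of_nonneg (by positivity)]
        ring
    _ ≤ (∫⁻ p, ‖v p‖ₑ ^ (2 : ℝ)) ^ (1 / 2 : ℝ) *
        (∫⁻ p : ℝ × ℝ, (ENNReal.ofReal (|p.1| ^ (δ / 2)) * ‖kpG α F p‖ₑ) ^ (2 : ℝ)) ^ (1 / 2 : ℝ) :=
        ENNReal.lintegral_mul_le_Lp_mul_Lq volume Real.HolderConjugate.two_two (by fun_prop) (by fun_prop)
    _ ≤ _ := by
        simp only [ENNReal.rpow_two]
        gcongr
        refine le_trans (le_of_eq ?_) hD
        congr 1; ext p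
        rw [mul_pow, ← ENNReal.ofReal_pow (by positivity), ← Real.rpow_natCast, ← Real.rpow_mul (abs_nonneg _)]
        congr 3; push_cast; ring

lemma kp_pow_split (a s : ℝ) (ha : 0 ≤ a) (hs : 2 < s) : a * a ^ (s - 2) = a ^ (s - 1) := by
  nth_rw 1 [← Real.rpow_one a]
  rw [← Real.rpow_add_of_nonneg ha (by norm_num) (by linarith)]
  congr 1; ring

/-- Truncated Strichartz estimate. -/
lemma kp_trunc (α r δ : ℝ) (hr : 2 < r) (hδ : δ = 1 - 2 / r) : ∃ C : ℝ, 0 < C ∧ ∀ (v : ℝ × ℝ → ℂ), Measurable v →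
    Integrable (fun p : ℝ × ℝ => ((|p.1| ^ (δ / 2) : ℝ) : ℂ) * v p) → ∀ (U : ℝ → ℝ × ℝ → ℂ),
    U = kpEv α (fun p : ℝ × ℝ => ((|p.1| ^ (δ / 2) : ℝ) : ℂ) * v p) →
    ∀ (T κ : ℝ) (K : Set (ℝ × ℝ)), T < 1 → 0 < κ → MeasurableSet K → volume K < ∞ → 
    ∀ (N : ℝ → ℝ) (E : Set ℝ), N = (fun t => ∫ x in K, ‖U t x‖ ^ r) → E = Set.Ioo (-T) T ∩ {t | κ < N t} →
    (∫⁻ t in E, ENNReal.ofReal (N t ^ (2 / (r - 2)))) ^ (δ / 2) ≤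
      ENNReal.ofReal C * (∫⁻ p, ‖v p‖ₑ ^ 2) ^ (1 / 2 : ℝ) := by
  have hr0 : 0 < r := by linarith
  have hδ0 : 0 < δ := by
    rw [hδ, sub_pos, div_lt_one hr0]; exact hr
  have hδ1 : δ < 1 := by
    have : 0 < 2 / r := by positivity
    linarith
  obtain ⟨C, hC, hdual⟩ := kp_dual α δ hδ0 hδ1
  refine ⟨C ^ (1 / 2 : ℝ), by positivity, ?_⟩
  intro v hv hi U hU T κ K hT hκ hKm hK N E hN hE
  set m : ℝ := 2 / (r - 2) with hm
  have hr2 : 0 < r - 2 := by linarith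
  have hm0 : 0 < m := by positivity
  have hUm : Measurable (Function.uncurry U) := by
    rw [hU]; exact kpEv_meas α _ (by fun_prop)
  set BU := ∫ p : ℝ × ℝ, ‖((|p.1| ^ (δ / 2) : ℝ) : ℂ) * v p‖ with hBU
  have hUb : ∀ t x, ‖U t x‖ ≤ BU := fun t x => by rw [hU]; exact kpEv_bd α _ t x
  have hBU0 : 0 ≤ BU := (norm_nonneg _).trans (hUb 0 0)
  have hN0 : ∀ t, 0 ≤ N t := fun t => by rw [hN]; exact integral_nonneg fun x => by positivity
  have hUr : ∀ t x, ‖U t x‖ ^ r ≤ BU ^ r := fun t x =>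
    Real.rpow_le_rpow (norm_nonneg _) (hUb t x) hr0.le
  have hNb : ∀ t, N t ≤ BU ^ r * volume.real K := by
    intro t
    have := norm_setIntegral_le_of_norm_le_const (μ := (volume : Measure (ℝ × ℝ))) (s := K)
      (f := fun x => ‖U t x‖ ^ r) (C := BU ^ r) hK (fun x _ => by
        rw [Real.norm_of_nonneg (by positivity)]; exact hUr t x)
    rw [hN]
    exact (le_abs_self _).trans this
  have hNm : Measurable N := by
    rw [hN]
    apply StronglyMeasurable.measurable
    apply StronglyMeasurable.integral_prod_right' (f := fun q : ℝ × (ℝ × ℝ) => ‖U q.1 q.2‖ ^ r)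
    exact (hUm.norm.pow_const r).stronglyMeasurable
  have hEm : MeasurableSet E := by
    rw [hE]; exact measurableSet_Ioo.inter (measurableSet_lt measurable_const hNm)
  have hEsub : E ⊆ Set.Ioo (-1 : ℝ) 1 := by
    rw [hE]; intro t ht
    exact ⟨by linarith [ht.1.1], by linarith [ht.1.2]⟩
  have hEN : ∀ t ∈ E, κ < N t := by rw [hE]; intro t ht; exact ht.2
  classical
  set F : ℝ → ℝ × ℝ → ℂ := fun t x => if t ∈ E ∧ x ∈ K then
    (starRingEnd ℂ) (U t x) * ((‖U t x‖ ^ (r - 2) * N t ^ (m - 1) : ℝ) : ℂ) else 0 with hFdef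
  have hFm : Measurable (Function.uncurry F) := by
    have hS : MeasurableSet {z : ℝ × (ℝ × ℝ) | z.1 ∈ E ∧ z.2 ∈ K} :=
      (measurable_fst hEm).inter (measurable_snd hKm)
    refine Measurable.ite hS ?_ measurable_const
    have a1 : Measurable (fun z : ℝ × (ℝ × ℝ) => U z.1 z.2) := hUm
    have a2 : Measurable (fun z : ℝ × (ℝ × ℝ) => N z.1) := hNm.comp measurable_fst
    have a3 := kp_conj_measurable a1
    fun_prop
  have hFn : ∀ t x, t ∈ E → x ∈ K → ‖F t x‖ = ‖U t x‖ ^ (r - 1) * N t ^ (m - 1) := by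
    intro t x ht hx
    simp only [hFdef]
    rw [if_pos ⟨ht, hx⟩, norm_mul, RCLike.norm_conj, Complex.norm_real,
      Real.norm_of_nonneg (mul_nonneg (by positivity) (Real.rpow_nonneg (hN0 t) _)), ← mul_assoc,
      kp_pow_split _ _ (norm_nonneg _) hr]
  have hFE : ∀ t x, t ∉ E → F t x = 0 := by
    intro t x ht; simp only [hFdef]; rw [if_neg (fun h => ht h.1)]
  have hFK : ∀ t x, x ∉ K → F t x = 0 := by
    intro t x ht; simp only [hFdef]; rw [if_neg (fun h => ht h.2)]
  set B : ℝ := BU ^ (r - 1) * (κ ^ (m - 1) + (BU ^ r * volume.real K) ^ (m - 1)) with hBdef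
  have hFB : ∀ t x, ‖F t x‖ ≤ B := by
    intro t x
    have hB0 : 0 ≤ B := by positivity
    by_cases ht : t ∈ E
    · by_cases hx : x ∈ K
      · rw [hFn t x ht hx]
        refine mul_le_mul (Real.rpow_le_rpow (norm_nonneg _) (hUb t x) (by linarith)) ?_
          (Real.rpow_nonneg (hN0 t) _) (by positivity)
        have p1 : 0 ≤ κ ^ (m - 1) := by positivity
        have p2 : 0 ≤ (BU ^ r * volume.real K) ^ (m - 1) := by positivity
        rcases le_total 0 (m - 1) with h | h
        · have := Real.rpow_le_rpow (hN0 t) (hNb t) h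
          linarith
        · have := Real.rpow_le_rpow_of_nonpos hκ (hEN t ht).le h
          linarith
      · rw [hFK t x hx, norm_zero]; exact hB0
    · rw [hFE t x ht, norm_zero]; exact hB0
  set ρ : ℝ := r / (2 * (r - 1)) with hρ
  have hr1 : 0 < r - 1 := by linarith
  have hρ0 : 0 < ρ := by positivity
  have hρδ : ρ * (1 + δ) = 1 := by rw [hρ, hδ]; field_simp; ring
  -- the norm of F
  have hφE : ∀ t ∈ E, (∫ x, ‖F t x‖ ^ (2 * ρ)) ^ ((1 + δ) / 2) = N t ^ (m - 1 / r) := by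
    intro t ht
    have hNp : 0 < N t := hκ.trans (hEN t ht)
    have e1 : ∫ x, ‖F t x‖ ^ (2 * ρ) = ∫ x in K, ‖F t x‖ ^ (2 * ρ) := by
      rw [setIntegral_eq_integral_of_forall_compl_eq_zero]
      intro x hx
      rw [hFK t x hx, norm_zero, Real.zero_rpow (by positivity)]
    have e2 : ∫ x in K, ‖F t x‖ ^ (2 * ρ) = ∫ x in K, ‖U t x‖ ^ r * N t ^ ((m - 1) * (2 * ρ)) := by
      refine setIntegral_congr_fun hKm fun x hx => ?_
      rw [hFn t x ht hx, Real.mul_rpow (by positivity) (Real.rpow_nonneg hNp.le _), ← Real.rpow_mul (norm_nonneg _),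
        ← Real.rpow_mul hNp.le]
      congr 2
      rw [hρ]; field_simp
    rw [e1, e2, integral_mul_const]
    have e3 : ∫ x in K, ‖U t x‖ ^ r = N t := by rw [hN]
    rw [e3]
    nth_rw 1 [← Real.rpow_one (N t)]
    rw [← Real.rpow_add hNp, ← Real.rpow_mul hNp.le]
    congr 1
    rw [hρ, hm, hδ]; field_simp; ring
  have hφE' : ∀ t, t ∉ E → (∫ x, ‖F t x‖ ^ (2 * ρ)) ^ ((1 + δ) / 2) = 0 := by
    intro t ht
    have : ∀ x, ‖F t x‖ ^ (2 * ρ) = 0 := fun x => by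
      rw [hFE t x ht, norm_zero, Real.zero_rpow (by positivity)]
    simp only [this, integral_zero]
    exact Real.zero_rpow (by linarith)
  have h2δ : 0 < 2 - δ := by linarith
  set Q := ∫⁻ t in E, ENNReal.ofReal (N t ^ m) with hQ
  have hφQ : ∫⁻ t, ENNReal.ofReal ((∫ x, ‖F t x‖ ^ (2 * ρ)) ^ ((1 + δ) / 2)) ^ (2 / (2 - δ)) = Q := by
    rw [hQ, ← lintegral_indicator hEm]
    congr 1; ext t
    by_cases ht : t ∈ E
    · rw [Set.indicator_of_mem ht, hφE t ht, ENNReal.ofReal_rpow_of_nonneg (Real.rpow_nonneg (hN0 t) _) (by positivity),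
        ← Real.rpow_mul (hN0 t)]
      congr 2
      rw [hm, hδ]
      have : 2 - (1 - 2 / r) = (r + 2) / r := by field_simp; ring
      rw [this]; field_simp; ring
    · rw [Set.indicator_of_notMem ht, hφE' t ht, ENNReal.ofReal_zero, ENNReal.zero_rpow_of_pos (by positivity)]
  have hQtop : Q ≠ ∞ := by
    have : Q ≤ ENNReal.ofReal ((BU ^ r * volume.real K) ^ m) * volume E := by
      rw [← setLIntegral_const]
      refine lintegral_mono fun t => ENNReal.ofReal_le_ofReal ?_
      exact Real.rpow_le_rpow (hN0 t) (hNb t) hm0.le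
    refine ne_top_of_le_ne_top (ENNReal.mul_ne_top ENNReal.ofReal_ne_top ?_) this
    refine ne_top_of_le_ne_top ?_ (measure_mono hEsub)
    simp
  rcases eq_or_ne Q 0 with hQ0 | hQ0
  · rw [hQ0, ENNReal.zero_rpow_of_pos (by positivity)]; exact zero_le
  have hQp : 0 < Q.toReal := ENNReal.toReal_pos hQ0 hQtop
  have hQe : ENNReal.ofReal Q.toReal = Q := ENNReal.ofReal_toReal hQtop
  have hD := hdual F B K ρ Q.toReal hFm hFB hKm hK hFK hρ0 hρδ hQp (by rw [hφQ, hQe])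
  have hP := kp_pair_le α δ hδ0 v hv hi F B K hFm hFB hK hFK _ hD
  rw [← hU] at hP
  -- identify the pairing
  have hFU : ∀ z : ℝ × (ℝ × ℝ), F z.1 z.2 * U z.1 z.2 = ((‖F z.1 z.2‖ * ‖U z.1 z.2‖ : ℝ) : ℂ) := by
    intro z
    by_cases hz : z.1 ∈ E ∧ z.2 ∈ K
    · rw [hFn _ _ hz.1 hz.2]
      simp only [hFdef]
      rw [if_pos hz, ← kp_pow_split _ _ (norm_nonneg _) hr, mul_right_comm, mul_comm _ (U z.1 z.2), Complex.mul_conj']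
      push_cast; ring
    · have : F z.1 z.2 = 0 := by simp only [hFdef]; rw [if_neg hz]
      rw [this]; simp
  have hFi := kp_F_integrable F B K hFm hFB hK hFK
  have hFUi : Integrable (fun z : ℝ × (ℝ × ℝ) => ‖F z.1 z.2‖ * ‖U z.1 z.2‖)
      ((volume.restrict (Set.Ioo (-1 : ℝ) 1)).prod volume) := by
    refine hFi.norm.mul_bdd (c := BU) hUm.norm.aestronglyMeasurable ?_
    refine Filter.Eventually.of_forall fun z => ?_
    rw [norm_norm]; exact hUb _ _
  have hpairQ : ‖∫ z : ℝ × (ℝ × ℝ), F z.1 z.2 * U z.1 z.2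
      ∂((volume.restrict (Set.Ioo (-1 : ℝ) 1)).prod volume)‖ₑ = Q := by
    simp_rw [hFU]
    rw [integral_complex_ofReal, ← ofReal_norm, Complex.norm_real, Real.norm_of_nonneg
      (integral_nonneg fun z => by positivity),
      ofReal_integral_eq_lintegral_ofReal hFUi (Filter.Eventually.of_forall fun z => by positivity),
      lintegral_prod _ (by
        have a1 : Measurable (fun z : ℝ × (ℝ × ℝ) => ‖F z.1 z.2‖) := hFm.norm
        have a2 : Measurable (fun z : ℝ × (ℝ × ℝ) => ‖U z.1 z.2‖) := hUm.norm
        exact (a1.mul a2).ennreal_ofReal.aemeasurable)]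
    have hin : ∀ t, ∫⁻ x, ENNReal.ofReal (‖F t x‖ * ‖U t x‖) = E.indicator (fun t => ENNReal.ofReal (N t ^ m)) t := by
      intro t
      by_cases ht : t ∈ E
      · have hNp : 0 < N t := hκ.trans (hEN t ht)
        rw [Set.indicator_of_mem ht]
        have e1 : ∀ x, ENNReal.ofReal (‖F t x‖ * ‖U t x‖) =
            K.indicator (fun x => ENNReal.ofReal (N t ^ (m - 1)) * ENNReal.ofReal (‖U t x‖ ^ r)) x := by
          intro x
          by_cases hx : x ∈ K
          · rw [Set.indicator_of_mem hx, hFn t x ht hx, ← ENNReal.ofReal_mul (by positivity)]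
            congr 1
            have : ‖U t x‖ ^ r = ‖U t x‖ ^ (r - 1) * ‖U t x‖ := by
              nth_rw 3 [← Real.rpow_one ‖U t x‖]
              rw [← Real.rpow_add_of_nonneg (norm_nonneg _) hr1.le (by norm_num)]
              congr 1; ring
            rw [this]; ring
          · rw [Set.indicator_of_notMem hx, hFK t x hx]; simp
        simp_rw [e1]
        rw [lintegral_indicator hKm, lintegral_const_mul' _ _ ENNReal.ofReal_ne_top,
          ← ofReal_integral_eq_lintegral_ofReal _ (Filter.Eventually.of_forall fun x => by positivity)]
        · have e3 : ∫ x in K, ‖U t x‖ ^ r = N t := by rw [hN]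
          rw [e3, ← ENNReal.ofReal_mul (by positivity)]
          congr 1
          nth_rw 2 [← Real.rpow_one (N t)]
          rw [← Real.rpow_add hNp]; congr 1; ring
        · refine Measure.integrableOn_of_bounded (M := BU ^ r) hK.ne
            ((hUm.of_uncurry_left (x := t)).norm.pow_const r).aestronglyMeasurable
            (Filter.Eventually.of_forall fun x => ?_)
          rw [Real.norm_of_nonneg (by positivity)]; exact hUr t x
      · rw [Set.indicator_of_notMem ht]
        simp [hFE t _ ht]
    simp_rw [hin]
    rw [lintegral_indicator hEm, Measure.restrict_restrict hEm, Set.inter_eq_left.2 hEsub]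
  rw [hpairQ] at hP
  -- conclude
  set V := (∫⁻ p, ‖v p‖ₑ ^ 2) ^ (1 / 2 : ℝ) with hV
  rw [ENNReal.ofReal_mul hC.le, ENNReal.mul_rpow_of_nonneg _ _ (by norm_num),
    ← ENNReal.ofReal_rpow_of_pos hQp, hQe, ← ENNReal.rpow_mul] at hP
  have hsplit : Q = Q ^ (δ / 2) * Q ^ ((2 - δ) * (1 / 2)) := by
    rw [← ENNReal.rpow_add _ _ hQ0 hQtop, show δ / 2 + (2 - δ) * (1 / 2) = 1 by ring, ENNReal.rpow_one]
  have hP2 : Q ^ (δ / 2) * Q ^ ((2 - δ) * (1 / 2)) ≤ (V * ENNReal.ofReal C ^ (1 / 2 : ℝ)) * Q ^ ((2 - δ) * (1 / 2)) := by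
    rw [← hsplit, mul_assoc]; exact hP
  have hX0 : Q ^ ((2 - δ) * (1 / 2)) ≠ 0 := by
    simp [ENNReal.rpow_eq_zero_iff, hQ0, hQtop]
  have hXt : Q ^ ((2 - δ) * (1 / 2)) ≠ ∞ := ENNReal.rpow_ne_top_of_nonneg (by linarith) hQtop
  rw [ENNReal.mul_le_mul_iff_left hX0 hXt] at hP2
  rw [← ENNReal.ofReal_rpow_of_pos hC, mul_comm]
  exact hP2


/-- Passage to the limit in the truncated estimate. -/
lemma kp_untrunc (α r δ : ℝ) (hr : 2 < r) (hδ : δ = 1 - 2 / r) : ∃ C : ℝ, 0 < C ∧ ∀ (v : ℝ × ℝ → ℂ), Measurable v →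
    Integrable (fun p : ℝ × ℝ => ((|p.1| ^ (δ / 2) : ℝ) : ℂ) * v p) → ∀ (U : ℝ → ℝ × ℝ → ℂ),
    U = kpEv α (fun p : ℝ × ℝ => ((|p.1| ^ (δ / 2) : ℝ) : ℂ) * v p) → ∀ T : ℝ, T < 1 →
    (∫⁻ t in Set.Ioo (-T) T, (∫⁻ x, ‖U t x‖ₑ ^ r) ^ (2 / (r - 2))) ^ (δ / 2) ≤
      ENNReal.ofReal C * (∫⁻ p, ‖v p‖ₑ ^ 2) ^ (1 / 2 : ℝ) := by
  have hr0 : 0 < r := by linarith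
  have hδ0 : 0 < δ := by
    rw [hδ, sub_pos, div_lt_one hr0]; exact hr
  have hr2 : 0 < r - 2 := by linarith
  have hs : 0 < 2 / (r - 2) := by positivity
  set s : ℝ := 2 / (r - 2) with hsdef
  obtain ⟨C, hC, htr⟩ := kp_trunc α r δ hr hδ
  refine ⟨C, hC, ?_⟩
  intro v hv hi U hU T hT
  set R : ℝ≥0∞ := ENNReal.ofReal C * (∫⁻ p, ‖v p‖ₑ ^ 2) ^ (1 / 2 : ℝ) with hR
  have hmeasU : Measurable (Function.uncurry U) := by
    rw [hU]; exact kpEv_meas α _ (by fun_prop)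
  have hUt : ∀ t, Measurable (U t) := fun t => hmeasU.comp (by fun_prop : Measurable fun x => (t, x))
  set B : ℝ := ∫ p : ℝ × ℝ, ‖((|p.1| ^ (δ / 2) : ℝ) : ℂ) * v p‖ with hB
  have hUB : ∀ t x, ‖U t x‖ ≤ B := fun t x => by rw [hU]; exact kpEv_bd α _ t x
  let K : ℕ → Set (ℝ × ℝ) := fun n => Metric.closedBall 0 (n : ℝ)
  let J : ℕ → ℝ → ℝ≥0∞ := fun n t => ∫⁻ x in K n, ‖U t x‖ₑ ^ r
  let κ : ℕ → ℝ := fun n => 1 / ((n : ℝ) + 1)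
  have hκ : ∀ n, 0 < κ n := fun n => by positivity
  have hKm : ∀ n, MeasurableSet (K n) := fun n => Metric.isClosed_closedBall.measurableSet
  have hKf : ∀ n, volume (K n) < ∞ := fun n => measure_closedBall_lt_top
  have hJm : ∀ n, Measurable (J n) := fun n =>
    Measurable.lintegral_prod_right' (f := fun z : ℝ × (ℝ × ℝ) => ‖U z.1 z.2‖ₑ ^ r)
      ((hmeasU.enorm).pow_const r)
  have hJN : ∀ n t, ENNReal.ofReal (∫ x in K n, ‖U t x‖ ^ r) = J n t := by
    intro n t
    rw [ofReal_integral_eq_lintegral_ofReal]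
    · refine lintegral_congr fun x => ?_
      rw [← ENNReal.ofReal_rpow_of_nonneg (norm_nonneg _) hr0.le, ofReal_norm_eq_enorm]
    · have : IsFiniteMeasure (volume.restrict (K n)) := ⟨by simpa using hKf n⟩
      refine Integrable.of_bound (C := B ^ r) ((hUt t).norm.pow_const r).aestronglyMeasurable ?_
      refine Filter.Eventually.of_forall fun x => ?_
      rw [Real.norm_of_nonneg (by positivity)]
      exact Real.rpow_le_rpow (norm_nonneg _) (hUB t x) hr0.le
    · exact Filter.Eventually.of_forall fun x => by positivity
  have hJt : ∀ t, Filter.Tendsto (fun n => J n t) Filter.atTop (nhds (∫⁻ x, ‖U t x‖ₑ ^ r)) := by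
    intro t
    have h1 : ∀ n, J n t = ∫⁻ x, (K n).indicator (fun x => ‖U t x‖ₑ ^ r) x := fun n =>
      (lintegral_indicator (hKm n) _).symm
    simp only [h1]
    refine lintegral_tendsto_of_tendsto_of_monotone (fun n => ?_) ?_ ?_
    · exact ((((hUt t).enorm).pow_const r).indicator (hKm n)).aemeasurable
    · refine Filter.Eventually.of_forall fun x m n hmn => ?_
      refine Set.indicator_le_indicator_of_subset (Metric.closedBall_subset_closedBall (by exact_mod_cast hmn)) (fun _ => zero_le) x
    · refine Filter.Eventually.of_forall fun x => ?_
      refine tendsto_const_nhds.congr' ?_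
      obtain ⟨m, hm⟩ := exists_nat_ge ‖x‖
      filter_upwards [Filter.eventually_ge_atTop m] with n hn
      rw [Set.indicator_of_mem]
      simp only [K, Metric.mem_closedBall, dist_zero_right]
      exact hm.trans (by exact_mod_cast hn)
  let a : ℕ → ℝ → ℝ≥0∞ := fun n => {t | ENNReal.ofReal (κ n) < J n t}.indicator (fun t => J n t ^ s)
  have hSm : ∀ n, MeasurableSet {t | ENNReal.ofReal (κ n) < J n t} := fun n =>
    measurableSet_lt measurable_const (hJm n)
  have ham : ∀ n, Measurable (a n) := fun n => ((hJm n).pow_const s).indicator (hSm n)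
  have hlim : ∀ t, (∫⁻ x, ‖U t x‖ₑ ^ r) ^ s ≤ Filter.liminf (fun n => a n t) Filter.atTop := by
    intro t
    rcases eq_or_ne (∫⁻ x, ‖U t x‖ₑ ^ r) 0 with h0 | h0
    · rw [h0, ENNReal.zero_rpow_of_pos hs]; exact zero_le
    · obtain ⟨c, hc0, hc⟩ := exists_between (pos_iff_ne_zero.2 h0)
      have hκt : Filter.Tendsto (fun n => ENNReal.ofReal (κ n)) Filter.atTop (nhds 0) := by
        have := ENNReal.tendsto_ofReal (tendsto_one_div_add_atTop_nhds_zero_nat (𝕜 := ℝ))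
        simpa [κ] using this
      have hev : ∀ᶠ n in Filter.atTop, J n t ^ s = a n t := by
        filter_upwards [(hJt t).eventually (lt_mem_nhds hc), hκt.eventually (gt_mem_nhds hc0)] with n h1 h2
        simp only [a]
        rw [Set.indicator_of_mem]
        exact h2.trans h1
      have ht : Filter.Tendsto (fun n => a n t) Filter.atTop (nhds ((∫⁻ x, ‖U t x‖ₑ ^ r) ^ s)) :=
        (((ENNReal.continuous_rpow_const (y := s)).tendsto _).comp (hJt t)).congr' hev
      exact ht.liminf_eq.ge
  have hbd : ∀ n, ∫⁻ t in Set.Ioo (-T) T, a n t ≤ R ^ (2 / δ) := by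
    intro n
    have := htr v hv hi U hU T (κ n) (K n) hT (hκ n) (hKm n) (hKf n) _ _ rfl rfl
    have e : ∫⁻ t in Set.Ioo (-T) T, a n t =
        ∫⁻ t in Set.Ioo (-T) T ∩ {t | κ n < ∫ x in K n, ‖U t x‖ ^ r}, ENNReal.ofReal ((∫ x in K n, ‖U t x‖ ^ r) ^ s) := by
      have hset : {t | ENNReal.ofReal (κ n) < J n t} = {t | κ n < ∫ x in K n, ‖U t x‖ ^ r} := by
        ext t
        simp only [Set.mem_setOf_eq]
        rw [← hJN, ENNReal.ofReal_lt_ofReal_iff_of_nonneg (hκ n).le]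
      simp only [a]
      rw [lintegral_indicator (hSm n), Measure.restrict_restrict (hSm n), Set.inter_comm, hset]
      refine lintegral_congr fun t => ?_
      rw [← hJN, ENNReal.ofReal_rpow_of_nonneg (integral_nonneg fun x => by positivity) hs.le]
    rw [← e] at this
    calc ∫⁻ t in Set.Ioo (-T) T, a n t = ((∫⁻ t in Set.Ioo (-T) T, a n t) ^ (δ / 2)) ^ (2 / δ) := by
          rw [← ENNReal.rpow_mul, show δ / 2 * (2 / δ) = 1 by field_simp, ENNReal.rpow_one]
      _ ≤ R ^ (2 / δ) := ENNReal.rpow_le_rpow this (by positivity)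
  have hfin : ∫⁻ t in Set.Ioo (-T) T, (∫⁻ x, ‖U t x‖ₑ ^ r) ^ s ≤ R ^ (2 / δ) :=
    calc ∫⁻ t in Set.Ioo (-T) T, (∫⁻ x, ‖U t x‖ₑ ^ r) ^ s
        ≤ ∫⁻ t in Set.Ioo (-T) T, Filter.liminf (fun n => a n t) Filter.atTop := lintegral_mono hlim
      _ ≤ Filter.liminf (fun n => ∫⁻ t in Set.Ioo (-T) T, a n t) Filter.atTop := lintegral_liminf_le ham
      _ ≤ R ^ (2 / δ) := Filter.liminf_le_of_le (by isBoundedDefault) (fun b hb => by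
          obtain ⟨n, hn⟩ := hb.exists
          exact hn.trans (hbd n))
  calc (∫⁻ t in Set.Ioo (-T) T, (∫⁻ x, ‖U t x‖ₑ ^ r) ^ s) ^ (δ / 2) ≤ (R ^ (2 / δ)) ^ (δ / 2) :=
        ENNReal.rpow_le_rpow hfin (by positivity)
    _ = R := by rw [← ENNReal.rpow_mul, show 2 / δ * (δ / 2) = 1 by field_simp, ENNReal.rpow_one]

lemma kp_c_le : ‖(1 / (2 * Real.pi) : ℂ)‖ₑ ^ 2 * ENNReal.ofReal ((2 * Real.pi) ^ 2) = 1 := by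
  have h : ‖(1 / (2 * Real.pi) : ℂ)‖ = 1 / (2 * Real.pi) := by
    simp [abs_of_pos Real.pi_pos]
  rw [← ofReal_norm_eq_enorm, h, ← ENNReal.ofReal_pow (by positivity), ← ENNReal.ofReal_mul (by positivity)]
  rw [show (1 / (2 * Real.pi)) ^ 2 * (2 * Real.pi) ^ 2 = 1 by field_simp [Real.pi_ne_zero]]
  simp

lemma kp_ft2_eq (u : ℝ × ℝ → ℂ) (p : ℝ × ℝ) : ft2 u p.1 p.2 = (1 / (2 * Real.pi)) * kpFm u p := rfl

lemma kp_ft2_meas (u : ℝ × ℝ → ℂ) (hm : Measurable u) : Measurable (fun p : ℝ × ℝ => ft2 u p.1 p.2) := by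
  simp only [kp_ft2_eq]
  exact (kpFm_meas u hm).const_mul _

lemma kp_ft2_L2 (u : ℝ × ℝ → ℂ) (hu : Integrable u) (hm : Measurable u) :
    ∫⁻ p : ℝ × ℝ, ‖ft2 u p.1 p.2‖ₑ ^ 2 ≤ ∫⁻ x, ‖u x‖ₑ ^ 2 := by
  simp only [kp_ft2_eq, enorm_mul, mul_pow]
  rw [lintegral_const_mul _ ((kpFm_meas u hm).enorm.pow_const 2)]
  calc _ ≤ ‖(1 / (2 * Real.pi) : ℂ)‖ₑ ^ 2 * (ENNReal.ofReal ((2 * Real.pi) ^ 2) * ∫⁻ x, ‖u x‖ₑ ^ 2) := by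
        gcongr; exact kp_besselm u hu hm
    _ = _ := by rw [← mul_assoc, kp_c_le, one_mul]

lemma kp_S_eq (α σ : ℝ) (u : ℝ × ℝ → ℂ) (t : ℝ) (x : ℝ × ℝ) : SfreeDx α σ u t x.1 x.2 =
    (1 / (2 * Real.pi)) * kpEv α (fun p : ℝ × ℝ => ((|p.1| ^ σ : ℝ) : ℂ) * ft2 u p.1 p.2) t x := rfl

lemma kp_ev_undef (α : ℝ) (h : ℝ × ℝ → ℂ) (hm : Measurable h) (hi : ¬ Integrable h) (t : ℝ) (x : ℝ × ℝ) :
    kpEv α h t x = 0 := by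
  unfold kpEv
  refine integral_undef fun hc => hi ?_
  refine hc.mono hm.aestronglyMeasurable (Filter.Eventually.of_forall fun p => ?_)
  rw [norm_mul, kp_normE, mul_one]

lemma kp_L2_ev (α : ℝ) (h : ℝ × ℝ → ℂ) (hm : Measurable h) (hi : Integrable h) (t : ℝ) :
    ∫⁻ x, ‖kpEv α h t x‖ₑ ^ 2 ≤ ENNReal.ofReal ((2 * Real.pi) ^ 2) * ∫⁻ x, ‖h x‖ₑ ^ 2 := by
  let g : ℝ × ℝ → ℂ := fun p => h p * Complex.exp (Complex.I * ((t * omega5 α p.1 p.2 : ℝ) : ℂ))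
  have hgm : Measurable g := by
    have : Measurable (fun p : ℝ × ℝ => Complex.exp (Complex.I * ((t * omega5 α p.1 p.2 : ℝ) : ℂ))) := by
      unfold omega5; fun_prop
    exact hm.mul this
  have hgn : ∀ p, ‖g p‖ = ‖h p‖ := fun p => by
    simp only [g]; rw [norm_mul, kp_normE, mul_one]
  have hgi : Integrable g := hi.mono hgm.aestronglyMeasurable (Filter.Eventually.of_forall fun p => (hgn p).le)
  have e : ∀ x, kpEv α h t x = kpFT g x := by
    intro x
    unfold kpEv kpFT
    refine integral_congr_ae (Filter.Eventually.of_forall fun p => ?_)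
    simp only [g]
    rw [mul_assoc, ← Complex.exp_add]
    congr 2
    push_cast
    ring
  simp only [e]
  refine (kp_bessel g hgi hgm).trans (le_of_eq ?_)
  congr 1
  refine lintegral_congr fun p => ?_
  rw [← ofReal_norm_eq_enorm, hgn, ofReal_norm_eq_enorm]

lemma kp_eL2 (f : ℝ × ℝ → ℂ) : eLpNorm f 2 volume = (∫⁻ x, ‖f x‖ₑ ^ 2) ^ (1 / 2 : ℝ) := by
  rw [eLpNorm_eq_lintegral_rpow_enorm_toReal (by norm_num) (by norm_num)]
  simp

lemma kp_eLr (f : ℝ × ℝ → ℂ) (r : ℝ) (hr : 0 < r) :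
    eLpNorm f (ENNReal.ofReal r) volume = (∫⁻ x, ‖f x‖ₑ ^ r) ^ (1 / r) := by
  rw [eLpNorm_eq_lintegral_rpow_enorm_toReal (by simpa using hr) (by simp), ENNReal.toReal_ofReal hr.le]

lemma kp_final_two (α : ℝ) (u : ℝ × ℝ → ℂ) (hu : Integrable u) (hm : Measurable u) (t : ℝ) :
    eLpNorm (fun x : ℝ × ℝ => SfreeDx α 0 u t x.1 x.2) 2 volume ≤ eLpNorm u 2 volume := by
  simp only [kp_S_eq, Real.rpow_zero, Complex.ofReal_one, one_mul]
  have hvm := kp_ft2_meas u hm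
  set v := fun p : ℝ × ℝ => ft2 u p.1 p.2 with hv
  by_cases hi : Integrable v
  · rw [kp_eL2, kp_eL2]
    refine ENNReal.rpow_le_rpow ?_ (by norm_num)
    simp only [enorm_mul, mul_pow]
    rw [lintegral_const_mul']
    · calc _ ≤ ‖(1 / (2 * Real.pi) : ℂ)‖ₑ ^ 2 * (ENNReal.ofReal ((2 * Real.pi) ^ 2) * ∫⁻ x, ‖v x‖ₑ ^ 2) := by
            gcongr; exact kp_L2_ev α v hvm hi t
        _ = ∫⁻ x, ‖v x‖ₑ ^ 2 := by rw [← mul_assoc, kp_c_le, one_mul]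
        _ ≤ _ := kp_ft2_L2 u hu hm
    · exact ENNReal.pow_ne_top enorm_ne_top
  · have : ∀ x, kpEv α v t x = 0 := kp_ev_undef α v hvm hi t
    simp [this]

lemma kp_final_r (α r : ℝ) (hr : 2 < r) : ∃ C : ℝ, 0 < C ∧ ∀ T : ℝ, T < 1 → ∀ u : ℝ × ℝ → ℂ,
    Integrable u → Measurable u → (∫⁻ t in Set.Ioo (-T) T,
      (eLpNorm (fun x : ℝ × ℝ => SfreeDx α (delta r / 2) u t x.1 x.2)
        (ENNReal.ofReal r) volume) ^ (2 / delta r)) ^ (delta r / 2)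
      ≤ ENNReal.ofReal C * eLpNorm u 2 volume := by
  have hr0 : 0 < r := by linarith
  have hδ : delta r = 1 - 2 / r := by unfold delta; ring
  have hδ0 : 0 < delta r := by
    rw [hδ, sub_pos, div_lt_one hr0]; exact hr
  obtain ⟨C, hC, hmain⟩ := kp_untrunc α r (delta r) hr hδ
  refine ⟨C, hC, fun T hT u hu hm => ?_⟩
  have hvm := kp_ft2_meas u hm
  have hL2 := kp_ft2_L2 u hu hm
  simp only [kp_S_eq]
  set v := fun p : ℝ × ℝ => ft2 u p.1 p.2 with hv
  set h := fun p : ℝ × ℝ => ((|p.1| ^ (delta r / 2) : ℝ) : ℂ) * v p with hh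
  have hhm : Measurable h := by fun_prop
  by_cases hi : Integrable h
  · have := hmain v hvm hi _ rfl T hT
    rw [kp_eL2]
    refine le_trans (ENNReal.rpow_le_rpow ?_ (by positivity)) (this.trans ?_)
    · refine lintegral_mono fun t => ?_
      rw [kp_eLr _ r hr0, ← ENNReal.rpow_mul]
      have hr2 : r - 2 ≠ 0 := by linarith
      rw [show 1 / r * (2 / delta r) = 2 / (r - 2) by rw [hδ]; field_simp]
      refine ENNReal.rpow_le_rpow (lintegral_mono fun x => ?_) (div_nonneg (by norm_num) (by linarith))
      refine ENNReal.rpow_le_rpow ?_ hr0.le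
      rw [enorm_mul]
      have hc1 : ‖(1 / (2 * Real.pi) : ℂ)‖ₑ ≤ 1 := by
        rw [← ofReal_norm_eq_enorm]
        refine ENNReal.ofReal_le_one.2 ?_
        have h : ‖(1 / (2 * Real.pi) : ℂ)‖ = 1 / (2 * Real.pi) := by
          simp [abs_of_pos Real.pi_pos]
        rw [h, div_le_one (by positivity)]
        linarith [Real.pi_gt_three]
      calc _ ≤ 1 * ‖kpEv α h t x‖ₑ := by gcongr
        _ = _ := one_mul _
    · gcongr
  · have h0 : ∀ t x, kpEv α h t x = 0 := kp_ev_undef α h hhm hi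
    have h1 : (fun x : ℝ × ℝ => (0 : ℂ)) = 0 := rfl
    simp only [h0, mul_zero, h1, eLpNorm_zero, ENNReal.zero_rpow_of_pos (show 0 < 2 / delta r by positivity),
      lintegral_zero, ENNReal.zero_rpow_of_pos (show 0 < delta r / 2 by positivity)]
    exact zero_le

/-- The Strichartz estimate for the fifth order KP-I evolution
(Proposition 2.2): `‖|D_x|^{δ(r)/2} S(t)u₀‖_{L^q_T(L^r_{x,y})} ≤ C‖u₀‖_{L²}`
with `2/q = δ(r)` (and `q = ∞` when `r = 2`). -/
theorem strichartz_estimate (α r : ℝ) (hr : 2 ≤ r) :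
    ∃ C : ℝ, 0 < C ∧
      ∀ T : ℝ, 0 < T → T < 1 → ∀ u₀ : SchwartzMap (ℝ × ℝ) ℂ,
        (r = 2 →
          essSup (fun t : ℝ =>
              eLpNorm (fun xy : ℝ × ℝ =>
                SfreeDx α (delta r / 2) (fun p => u₀ p) t xy.1 xy.2)
                (ENNReal.ofReal r) volume)
            (volume.restrict (Set.Ioo (-T) T))
            ≤ ENNReal.ofReal C * eLpNorm (fun p : ℝ × ℝ => u₀ p) 2 volume) ∧
        (2 < r →
          (∫⁻ t in Set.Ioo (-T) T,
              (eLpNorm (fun xy : ℝ × ℝ =>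
                SfreeDx α (delta r / 2) (fun p => u₀ p) t xy.1 xy.2)
                (ENNReal.ofReal r) volume) ^ (2 / delta r)) ^ (delta r / 2)
            ≤ ENNReal.ofReal C * eLpNorm (fun p : ℝ × ℝ => u₀ p) 2 volume) := by
  rcases hr.eq_or_lt with h2 | h2
  · subst h2
    refine ⟨1, one_pos, fun T _ _ u₀ => ⟨fun _ => ?_, fun h => absurd h (lt_irrefl _)⟩⟩
    refine essSup_le_of_ae_le _ (Filter.Eventually.of_forall fun t => ?_)
    have hd : delta 2 / 2 = 0 := by unfold delta; norm_num
    have ht : ENNReal.ofReal 2 = 2 := by norm_num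
    simp only [hd, ht, ENNReal.ofReal_one, one_mul]
    exact kp_final_two α (fun p => u₀ p) u₀.integrable u₀.continuous.measurable t
  · obtain ⟨C, hC, hmain⟩ := kp_final_r α r h2
    refine ⟨C, hC, fun T _ hT u₀ => ⟨fun h => absurd h h2.ne', fun _ => ?_⟩⟩
    exact hmain T hT (fun p => u₀ p) u₀.integrable u₀.continuous.measurable
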